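/- For even d = 2k, the algebraic boundary of the region of real binary forms of rank k+1 (minimal typical rank) equals the union of the two dual hypersurfaces (Δ_{(3,3,2^{k−3})})^∨ ∪ (Δ_{(4,2^{k−2})})^∨ in ℙ(ℂ[x,y]_d). -/

import Mathlib

open MvPolynomial

noncomputable section

/-- The Zariski closure of a subset of the affine space `σ → K`. -/
def zClosure {K : Type} [Field K] {σ : Type} [Fintype σ] [DecidableEq σ]
    (S : Set (σ → K)) : Set (σ → K) :=
  {x | ∀ p : MvPolynomial σ K, (∀ y ∈ S, eval y p = 0) → eval x p = 0}

/-- A subset of affine space is Zariski closed if it equals its Zariski closure. -/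
def zClosed {K : Type} [Field K] {σ : Type} [Fintype σ] [DecidableEq σ]
    (S : Set (σ → K)) : Prop :=
  zClosure S = S

/-- Irreducibility of a subset of affine space in the Zariski topology,
tested against the basic open sets. -/
def zIrreducible {K : Type} [Field K] {σ : Type} [Fintype σ] [DecidableEq σ]
    (S : Set (σ → K)) : Prop :=
  S.Nonempty ∧ ∀ p q : MvPolynomial σ K,
    (∀ x ∈ S, eval x p = 0 ∨ eval x q = 0) →
    (∀ x ∈ S, eval x p = 0) ∨ (∀ x ∈ S, eval x q = 0)

/-- There is a strictly increasing chain of `m+1` irreducible Zariski-closed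
subsets contained in `S`. -/
def zChain {K : Type} [Field K] {σ : Type} [Fintype σ] [DecidableEq σ]
    (S : Set (σ → K)) (m : ℕ) : Prop :=
  ∃ c : Fin (m+1) → Set (σ → K),
    (∀ i, zIrreducible (c i) ∧ zClosed (c i) ∧ c i ⊆ S) ∧
    ∀ i j : Fin (m+1), i < j → c i ⊂ c j

/-- `S` has (Krull) dimension `m` in the Zariski topology. -/
def zDimEq {K : Type} [Field K] {σ : Type} [Fintype σ] [DecidableEq σ]
    (S : Set (σ → K)) (m : ℕ) : Prop :=
  zChain S m ∧ ¬ zChain S (m+1)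

/-- The (embedded, affine) Zariski tangent space to `S` at `a`: the common kernel of the
differentials at `a` of all polynomials vanishing on `S`. -/
def zTangentAt {K : Type} [Field K] {σ : Type} [Fintype σ] [DecidableEq σ]
    (S : Set (σ → K)) (a : σ → K) : Set (σ → K) :=
  {v | ∀ p : MvPolynomial σ K, (∀ y ∈ S, eval y p = 0) →
        ∑ i : σ, eval a (pderiv i p) * v i = 0}

/-- Dimension of the Zariski tangent space at a point. -/
def zTangentDim {K : Type} [Field K] {σ : Type} [Fintype σ] [DecidableEq σ]
    (S : Set (σ → K)) (a : σ → K) : ℕ :=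
  Module.finrank K (Submodule.span K (zTangentAt S a))

/-- The binary form of degree `r` with coefficient vector `a`. -/
def binForm {K : Type} [CommSemiring K] (r : ℕ) (a : Fin (r+1) → K) :
    MvPolynomial (Fin 2) K :=
  ∑ i : Fin (r+1), C (a i) * X 0 ^ (r - (i : ℕ)) * X 1 ^ (i : ℕ)

/-- The linear binary form `u·x + v·y`. -/
def linForm {K : Type} [CommSemiring K] (u v : K) : MvPolynomial (Fin 2) K :=
  C u * X 0 + C v * X 1

/-- The affine cone over the coincident root locus `Δ_λ ⊆ ℙ^r`, in coefficient coordinates: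
scalar multiples of forms `∏ ℓ_i ^ λ_i`. -/
def crlCone (r n : ℕ) (lam : Fin n → ℕ) : Set (Fin (r+1) → ℂ) :=
  {a | ∃ (t : ℂ) (u v : Fin n → ℂ),
    binForm r a = C t * ∏ i, (linForm (u i) (v i)) ^ lam i}

/-- `lam` is a partition of `r` of length `n` (all parts positive). -/
def isPartitionOf (r n : ℕ) (lam : Fin n → ℕ) : Prop :=
  (∀ i, 1 ≤ lam i) ∧ ∑ i, lam i = r

/-- The multiplicity `m_j` of the part `j` in the partition `lam`. -/
def multOf {n : ℕ} (lam : Fin n → ℕ) (jj : ℕ) : ℕ :=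
  (Finset.univ.filter fun i => lam i = jj).card

/-- The differential operator of degree `s` with coefficient vector `b`, i.e.
`∑ b_i ∂x^(s-i) ∂y^i`, applied to `f`. -/
def diffOp {K : Type} [CommSemiring K] (s : ℕ) (b : Fin (s+1) → K)
    (f : MvPolynomial (Fin 2) K) : MvPolynomial (Fin 2) K :=
  ∑ i : Fin (s+1), b i •
    ((fun g => pderiv (0 : Fin 2) g)^[s - (i : ℕ)]
      (((fun g => pderiv (1 : Fin 2) g)^[(i : ℕ)]) f))

/-- The apolarity pairing between a degree-`d` operator (coefficients `h`) and a
degree-`d` form (coefficients `a`). -/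
def apolarPair (d : ℕ) (h a : Fin (d+1) → ℂ) : ℂ :=
  eval (fun _ => (0 : ℂ)) (diffOp d h (binForm d a))

/-- The cone over the dual variety of the cone `S ⊆ ℂ^(m+1)` (with `k` the dimension of the
cone `S`, used to select smooth points): closure of the set of hyperplanes, written in dual
coordinates via the apolarity pairing, containing an embedded tangent space at a smooth point. -/
def dualConeOf (m : ℕ) (S : Set (Fin (m+1) → ℂ)) (k : ℕ) : Set (Fin (m+1) → ℂ) :=
  zClosure {h | h ≠ 0 ∧ ∃ a ∈ S, a ≠ 0 ∧ zTangentDim S a = k ∧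
      ∀ v ∈ zTangentAt S a, apolarPair m h v = 0}

/-- The row span of a matrix, as a subspace of `ℂ^m`. -/
def rowSpan {k m : ℕ} (M : Matrix (Fin k) (Fin m) ℂ) : Submodule ℂ (Fin m → ℂ) :=
  Submodule.span ℂ (Set.range fun i => M i)

/-- The (redundant) Plücker coordinate vector of the row span of `M`: all maximal minors. -/
def plucker {k m : ℕ} (M : Matrix (Fin k) (Fin m) ℂ) : (Fin k → Fin m) → ℂ :=
  fun s => (M.submatrix id s).det

/-- The degree-`s` component of the apolar ideal of the degree-`d` form with
coefficients `a`, as a subset of the coefficient space of operators. -/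
def apolarSet (d s : ℕ) (a : Fin (d+1) → ℂ) : Set (Fin (s+1) → ℂ) :=
  {b | diffOp s b (binForm d a) = 0}

/-- The (pre-closure) cone, in Plücker coordinates, over the `j`-th higher associated variety
`CH_j(S)`: spans of `k`-row matrices whose row space contains a smooth point `x` of the cone
`S` (`dimS` = dimension of the cone `S`) and meets the tangent space at `x` in projective
dimension at least `j`. -/
def smoothCHCone (m : ℕ) (S : Set (Fin (m+1) → ℂ)) (dimS k j : ℕ) :
    Set ((Fin k → Fin (m+1)) → ℂ) :=
  {u | ∃ M : Matrix (Fin k) (Fin (m+1)) ℂ, u = plucker M ∧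
    Module.finrank ℂ (rowSpan M) = k ∧
    ∃ x, x ≠ 0 ∧ x ∈ S ∧ zTangentDim S x = dimS ∧ x ∈ rowSpan M ∧
      j + 1 ≤ Module.finrank ℂ ↥(rowSpan M ⊓ Submodule.span ℂ (zTangentAt S x))}

/-- The (pre-closure) cone, in Plücker coordinates, over `Ξ_0(S)`: spans of `k`-row matrices
whose row space meets the cone `S` nontrivially. -/
def meetCone (m : ℕ) (S : Set (Fin (m+1) → ℂ)) (k : ℕ) :
    Set ((Fin k → Fin (m+1)) → ℂ) :=
  {u | ∃ M : Matrix (Fin k) (Fin (m+1)) ℂ, u = plucker M ∧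
    Module.finrank ℂ (rowSpan M) = k ∧ ∃ x, x ≠ 0 ∧ x ∈ S ∧ x ∈ rowSpan M}

/-- The preimage under the apolar map `Ψ_{d,s}` of a subset `T` of the Grassmannian
(in Plücker coordinates) of `(k-1)`-projective-dimensional subspaces of `ℙ(D_s)`. -/
def apolarPull (d s k : ℕ) (T : Set ((Fin k → Fin (s+1)) → ℂ)) : Set (Fin (d+1) → ℂ) :=
  {a | ∃ M : Matrix (Fin k) (Fin (s+1)) ℂ,
    rowSpan M = Submodule.span ℂ (apolarSet d s a) ∧
    Module.finrank ℂ (rowSpan M) = k ∧ plucker M ∈ T}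

/-- The Waring rank over `K` of a binary form: the least `r` such that `f` is a sum of `r`
scalar multiples of `d`-th powers of linear forms. -/
def waringRank {K : Type} [Field K] (d : ℕ) (f : MvPolynomial (Fin 2) K) : ℕ :=
  sInf {r | ∃ (α u v : Fin r → K), f = ∑ i, α i • (linForm (u i) (v i)) ^ d}

/-- The set of coefficient vectors of real binary forms of degree `d` of real rank `r`. -/
def realRankSet (d r : ℕ) : Set (Fin (d+1) → ℝ) :=
  {a | waringRank d (binForm d a) = r}

/-- `R_{d,r}`: the interior, in the Euclidean topology, of the set of real binary forms of
degree `d` and real rank `r`. -/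
def Rdr (d r : ℕ) : Set (Fin (d+1) → ℝ) := interior (realRankSet d r)

/-- The topological boundary of `R_{d,r}`: the closure of `R_{d,r}` minus the interior of
the closure. -/
def topBoundary (d r : ℕ) : Set (Fin (d+1) → ℝ) :=
  closure (Rdr d r) \ interior (closure (Rdr d r))

/-- The algebraic boundary `∂_alg(R_{d,r})`: the Zariski closure over `ℂ` of the topological
boundary of `R_{d,r}`. -/
def algBoundary (d r : ℕ) : Set (Fin (d+1) → ℂ) :=
  zClosure ((fun a i => ((a i : ℝ) : ℂ)) '' topBoundary d r)

namespace EM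

/-- polynomial with coefficient vector `a` -/
def toP {K : Type} [CommSemiring K] {n : ℕ} (a : Fin n → K) : Polynomial K :=
  ∑ i : Fin n, Polynomial.C (a i) * Polynomial.X ^ (i : ℕ)

/-- coefficient vector of a polynomial -/
def ofP {K : Type} [CommSemiring K] (n : ℕ) (p : Polynomial K) : Fin n → K := fun i => p.coeff i

/-- dehomogenised linear form -/
def lin {K : Type} [CommSemiring K] (u v : K) : Polynomial K :=
  Polynomial.C u + Polynomial.C v * Polynomial.X

/-- homogeneous evaluation -/
def hev {K : Type} [CommSemiring K] (n : ℕ) (p : Polynomial K) (x y : K) : K :=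
  ∑ i ∈ Finset.range (n+1), p.coeff i * x ^ (n - i) * y ^ i

section basics
variable {K : Type} [CommSemiring K]

lemma coeff_toP {n : ℕ} (a : Fin n → K) (i : ℕ) :
    (toP a).coeff i = if h : i < n then a ⟨i, h⟩ else 0 := by
  unfold toP
  simp only [Polynomial.finsetSum_coeff, Polynomial.coeff_C_mul, Polynomial.coeff_X_pow]
  split_ifs with h
  · rw [Finset.sum_eq_single (⟨i, h⟩ : Fin n)]
    · simp
    · intro b _ hb
      have : ¬ (i = (b : ℕ)) := fun h' => hb (Fin.ext h'.symm)
      simp [this]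
    · simp
  · apply Finset.sum_eq_zero
    intro b _
    have : ¬ (i = (b : ℕ)) := by have := b.2; omega
    simp [this]

@[simp] lemma coeff_toP_fin {n : ℕ} (a : Fin n → K) (i : Fin n) : (toP a).coeff i = a i := by
  rw [coeff_toP, dif_pos i.2]

lemma natDegree_toP {n : ℕ} (a : Fin (n+1) → K) : (toP a).natDegree ≤ n := by
  rw [Polynomial.natDegree_le_iff_coeff_eq_zero]
  intro N hN
  rw [coeff_toP, dif_neg (by omega)]

@[simp] lemma ofP_toP {n : ℕ} (a : Fin n → K) : ofP n (toP a) = a := by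
  funext i; simp [ofP]

lemma toP_ofP {n : ℕ} (p : Polynomial K) (hp : p.natDegree ≤ n) : toP (ofP (n+1) p) = p := by
  ext i
  rw [coeff_toP]
  split_ifs with h
  · rfl
  · exact (Polynomial.coeff_eq_zero_of_natDegree_lt (by omega)).symm

lemma toP_injective {n : ℕ} : Function.Injective (toP : (Fin n → K) → Polynomial K) :=
  Function.LeftInverse.injective ofP_toP

@[simp] lemma toP_zero {n : ℕ} : toP (0 : Fin n → K) = 0 := by simp [toP]
lemma toP_add {n : ℕ} (a b : Fin n → K) : toP (a + b) = toP a + toP b := by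
  simp [toP, add_mul, Finset.sum_add_distrib]
lemma toP_smul {n : ℕ} (c : K) (b : Fin n → K) : toP (c • b) = Polynomial.C c * toP b := by
  simp [toP, Finset.mul_sum, mul_assoc]

@[simp] lemma coeff_lin_zero (u v : K) : (lin u v).coeff 0 = u := by simp [lin]
@[simp] lemma coeff_lin_one (u v : K) : (lin u v).coeff 1 = v := by simp [lin]
lemma natDegree_lin (u v : K) : (lin u v).natDegree ≤ 1 := by
  unfold lin
  refine (Polynomial.natDegree_add_le _ _).trans ?_
  simp only [Polynomial.natDegree_C, zero_le, sup_of_le_right]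
  exact (Polynomial.natDegree_C_mul_le _ _).trans Polynomial.natDegree_X_le
lemma lin_eq_toP (p : Polynomial K) (hp : p.natDegree ≤ 1) : p = lin (p.coeff 0) (p.coeff 1) := by
  unfold lin
  rw [add_comm]
  exact Polynomial.eq_X_add_C_of_natDegree_le_one hp

lemma hev_add (n : ℕ) (p q : Polynomial K) (x y : K) :
    hev n (p + q) x y = hev n p x y + hev n q x y := by
  simp [hev, add_mul, Finset.sum_add_distrib]
lemma hev_C_mul (n : ℕ) (c : K) (q : Polynomial K) (x y : K) :
    hev n (Polynomial.C c * q) x y = c * hev n q x y := by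
  simp [hev, Finset.mul_sum, mul_assoc]
@[simp] lemma hev_lin (u v x y : K) : hev 1 (lin u v) x y = u * x + v * y := by
  simp [hev, Finset.sum_range_succ]
@[simp] lemma hev_zero (n : ℕ) (x y : K) : hev n 0 x y = 0 := by simp [hev]

lemma hev_X_pow (n i : ℕ) (hi : i ≤ n) (x y : K) : hev n (Polynomial.X ^ i) x y = x ^ (n - i) * y ^ i := by
  unfold hev
  rw [Finset.sum_eq_single i]
  · simp
  · intro b _ hb; simp [Polynomial.coeff_X_pow, hb]
  · intro h; exact absurd (Finset.mem_range.2 (by omega)) h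

lemma hev_mul (n m : ℕ) (p q : Polynomial K) (hp : p.natDegree ≤ n) (hq : q.natDegree ≤ m) (x y : K) :
    hev (n + m) (p * q) x y = hev n p x y * hev m q x y := by
  have e1 : p = ∑ i ∈ Finset.range (n+1), Polynomial.C (p.coeff i) * Polynomial.X ^ i :=
    Polynomial.as_sum_range_C_mul_X_pow' _ (by omega)
  have e2 : q = ∑ i ∈ Finset.range (m+1), Polynomial.C (q.coeff i) * Polynomial.X ^ i :=
    Polynomial.as_sum_range_C_mul_X_pow' _ (by omega)
  have hs : ∀ (N : ℕ) (s : Finset (ℕ × ℕ)) (f : ℕ × ℕ → Polynomial K),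
      hev N (∑ i ∈ s, f i) x y = ∑ i ∈ s, hev N (f i) x y := by
    intro N s f
    induction s using Finset.induction_on with
    | empty => simp
    | insert a s ha ih => rw [Finset.sum_insert ha, Finset.sum_insert ha, hev_add, ih]
  have e3 : hev n p x y * hev m q x y = ∑ ij ∈ Finset.range (n+1) ×ˢ Finset.range (m+1),
      p.coeff ij.1 * x ^ (n - ij.1) * y ^ ij.1 * (q.coeff ij.2 * x ^ (m - ij.2) * y ^ ij.2) := by
    unfold hev
    rw [Finset.sum_mul_sum, ← Finset.sum_product']
  rw [e3]
  conv_lhs => rw [e1, e2, Finset.sum_mul_sum, ← Finset.sum_product', hs]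
  apply Finset.sum_congr rfl
  rintro ⟨i, j⟩ hij
  simp only [Finset.mem_product, Finset.mem_range] at hij
  have := hev_X_pow (n+m) (i+j) (by omega) x y
  rw [show Polynomial.C (p.coeff i) * Polynomial.X ^ i * (Polynomial.C (q.coeff j) * Polynomial.X ^ j)
    = Polynomial.C (p.coeff i * q.coeff j) * Polynomial.X ^ (i+j) by
      rw [Polynomial.C_mul, pow_add]; ring]
  have h2 := hev_C_mul (n+m) (p.coeff i * q.coeff j) (Polynomial.X ^ (i+j)) x y
  rw [h2, this, show n + m - (i+j) = (n - i) + (m - j) by omega]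
  ring

lemma hev_pow (n e : ℕ) (p : Polynomial K) (hp : p.natDegree ≤ n) (x y : K) :
    hev (e * n) (p ^ e) x y = hev n p x y ^ e := by
  induction e with
  | zero => simp [hev]
  | succ e ih =>
    rw [pow_succ, add_mul, one_mul, hev_mul _ _ _ _ (Polynomial.natDegree_pow_le_of_le e hp) hp, ih, pow_succ]

lemma hev_prod {ι : Type} (s : Finset ι) (n : ι → ℕ) (p : ι → Polynomial K)
    (hp : ∀ i, (p i).natDegree ≤ n i) (x y : K) :
    hev (∑ i ∈ s, n i) (∏ i ∈ s, p i) x y = ∏ i ∈ s, hev (n i) (p i) x y := by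
  classical
  induction s using Finset.induction_on with
  | empty => simp [hev]
  | insert a s ha ih =>
    rw [Finset.sum_insert ha, Finset.prod_insert ha, Finset.prod_insert ha, hev_mul _ _ _ _ (hp a), ih]
    exact (Polynomial.natDegree_prod_le _ _).trans (Finset.sum_le_sum fun i _ => hp i)

end basics

section field
variable {K : Type} [Field K]

lemma lin_ne_zero {u v : K} (h : ¬ (u = 0 ∧ v = 0)) : lin u v ≠ 0 := by
  intro h0
  apply h
  constructor
  · rw [← coeff_lin_zero u v, h0]; simp
  · rw [← coeff_lin_one u v, h0]; simp

lemma lin_eq_zero_iff {u v : K} : lin u v = 0 ↔ (u = 0 ∧ v = 0) := by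
  constructor
  · intro h; by_contra h2; exact lin_ne_zero h2 h
  · rintro ⟨rfl, rfl⟩; simp [lin]

lemma hev_eq_eval (n : ℕ) (p : Polynomial K) (hp : p.natDegree ≤ n) (x y : K) (hx : x ≠ 0) :
    hev n p x y = x ^ n * p.eval (y / x) := by
  rw [Polynomial.eval_eq_sum_range' (Nat.lt_succ_of_le hp), Finset.mul_sum]
  apply Finset.sum_congr rfl
  intro i hi
  have : i ≤ n := by simpa [Nat.lt_succ_iff] using hi
  rw [div_pow]
  have : x ^ n = x ^ (n-i) * x ^ i := by rw [← pow_add]; congr 1; omega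
  rw [this]
  field_simp

lemma hev_zero_left (n : ℕ) (p : Polynomial K) (y : K) : hev n p 0 y = p.coeff n * y ^ n := by
  unfold hev
  rw [Finset.sum_eq_single n]
  · simp
  · intro b hb hbn
    have : n - b ≠ 0 := by simp at hb; omega
    simp [this]
  · simp

lemma hev_one (n : ℕ) (p : Polynomial K) (hp : p.natDegree ≤ n) (y : K) : hev n p 1 y = p.eval y := by
  rw [hev_eq_eval n p hp 1 y one_ne_zero]; simp

/-- root lemma -/
lemma exists_factor (n : ℕ) (p : Polynomial K) (hp : p.natDegree ≤ n + 1) (u v : K)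
    (huv : ¬ (u = 0 ∧ v = 0)) (h : hev (n+1) p v (-u) = 0) :
    ∃ p' : Polynomial K, p'.natDegree ≤ n ∧ p = p' * lin u v := by
  by_cases hv : v = 0
  · subst hv
    have hu : u ≠ 0 := by simpa using huv
    rw [hev_zero_left] at h
    have hc : p.coeff (n+1) = 0 := by
      rcases mul_eq_zero.1 h with h | h
      · exact h
      · exact absurd h (pow_ne_zero _ (neg_ne_zero.2 hu))
    refine ⟨Polynomial.C u⁻¹ * p, ?_, ?_⟩
    · refine (Polynomial.natDegree_C_mul_le _ _).trans ?_
      rw [Polynomial.natDegree_le_iff_coeff_eq_zero]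
      intro N hN
      rcases Nat.lt_or_ge (n+1) N with h1 | h1
      · exact Polynomial.coeff_eq_zero_of_natDegree_lt (by omega)
      · have : N = n+1 := by omega
        rw [this, hc]
    · have : lin u (0:K) = Polynomial.C u := by simp [lin]
      rw [this, mul_comm, ← mul_assoc, ← Polynomial.C_mul, mul_inv_cancel₀ hu]; simp
  · rw [hev_eq_eval _ p hp v (-u) hv] at h
    have hr : p.IsRoot (-u / v) := by
      rcases mul_eq_zero.1 h with h | h
      · exact absurd h (pow_ne_zero _ hv)
      · exact h
    obtain ⟨r, hr⟩ := Polynomial.dvd_iff_isRoot.2 hr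
    have hl : lin u v = Polynomial.C v * (Polynomial.X - Polynomial.C (-u/v)) := by
      rw [mul_sub, ← Polynomial.C_mul, mul_div_cancel₀ _ hv]; simp [lin, add_comm]
    have e : p = (Polynomial.C v⁻¹ * r) * lin u v := by
      rw [hl, hr]
      have : Polynomial.C v⁻¹ * Polynomial.C v = (1 : Polynomial K) := by
        rw [← Polynomial.C_mul, inv_mul_cancel₀ hv]; simp
      linear_combination -((Polynomial.X - Polynomial.C (-u/v)) * r) * this
    refine ⟨_, ?_, e⟩
    by_cases hr0 : r = 0
    · simp [hr0]
    have hd : p.natDegree = 1 + r.natDegree := by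
      rw [hr, Polynomial.natDegree_mul (Polynomial.X_sub_C_ne_zero _) hr0, Polynomial.natDegree_X_sub_C]
    refine (Polynomial.natDegree_C_mul_le _ _).trans ?_
    omega

lemma hev_lin_self (u v : K) : hev 1 (lin u v) v (-u) = 0 := by simp; ring

/-- if two linear forms share a root they are proportional -/
lemma lin_prop {u v u' v' : K} (h : ¬ (u = 0 ∧ v = 0)) (h0 : hev 1 (lin u' v') v (-u) = 0) :
    ∃ c : K, lin u' v' = Polynomial.C c * lin u v := by
  obtain ⟨p', hp', e⟩ := exists_factor 0 (lin u' v') (natDegree_lin _ _) u v h h0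
  rw [Polynomial.eq_C_of_natDegree_le_zero hp'] at e
  exact ⟨_, e⟩

lemma natDegree_mul_le' {p q : Polynomial K} {n m : ℕ} (hp : p.natDegree ≤ n) (hq : q.natDegree ≤ m) :
    (p * q).natDegree ≤ n + m :=
  Polynomial.natDegree_mul_le.trans (by omega)

lemma natDegree_of_mul_lin {p : Polynomial K} {u v : K} {n : ℕ} (hv : v ≠ 0)
    (h : (p * lin u v).natDegree ≤ n + 1) : p.natDegree ≤ n := by
  by_cases hp : p = 0
  · simp [hp]
  have hl : (lin u v).natDegree = 1 := by
    refine le_antisymm (natDegree_lin _ _) ?_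
    apply Polynomial.le_natDegree_of_ne_zero
    simpa using hv
  have hl0 : lin u v ≠ 0 := lin_ne_zero (by tauto)
  rw [Polynomial.natDegree_mul hp hl0] at h
  omega

/-- a linear form not vanishing at the root of `lin u v` -/
lemma exists_nonvanish (u v : K) (h : ¬ (u = 0 ∧ v = 0)) :
    ∃ a b : K, hev 1 (lin a b) v (-u) = 1 := by
  by_cases hv : v = 0
  · have hu : u ≠ 0 := by tauto
    exact ⟨0, -u⁻¹, by simp [hv, hu]⟩
  · exact ⟨v⁻¹, 0, by simp [hv]⟩

lemma exists_nonvanish' (n : ℕ) (u v : K) (h : ¬ (u = 0 ∧ v = 0)) :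
    ∃ r : Polynomial K, r.natDegree ≤ n ∧ hev n r v (-u) = 1 := by
  obtain ⟨a, b, hab⟩ := exists_nonvanish u v h
  refine ⟨lin a b ^ n, ?_, ?_⟩
  · simpa using Polynomial.natDegree_pow_le_of_le n (natDegree_lin a b)
  · have := hev_pow 1 n (lin a b) (natDegree_lin a b) v (-u)
    rw [mul_one] at this
    rw [this, hab, one_pow]

end field
end EM

namespace EM

section bridge
variable {K : Type} [Field K]

/-- dehomogenisation -/
def deh (K : Type) [CommSemiring K] : MvPolynomial (Fin 2) K →ₐ[K] Polynomial K :=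
  aeval ![1, Polynomial.X]

lemma deh_binForm {r : ℕ} (a : Fin (r+1) → K) : deh K (binForm r a) = toP a := by
  simp [deh, binForm, toP, Polynomial.C_eq_algebraMap]

lemma deh_linForm (u v : K) : deh K (linForm u v) = lin u v := by
  simp [deh, linForm, lin, Polynomial.C_eq_algebraMap]

/-- homogenisation -/
def hz (n : ℕ) (p : Polynomial K) : MvPolynomial (Fin 2) K :=
  hev n (p.map (C : K →+* MvPolynomial (Fin 2) K)) (X 0) (X 1)

lemma hz_toP {r : ℕ} (a : Fin (r+1) → K) : hz r (toP a) = binForm r a := by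
  unfold hz hev binForm
  rw [Finset.sum_range]
  simp [Polynomial.coeff_map]

lemma hz_lin (u v : K) : hz 1 (lin u v) = linForm u v := by
  simp [hz, hev, linForm, Finset.sum_range_succ, Polynomial.coeff_map]

lemma hz_C_mul (n : ℕ) (c : K) (p : Polynomial K) : hz n (Polynomial.C c * p) = C c * hz n p := by
  simp only [hz, Polynomial.map_mul, Polynomial.map_C, hev_C_mul]

lemma hz_pow (e : ℕ) (u v : K) : hz e (lin u v ^ e) = linForm u v ^ e := by
  have := hev_pow 1 e ((lin u v).map (C : K →+* MvPolynomial (Fin 2) K))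
    (Polynomial.natDegree_map_le.trans (natDegree_lin u v)) (X 0) (X 1)
  rw [mul_one] at this
  unfold hz
  rw [Polynomial.map_pow, this]
  congr 1
  exact hz_lin u v

lemma hz_sum {ι : Type} (s : Finset ι) (n : ℕ) (p : ι → Polynomial K) :
    hz n (∑ i ∈ s, p i) = ∑ i ∈ s, hz n (p i) := by
  classical
  induction s using Finset.induction_on with
  | empty => simp [hz]
  | insert a s ha ih =>
    rw [Finset.sum_insert ha, Finset.sum_insert ha, ← ih]
    simp [hz, hev_add]

lemma hz_prod {n : ℕ} (lam : Fin n → ℕ) (u v : Fin n → K) :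
    hz (∑ i, lam i) (∏ i, lin (u i) (v i) ^ lam i) = ∏ i, linForm (u i) (v i) ^ lam i := by
  unfold hz
  rw [Polynomial.map_prod, hev_prod]
  · apply Finset.prod_congr rfl
    intro i _
    exact hz_pow _ _ _
  · intro i
    refine Polynomial.natDegree_map_le.trans ?_
    simpa using Polynomial.natDegree_pow_le_of_le (lam i) (natDegree_lin (u i) (v i))

lemma mem_crlCone_iff {r n : ℕ} (lam : Fin n → ℕ) (hl : ∑ i, lam i = r) (a : Fin (r+1) → ℂ) :
    a ∈ crlCone r n lam ↔ ∃ (t : ℂ) (u v : Fin n → ℂ),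
      toP a = Polynomial.C t * ∏ i, lin (u i) (v i) ^ lam i := by
  constructor
  · rintro ⟨t, u, v, h⟩
    refine ⟨t, u, v, ?_⟩
    have := congrArg (deh ℂ) h
    rw [deh_binForm, map_mul, map_prod] at this
    rw [this]
    congr 1
    · simp [deh, Polynomial.C_eq_algebraMap]
    · simp [deh_linForm]
  · rintro ⟨t, u, v, h⟩
    refine ⟨t, u, v, ?_⟩
    rw [← hz_toP, h, hz_C_mul]
    subst hl
    rw [hz_prod]

/-- expression as a sum of `r` powers -/
def rankLE (d r : ℕ) (a : Fin (d+1) → K) : Prop :=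
  ∃ α u v : Fin r → K, toP a = ∑ i, Polynomial.C (α i) * lin (u i) (v i) ^ d

lemma rankLE_iff (d r : ℕ) (a : Fin (d+1) → K) : rankLE d r a ↔
    ∃ (α u v : Fin r → K), binForm d a = ∑ i, α i • (linForm (u i) (v i)) ^ d := by
  constructor
  · rintro ⟨α, u, v, h⟩
    refine ⟨α, u, v, ?_⟩
    rw [← hz_toP, h, hz_sum]
    apply Finset.sum_congr rfl
    intro i _
    rw [hz_C_mul, hz_pow, smul_eq_C_mul]
  · rintro ⟨α, u, v, h⟩
    refine ⟨α, u, v, ?_⟩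
    have := congrArg (deh K) h
    rw [deh_binForm] at this
    rw [this, map_sum]
    apply Finset.sum_congr rfl
    intro i _
    rw [map_smul, map_pow, deh_linForm, Polynomial.smul_eq_C_mul]

lemma rankLE_succ {d r : ℕ} {a : Fin (d+1) → K} (h : rankLE d r a) : rankLE d (r+1) a := by
  obtain ⟨α, u, v, h⟩ := h
  refine ⟨Fin.cons 0 α, Fin.cons 0 u, Fin.cons 0 v, ?_⟩
  rw [Fin.sum_univ_succ]
  simp [h]

lemma rankLE_mono {d r s : ℕ} (hrs : r ≤ s) {a : Fin (d+1) → K} (h : rankLE d r a) : rankLE d s a := by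
  induction hrs with
  | refl => exact h
  | step _ ih => exact rankLE_succ ih

lemma waringRank_eq_iff (d r : ℕ) (a : Fin (d+1) → K) :
    waringRank d (binForm d a) = r + 1 ↔ rankLE d (r+1) a ∧ ¬ rankLE d r a := by
  unfold waringRank
  simp only [← rankLE_iff]
  constructor
  · intro h
    have hne : {r | rankLE d r a}.Nonempty := by
      apply Nat.nonempty_of_pos_sInf
      omega
    refine ⟨?_, ?_⟩
    · have := Nat.sInf_mem hne
      rwa [h] at this
    · intro h2
      have := Nat.sInf_le (s := {r | rankLE d r a}) h2
      omega
  · rintro ⟨h1, h2⟩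
    apply le_antisymm
    · exact Nat.sInf_le h1
    · by_contra hlt
      push Not at hlt
      have := Nat.sInf_mem (s := {r | rankLE d r a}) ⟨_, h1⟩
      exact h2 (rankLE_mono (by omega) this)

/-- the weights -/
def wt (K : Type) [Field K] (d i : ℕ) : K := ((i.factorial * (d - i).factorial : ℕ) : K)

lemma wt_ne_zero [CharZero K] (d i : ℕ) : wt K d i ≠ 0 := by
  unfold wt
  exact_mod_cast (Nat.mul_pos (Nat.factorial_pos _) (Nat.factorial_pos _)).ne'

/-- apolar functional -/
def Lf (d : ℕ) (a : Fin (d+1) → K) (p : Polynomial K) : K :=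
  ∑ i : Fin (d+1), wt K d i * a i * p.coeff i

lemma Lf_add {d : ℕ} (a : Fin (d+1) → K) (p q) : Lf d a (p + q) = Lf d a p + Lf d a q := by
  simp [Lf, mul_add, Finset.sum_add_distrib]
lemma Lf_C_mul {d : ℕ} (a : Fin (d+1) → K) (c : K) (q) :
    Lf d a (Polynomial.C c * q) = c * Lf d a q := by
  simp only [Lf, Polynomial.coeff_C_mul, Finset.mul_sum]
  exact Finset.sum_congr rfl fun i _ => by ring
lemma Lf_zero {d : ℕ} (a : Fin (d+1) → K) : Lf d a 0 = 0 := by simp [Lf]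
lemma Lf_sum {d : ℕ} {ι : Type} (s : Finset ι) (a : Fin (d+1) → K) (p : ι → Polynomial K) :
    Lf d a (∑ i ∈ s, p i) = ∑ i ∈ s, Lf d a (p i) := by
  classical
  induction s using Finset.induction_on with
  | empty => simp [Lf]
  | insert b s ha ih => rw [Finset.sum_insert ha, Finset.sum_insert ha, Lf_add, ih]
lemma Lf_X_pow {d : ℕ} (a : Fin (d+1) → K) (i : Fin (d+1)) :
    Lf d a (Polynomial.X ^ (i:ℕ)) = wt K d i * a i := by
  unfold Lf
  rw [Finset.sum_eq_single i]
  · simp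
  · intro b _ hb
    have : ¬ ((b : ℕ) = i) := fun h => hb (Fin.ext h)
    simp [Polynomial.coeff_X_pow, this]
  · simp

lemma coeff_lin_pow (u v : K) (d i : ℕ) (hi : i ≤ d) :
    (lin u v ^ d).coeff i = (d.choose i : K) * u ^ (d - i) * v ^ i := by
  unfold lin
  rw [add_comm, add_pow, Polynomial.finsetSum_coeff, Finset.sum_eq_single i]
  · rw [mul_pow, ← Polynomial.C_pow, ← Polynomial.C_pow, ← Polynomial.C_eq_natCast]
    rw [show Polynomial.C (v ^ i) * Polynomial.X ^ i * Polynomial.C (u ^ (d - i)) * Polynomial.C ((d.choose i : ℕ) : K)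
      = Polynomial.C (v ^ i * u ^ (d-i) * ((d.choose i : ℕ) : K)) * Polynomial.X ^ i by
        simp only [Polynomial.C_mul]; ring]
    rw [Polynomial.coeff_C_mul, Polynomial.coeff_X_pow, if_pos rfl]; ring
  · intro b _ hb
    rw [mul_pow, ← Polynomial.C_pow, ← Polynomial.C_pow, ← Polynomial.C_eq_natCast]
    rw [show Polynomial.C (v ^ b) * Polynomial.X ^ b * Polynomial.C (u ^ (d - b)) * Polynomial.C ((d.choose b : ℕ) : K)
      = Polynomial.C (v ^ b * u ^ (d-b) * ((d.choose b : ℕ) : K)) * Polynomial.X ^ b by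
        simp only [Polynomial.C_mul]; ring]
    rw [Polynomial.coeff_C_mul, Polynomial.coeff_X_pow, if_neg (Ne.symm hb), mul_zero]
  · intro h; exact absurd (Finset.mem_range.2 (by omega)) h

lemma rankLE_of_Lf [CharZero K] {d r : ℕ} (a : Fin (d+1) → K) (β u v : Fin r → K)
    (h : ∀ p : Polynomial K, p.natDegree ≤ d → Lf d a p = ∑ i, β i * hev d p (u i) (v i)) :
    rankLE d r a := by
  have hf : (d.factorial : K) ≠ 0 := by exact_mod_cast (Nat.factorial_pos d).ne'
  refine ⟨fun i => β i / d.factorial, u, v, ?_⟩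
  have hdeg : (∑ i, Polynomial.C (β i / (d.factorial : K)) * lin (u i) (v i) ^ d).natDegree ≤ d := by
    apply Polynomial.natDegree_sum_le_of_forall_le
    intro i _
    refine (Polynomial.natDegree_C_mul_le _ _).trans ?_
    simpa using Polynomial.natDegree_pow_le_of_le d (natDegree_lin (u i) (v i))
  rw [← toP_ofP _ hdeg]
  congr 1
  · funext i
    have hi : (i:ℕ) ≤ d := Nat.lt_succ_iff.1 i.2
    simp only [ofP, Polynomial.finsetSum_coeff, Polynomial.coeff_C_mul]
    have h1 := h (Polynomial.X ^ (i:ℕ)) (by simpa using hi)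
    rw [Lf_X_pow] at h1
    have h2 : a i = (wt K d i)⁻¹ * ∑ j, β j * hev d (Polynomial.X ^ (i:ℕ)) (u j) (v j) := by
      rw [← h1, inv_mul_cancel_left₀ (wt_ne_zero d i)]
    rw [h2, Finset.mul_sum]
    apply Finset.sum_congr rfl
    intro j _
    rw [hev_X_pow _ _ hi, coeff_lin_pow _ _ _ _ hi]
    have h3 : (d.choose i : K) * wt K d i = d.factorial := by
      unfold wt
      have := Nat.choose_mul_factorial_mul_factorial hi
      exact_mod_cast (by rw [← this]; ring)
    have h4 := wt_ne_zero (K := K) d i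
    field_simp
    linear_combination (-1 : K) * β j * (u j)^(d-(i:ℕ)) * (v j) ^ (i:ℕ) * h3
  

lemma Lf_of_rankLE {d r : ℕ} (a : Fin (d+1) → K) (h : rankLE d r a) :
    ∃ β u v : Fin r → K, ∀ p : Polynomial K, Lf d a p = ∑ i, β i * hev d p (u i) (v i) := by
  obtain ⟨α, u, v, h⟩ := h
  refine ⟨fun i => α i * d.factorial, u, v, ?_⟩
  intro p
  have ha : ∀ i : Fin (d+1), wt K d i * a i = ∑ j, α j * d.factorial * (u j ^ (d - (i:ℕ)) * v j ^ (i:ℕ)) := by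
    intro i
    have hi : (i:ℕ) ≤ d := Nat.lt_succ_iff.1 i.2
    have := congrArg (fun q => Polynomial.coeff q (i:ℕ)) h
    simp only [coeff_toP_fin, Polynomial.finsetSum_coeff, Polynomial.coeff_C_mul] at this
    rw [this, Finset.mul_sum]
    apply Finset.sum_congr rfl
    intro j _
    rw [coeff_lin_pow _ _ _ _ hi]
    have h3 : (d.choose i : K) * wt K d i = d.factorial := by
      unfold wt
      have := Nat.choose_mul_factorial_mul_factorial hi
      exact_mod_cast (by rw [← this]; ring)
    rw [← h3]; ring
  unfold Lf hev
  simp only [ha]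
  simp only [Finset.sum_mul, Finset.mul_sum]
  rw [Finset.sum_comm]
  apply Finset.sum_congr rfl
  intro j _
  rw [Finset.sum_range]
  apply Finset.sum_congr rfl
  intro i _
  ring

lemma iter_pderiv_one (c : ℂ) (a b q : ℕ) :
    (fun g : MvPolynomial (Fin 2) ℂ => pderiv (1 : Fin 2) g)^[q] (C c * X 0 ^ a * X 1 ^ b)
      = C (c * (b.descFactorial q : ℂ)) * X 0 ^ a * X 1 ^ (b - q) := by
  induction q with
  | zero => simp
  | succ q ih =>
    rw [Function.iterate_succ_apply', ih]
    simp only [Derivation.leibniz, Derivation.leibniz_pow, pderiv_C, pderiv_X_self,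
      pderiv_X_of_ne (show (0 : Fin 2) ≠ 1 by decide), smul_eq_mul]
    rw [Nat.descFactorial_succ, show b - (q+1) = b - q - 1 by omega]
    push_cast
    simp only [C_mul, nsmul_eq_mul]
    rw [← map_natCast (C : ℂ →+* MvPolynomial (Fin 2) ℂ) (b - q)]
    ring

lemma iter_pderiv_zero (c : ℂ) (a b q : ℕ) :
    (fun g : MvPolynomial (Fin 2) ℂ => pderiv (0 : Fin 2) g)^[q] (C c * X 0 ^ a * X 1 ^ b)
      = C (c * (a.descFactorial q : ℂ)) * X 0 ^ (a - q) * X 1 ^ b := by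
  induction q with
  | zero => simp
  | succ q ih =>
    rw [Function.iterate_succ_apply', ih]
    simp only [Derivation.leibniz, Derivation.leibniz_pow, pderiv_C, pderiv_X_self,
      pderiv_X_of_ne (show (1 : Fin 2) ≠ 0 by decide), smul_eq_mul]
    rw [Nat.descFactorial_succ, show a - (q+1) = a - q - 1 by omega]
    push_cast
    simp only [C_mul, nsmul_eq_mul]
    rw [← map_natCast (C : ℂ →+* MvPolynomial (Fin 2) ℂ) (a - q)]
    ring

lemma iter_sum (i : Fin 2) (q : ℕ) {ι : Type} (s : Finset ι) (f : ι → MvPolynomial (Fin 2) ℂ) :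
    (fun g : MvPolynomial (Fin 2) ℂ => pderiv i g)^[q] (∑ j ∈ s, f j)
      = ∑ j ∈ s, (fun g : MvPolynomial (Fin 2) ℂ => pderiv i g)^[q] (f j) := by
  induction q with
  | zero => simp
  | succ q ih => simp only [Function.iterate_succ_apply', ih, map_sum]

lemma apolarPair_eq (d : ℕ) (h a : Fin (d+1) → ℂ) : apolarPair d h a = Lf d h (toP a) := by
  unfold apolarPair diffOp Lf
  rw [map_sum]
  apply Finset.sum_congr rfl
  intro i _
  have hi : (i:ℕ) ≤ d := Nat.lt_succ_iff.1 i.2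
  rw [coeff_toP_fin, smul_eval]
  unfold binForm
  rw [iter_sum, iter_sum, map_sum, Finset.sum_eq_single i]
  · rw [iter_pderiv_one, iter_pderiv_zero]
    simp [Nat.descFactorial_self, wt]
    ring
  · intro j _ hj
    have hj' : (j:ℕ) ≤ d := Nat.lt_succ_iff.1 j.2
    rw [iter_pderiv_one, iter_pderiv_zero]
    have hne : (j:ℕ) ≠ i := fun h => hj (Fin.ext h)
    rcases Nat.lt_or_gt_of_ne hne with hlt | hgt
    · have : (j:ℕ).descFactorial i = 0 := Nat.descFactorial_eq_zero_iff_lt.2 hlt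
      simp [this]
    · have : (d - (j:ℕ)).descFactorial (d - i) = 0 := Nat.descFactorial_eq_zero_iff_lt.2 (by omega)
      simp [this]
  · simp

end bridge
end EM

namespace EM

section ker
variable {K : Type} [Field K]

lemma exists_rightInv {k n : ℕ} (N : Matrix (Fin k) (Fin n) K)
    (h : ∀ c : Fin k → K, Matrix.vecMul c N = 0 → c = 0) :
    ∃ S : Matrix (Fin n) (Fin k) K, N * S = 1 := by
  rw [← Matrix.mulVec_surjective_iff_exists_right_inverse]
  have hli : LinearIndependent K N.row := by
    rw [← Matrix.vecMul_injective_iff]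
    intro a b hab
    have := h (a - b) (by rw [Matrix.sub_vecMul]; exact sub_eq_zero.2 hab)
    exact sub_eq_zero.1 this
  have hr := hli.rank_matrix
  have : LinearMap.range N.mulVecLin = ⊤ := by
    apply Submodule.eq_top_of_finrank_eq
    have h2 : Module.finrank K (LinearMap.range N.mulVecLin) = N.rank := rfl
    rw [h2, hr]; simp
  intro y
  have hy : y ∈ LinearMap.range N.mulVecLin := by rw [this]; trivial
  obtain ⟨x, hx⟩ := hy
  exact ⟨x, hx⟩

/-- generic projection to the kernel -/
def kerProj {k n : ℕ} (N : Matrix (Fin k) (Fin n) K) (S : Matrix (Fin n) (Fin k) K)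
    (z : Fin n → K) : Fin n → K :=
  (N * S).det • z - S.mulVec ((N * S).adjugate.mulVec (N.mulVec z))

lemma mulVec_kerProj {k n : ℕ} (N : Matrix (Fin k) (Fin n) K) (S : Matrix (Fin n) (Fin k) K)
    (z : Fin n → K) : N.mulVec (kerProj N S z) = 0 := by
  unfold kerProj
  rw [Matrix.mulVec_sub, Matrix.mulVec_smul, Matrix.mulVec_mulVec, Matrix.mulVec_mulVec,
    Matrix.mul_adjugate, Matrix.smul_mulVec, Matrix.one_mulVec, sub_self]

lemma kerProj_eq {k n : ℕ} (N : Matrix (Fin k) (Fin n) K) (S : Matrix (Fin n) (Fin k) K)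
    (z : Fin n → K) (h1 : N * S = 1) (h2 : N.mulVec z = 0) : kerProj N S z = z := by
  simp [kerProj, h1, h2]

/-- multiplication matrix -/
def MM (k : ℕ) (g : Polynomial K) : Matrix (Fin k) (Fin (2*k+1)) K :=
  fun j i => wt K (2*k) i * (g * Polynomial.X ^ (j:ℕ)).coeff i

lemma MM_mulVec (k : ℕ) (g : Polynomial K) (a : Fin (2*k+1) → K) (j : Fin k) :
    (MM k g).mulVec a j = Lf (2*k) a (g * Polynomial.X ^ (j:ℕ)) := by
  unfold MM Matrix.mulVec dotProduct Lf
  exact Finset.sum_congr rfl fun i _ => by ring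

lemma MM_rightInv [CharZero K] (k : ℕ) (g : Polynomial K) (hg : g ≠ 0) (hd : g.natDegree ≤ k+1) :
    ∃ S : Matrix (Fin (2*k+1)) (Fin k) K, MM k g * S = 1 := by
  rcases Nat.eq_zero_or_pos k with rfl | hk
  · exact ⟨0, by ext i; exact i.elim0⟩
  obtain ⟨k', rfl⟩ : ∃ k', k = k' + 1 := ⟨k - 1, by omega⟩
  apply exists_rightInv
  intro c hc
  have h1 : g * toP c = 0 := by
    have hd2 : (g * toP c).natDegree ≤ 2*(k'+1) :=
      natDegree_mul_le' hd (natDegree_toP c) |>.trans (by omega)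
    rw [← toP_ofP _ hd2]
    rw [show ofP (2*(k'+1)+1) (g * toP c) = 0 from ?_, toP_zero]
    funext i
    have := congrFun hc i
    have h3 : wt K (2*(k'+1)) i * (g * toP c).coeff i = 0 := by
      rw [← Pi.zero_apply (M := fun _ => K) i, ← this]
      unfold MM Matrix.vecMul dotProduct toP
      rw [Finset.mul_sum, Polynomial.finsetSum_coeff, Finset.mul_sum]
      apply Finset.sum_congr rfl
      intro j _
      rw [show g * (Polynomial.C (c j) * Polynomial.X ^ (j:ℕ)) = Polynomial.C (c j) * (g * Polynomial.X ^ (j:ℕ)) by ring,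
        Polynomial.coeff_C_mul]
      ring
    exact (mul_eq_zero.1 h3).resolve_left (wt_ne_zero _ _)
  have h2 := (mul_eq_zero.1 h1).resolve_left hg
  exact toP_injective (by simpa using h2)

/-- apolarity up to degree -/
def apo (k : ℕ) (a : Fin (2*k+1) → K) (g : Polynomial K) : Prop :=
  ∀ j < k, Lf (2*k) a (g * Polynomial.X ^ j) = 0

lemma apo_iff_MM (k : ℕ) (a : Fin (2*k+1) → K) (g : Polynomial K) :
    apo k a g ↔ (MM k g).mulVec a = 0 := by
  constructor
  · intro h; funext j; rw [MM_mulVec]; exact h j j.2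
  · intro h j hj; rw [← MM_mulVec k g a ⟨j, hj⟩, h]; rfl

lemma apo_mul {k : ℕ} {a : Fin (2*k+1) → K} {g : Polynomial K} (h : apo k a g)
    (r : Polynomial K) (hr : r.natDegree < k) : Lf (2*k) a (g * r) = 0 := by
  rw [Polynomial.as_sum_range' r k hr, Finset.mul_sum, Lf_sum]
  apply Finset.sum_eq_zero
  intro i hi
  rw [← Polynomial.C_mul_X_pow_eq_monomial,
    show g * (Polynomial.C (r.coeff i) * Polynomial.X ^ i) = Polynomial.C (r.coeff i) * (g * Polynomial.X ^ i) by ring,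
    Lf_C_mul, h i (Finset.mem_range.1 hi), mul_zero]

lemma apo_of {k : ℕ} {a : Fin (2*k+1) → K} {g : Polynomial K} 
    (h : ∀ r : Polynomial K, r.natDegree < k → Lf (2*k) a (g * r) = 0) : apo k a g := by
  intro j hj
  exact h _ (by simpa using hj)

end ker

section LP
variable {V : Type} [AddCommGroup V] [Module ℂ V]

/-- functions polynomial along lines -/
def LP (f : V → ℂ) : Prop := ∀ a b : V, ∃ P : Polynomial ℂ, ∀ t : ℂ, f (a + t • b) = P.eval t

lemma LP.const (c : ℂ) : LP (fun _ : V => c) := fun _ _ => ⟨Polynomial.C c, by simp⟩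
lemma LP.linear (l : V →ₗ[ℂ] ℂ) : LP (fun x => l x) := fun a b =>
  ⟨Polynomial.C (l a) + Polynomial.C (l b) * Polynomial.X, by intro t; simp only [map_add, map_smul, smul_eq_mul, Polynomial.eval_add, Polynomial.eval_mul, Polynomial.eval_C, Polynomial.eval_X]; ring⟩
lemma LP.add {f g : V → ℂ} (hf : LP f) (hg : LP g) : LP (fun x => f x + g x) := by
  intro a b
  obtain ⟨P, hP⟩ := hf a b
  obtain ⟨Q, hQ⟩ := hg a b
  exact ⟨P + Q, by intro t; simp [hP, hQ]⟩
lemma LP.mul {f g : V → ℂ} (hf : LP f) (hg : LP g) : LP (fun x => f x * g x) := by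
  intro a b
  obtain ⟨P, hP⟩ := hf a b
  obtain ⟨Q, hQ⟩ := hg a b
  exact ⟨P * Q, by intro t; simp [hP, hQ]⟩
lemma LP.sub {f g : V → ℂ} (hf : LP f) (hg : LP g) : LP (fun x => f x - g x) := by
  intro a b
  obtain ⟨P, hP⟩ := hf a b
  obtain ⟨Q, hQ⟩ := hg a b
  exact ⟨P - Q, by intro t; simp [hP, hQ]⟩
lemma LP.sum {ι : Type} (s : Finset ι) {f : ι → V → ℂ} (h : ∀ i, LP (f i)) :
    LP (fun x => ∑ i ∈ s, f i x) := by
  classical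
  induction s using Finset.induction_on with
  | empty => simpa using LP.const 0
  | insert a s ha ih => simpa [Finset.sum_insert ha] using (h a).add ih
lemma LP.prod {ι : Type} (s : Finset ι) {f : ι → V → ℂ} (h : ∀ i, LP (f i)) :
    LP (fun x => ∏ i ∈ s, f i x) := by
  classical
  induction s using Finset.induction_on with
  | empty => simpa using LP.const 1
  | insert a s ha ih => simpa [Finset.prod_insert ha] using (h a).mul ih

lemma LP.eval {σ : Type} {F : V → σ → ℂ} (h : ∀ i, LP (fun x => F x i)) (p : MvPolynomial σ ℂ) :
    LP (fun x => MvPolynomial.eval (F x) p) := by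
  induction p using MvPolynomial.induction_on with
  | C a => simpa using LP.const a
  | add p q hp hq => simpa using hp.add hq
  | mul_X p i hp => simpa using hp.mul (h i)

lemma LP.det {n : ℕ} {A : V → Matrix (Fin n) (Fin n) ℂ} (h : ∀ i j, LP (fun x => A x i j)) :
    LP (fun x => (A x).det) := by
  simp only [Matrix.det_apply']
  exact LP.sum _ fun s => (LP.const _).mul (LP.prod _ fun i => h _ _)

lemma LP.adjugate {n : ℕ} {A : V → Matrix (Fin n) (Fin n) ℂ} (h : ∀ i j, LP (fun x => A x i j))
    (i j : Fin n) : LP (fun x => (A x).adjugate i j) := by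
  simp only [Matrix.adjugate_apply]
  apply LP.det
  intro a b
  by_cases hab : a = j
  · subst hab; simpa using LP.const _
  · simpa [Matrix.updateRow_ne hab] using h a b

lemma LP.matMul {l m n : ℕ} {A : V → Matrix (Fin l) (Fin m) ℂ} {B : V → Matrix (Fin m) (Fin n) ℂ}
    (hA : ∀ i j, LP (fun x => A x i j)) (hB : ∀ i j, LP (fun x => B x i j)) (i j) :
    LP (fun x => (A x * B x) i j) := by
  simp only [Matrix.mul_apply]
  exact LP.sum _ fun s => (hA _ _).mul (hB _ _)

lemma LP.mulVec {l m : ℕ} {A : V → Matrix (Fin l) (Fin m) ℂ} {B : V → (Fin m) → ℂ}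
    (hA : ∀ i j, LP (fun x => A x i j)) (hB : ∀ i, LP (fun x => B x i)) (i) :
    LP (fun x => (A x).mulVec (B x) i) := by
  simp only [Matrix.mulVec, dotProduct]
  exact LP.sum _ fun s => (hA _ _).mul (hB _)

lemma LP.kerProj {k n : ℕ} {N : V → Matrix (Fin k) (Fin n) ℂ} {S : V → Matrix (Fin n) (Fin k) ℂ}
    {z : V → Fin n → ℂ} (hN : ∀ i j, LP (fun x => N x i j)) (hS : ∀ i j, LP (fun x => S x i j))
    (hz : ∀ i, LP (fun x => z x i)) (i) : LP (fun x => kerProj (N x) (S x) (z x) i) := by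
  simp only [EM.kerProj, Pi.sub_apply, Pi.smul_apply, smul_eq_mul]
  exact ((LP.det (LP.matMul hN hS)).mul (hz i)).sub
    (LP.mulVec hS (LP.mulVec (LP.adjugate (LP.matMul hN hS)) (LP.mulVec hN hz)) i)

/-- polynomial-valued functions -/
def LPP (F : V → Polynomial ℂ) : Prop := ∀ i, LP (fun x => (F x).coeff i)

lemma LPP.const (P : Polynomial ℂ) : LPP (fun _ : V => P) := fun _ => LP.const _
lemma LPP.add {F G : V → Polynomial ℂ} (hF : LPP F) (hG : LPP G) : LPP (fun x => F x + G x) := by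
  intro i; simpa using (hF i).add (hG i)
lemma LPP.mul {F G : V → Polynomial ℂ} (hF : LPP F) (hG : LPP G) : LPP (fun x => F x * G x) := by
  intro i
  simp only [Polynomial.coeff_mul]
  exact LP.sum _ fun s => (hF _).mul (hG _)
lemma LPP.pow {F : V → Polynomial ℂ} (hF : LPP F) (n : ℕ) : LPP (fun x => F x ^ n) := by
  induction n with
  | zero => simpa using LPP.const 1
  | succ n ih => simpa [pow_succ] using ih.mul hF
lemma LPP.toP {n : ℕ} {a : V → Fin n → ℂ} (h : ∀ i, LP (fun x => a x i)) : LPP (fun x => toP (a x)) := by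
  intro i
  simp only [coeff_toP]
  split
  · exact h _
  · exact LP.const 0
lemma LPP.MM {k : ℕ} {F : V → Polynomial ℂ} (hF : LPP F) (i j) : LP (fun x => MM k (F x) i j) := by
  unfold EM.MM
  exact (LP.const _).mul ((hF.mul (LPP.const _)) _)

/-- domain lemma -/
lemma LP.domain {f g : V → ℂ} (hf : LP f) (hg : LP g) (h : ∀ x, g x ≠ 0 → f x = 0)
    {w : V} (hw : g w ≠ 0) (x : V) : f x = 0 := by
  obtain ⟨P, hP⟩ := hf w (x - w)
  obtain ⟨Q, hQ⟩ := hg w (x - w)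
  have hPQ : P * Q = 0 := by
    apply Polynomial.funext
    intro t
    rw [Polynomial.eval_mul, ← hP, ← hQ, Polynomial.eval_zero]
    by_cases h0 : g (w + t • (x - w)) = 0
    · rw [h0, mul_zero]
    · rw [h _ h0, zero_mul]
  have hQ0 : Q ≠ 0 := by
    rintro rfl
    have := hQ 0
    simp at this
    exact hw this
  have hP0 := (mul_eq_zero.1 hPQ).resolve_right hQ0
  have := hP 1
  simpa [hP0] using this

lemma LP.comp_linear {W : Type} [AddCommGroup W] [Module ℂ W] {f : V → ℂ} (hf : LP f) (l : W →ₗ[ℂ] V) :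
    LP (fun x => f (l x)) := by
  intro a b
  obtain ⟨P, hP⟩ := hf (l a) (l b)
  exact ⟨P, by intro t; simp [← hP]⟩

end LP
end EM

namespace EM

section lemT
variable {σ : Type} [Fintype σ] [DecidableEq σ]

/-- differential of `p` at `y` along `v` -/
def dl (y v : σ → ℂ) (p : MvPolynomial σ ℂ) : ℂ := ∑ i, eval y (pderiv i p) * v i

lemma dl_add (y v : σ → ℂ) (p q) : dl y v (p + q) = dl y v p + dl y v q := by
  simp [dl, add_mul, Finset.sum_add_distrib]
lemma dl_mul (y v : σ → ℂ) (p q) :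
    dl y v (p * q) = dl y v p * eval y q + eval y p * dl y v q := by
  simp only [dl, Derivation.leibniz, smul_eq_mul, map_add, map_mul]
  rw [Finset.sum_mul, Finset.mul_sum, ← Finset.sum_add_distrib]
  exact Finset.sum_congr rfl fun i _ => by ring
lemma dl_C (y v : σ → ℂ) (c : ℂ) : dl y v (C c) = 0 := by simp [dl]
lemma dl_X (y v : σ → ℂ) (j : σ) : dl y v (X j) = v j := by
  simp [dl, pderiv_X, Pi.single_apply]
lemma dl_sum (y v : σ → ℂ) {ι : Type} (s : Finset ι) (f : ι → MvPolynomial σ ℂ) :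
    dl y v (∑ i ∈ s, f i) = ∑ i ∈ s, dl y v (f i) := by
  classical
  induction s using Finset.induction_on with
  | empty => simp [dl]
  | insert a s ha ih => rw [Finset.sum_insert ha, Finset.sum_insert ha, dl_add, ih]
lemma dl_X_pow (y v : σ → ℂ) (j : σ) (n : ℕ) :
    dl y v (X j ^ n) = (n : ℂ) * y j ^ (n - 1) * v j := by
  induction n with
  | zero => simp [dl]
  | succ n ih =>
    rw [pow_succ, dl_mul, ih, dl_X]
    rcases n with _ | n
    · simp
    · simp [pow_succ]; ring

lemma dl_supported (y v : σ → ℂ) (s : Set σ) (hv : ∀ i ∈ s, v i = 0) (p : MvPolynomial σ ℂ)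
    (hp : p ∈ supported ℂ s) : dl y v p = 0 := by
  unfold dl
  apply Finset.sum_eq_zero
  intro i _
  by_cases hi : i ∈ s
  · rw [hv i hi, mul_zero]
  · rw [pderiv_eq_zero_of_notMem_vars, map_zero, zero_mul]
    intro h
    exact hi (mem_supported.1 hp h)

lemma lemT_one {τ : Type} (φ : σ → MvPolynomial τ ℂ) (s : Set σ) (j : σ)
    (h : IsAlgebraic (Algebra.adjoin ℂ (φ '' s)) (φ j)) :
    ∃ E : MvPolynomial σ ℂ, aeval φ E ≠ 0 ∧ ∀ y v : σ → ℂ, eval y E ≠ 0 →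
      (∀ p, aeval φ p = 0 → dl y v p = 0) → (∀ i ∈ s, v i = 0) → v j = 0 := by
  classical
  set A := Algebra.adjoin ℂ (φ '' s)
  have hex : ∃ n, ∃ P : Polynomial A, P ≠ 0 ∧ Polynomial.aeval (φ j) P = 0 ∧ P.natDegree = n := by
    obtain ⟨P, h1, h2⟩ := h
    exact ⟨_, P, h1, h2, rfl⟩
  obtain ⟨P, hP0, hP1, hP2⟩ := Nat.find_spec hex
  have hmin : ∀ Q : Polynomial A, Q.natDegree < P.natDegree → Polynomial.aeval (φ j) Q = 0 → Q = 0 := by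
    intro Q hQ hQ1
    by_contra hne
    rw [hP2] at hQ
    exact Nat.find_min hex hQ ⟨Q, hne, hQ1, rfl⟩
  have hder : Polynomial.aeval (φ j) (Polynomial.derivative P) ≠ 0 := by
    intro h0
    have hd : Polynomial.natDegree P ≠ 0 := by
      intro hd
      rw [Polynomial.eq_C_of_natDegree_eq_zero hd] at hP1 hP0
      rw [Polynomial.aeval_C] at hP1
      apply hP0
      have : P.coeff 0 = 0 := Subtype.ext hP1
      rw [this, Polynomial.C_0]
    have := hmin _ (Polynomial.natDegree_derivative_lt hd) h0
    exact hd (Polynomial.derivative_eq_zero.1 this)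
  have hlift : ∀ c : A, ∃ p : MvPolynomial σ ℂ, p ∈ supported ℂ s ∧ aeval φ p = (c : MvPolynomial τ ℂ) := by
    intro c
    have hc : (c : MvPolynomial τ ℂ) ∈ Algebra.adjoin ℂ (φ '' s) := c.2
    have : φ '' s = (aeval φ : MvPolynomial σ ℂ →ₐ[ℂ] MvPolynomial τ ℂ) '' ((X : σ → MvPolynomial σ ℂ) '' s) := by
      rw [Set.image_image]; simp only [aeval_X]
    rw [this, ← AlgHom.map_adjoin] at hc
    obtain ⟨p, hp, hpc⟩ := hc
    exact ⟨p, hp, hpc⟩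
  choose l hl1 hl2 using hlift
  refine ⟨∑ i ∈ Finset.range (P.natDegree + 1), l (P.coeff i) * (C (i:ℂ) * X j ^ (i-1)), ?_, ?_⟩
  · convert hder using 1
    rw [Polynomial.derivative_apply, Polynomial.sum_over_range _ (by simp), map_sum, map_sum]
    apply Finset.sum_congr rfl
    intro i _
    rw [map_mul, map_mul, hl2, map_mul, map_pow, map_pow, Polynomial.aeval_C, Polynomial.aeval_X, aeval_X, map_mul]
    simp only [mul_assoc]
    congr 1
    simp
  · intro y v hE hk hv
    have h1 := hk (∑ i ∈ Finset.range (P.natDegree + 1), l (P.coeff i) * X j ^ i) (by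
      rw [map_sum, ← hP1, Polynomial.aeval_eq_sum_range]
      apply Finset.sum_congr rfl
      intro i _
      rw [map_mul, map_pow, aeval_X, hl2]; rfl)
    rw [dl_sum] at h1
    have h2 : eval y (∑ i ∈ Finset.range (P.natDegree + 1), l (P.coeff i) * (C (i:ℂ) * X j ^ (i-1))) * v j = 0 := by
      rw [← h1, map_sum, Finset.sum_mul]
      apply Finset.sum_congr rfl
      intro i _
      rw [dl_mul, dl_X_pow, dl_supported y v s hv _ (hl1 _)]
      simp
      ring
    exact (mul_eq_zero.1 h2).resolve_left hE

lemma lemT {τ : Type} [Fintype τ] (φ : σ → MvPolynomial τ ℂ) : ∃ (B : Finset σ) (E : MvPolynomial σ ℂ),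
    B.card ≤ Fintype.card τ ∧ aeval φ E ≠ 0 ∧ ∀ y v : σ → ℂ, eval y E ≠ 0 →
      (∀ p, aeval φ p = 0 → dl y v p = 0) → (∀ i ∈ B, v i = 0) → v = 0 := by
  classical
  obtain ⟨s, hs⟩ := Set.Finite.exists_maximal (s := {s : Set σ | AlgebraicIndepOn ℂ φ s}) (Set.toFinite _)
    ⟨∅, by
      have : AlgebraicIndependent ℂ (fun i : (∅ : Set σ) => φ i) := algebraicIndependent_empty_type
      exact this⟩
  have hs1 : AlgebraicIndepOn ℂ φ s := hs.1
  have halg : ∀ j ∉ s, IsAlgebraic (Algebra.adjoin ℂ (φ '' s)) (φ j) := by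
    intro j hj
    by_contra hna
    have := hs.2 (hs1.insert hna) (Set.subset_insert j s)
    exact hj (this (Set.mem_insert j s))
  choose! E hE1 hE2 using fun j hj => lemT_one φ s j (halg j hj)
  refine ⟨s.toFinset, ∏ j ∈ s.toFinsetᶜ, E j, ?_, ?_, ?_⟩
  · have := AlgebraicIndependent.cardinalMk_le_trdeg hs1
    rw [MvPolynomial.trdeg_of_isDomain] at this
    simp only [Cardinal.mk_fintype, Cardinal.lift_natCast, Nat.cast_le] at this
    rwa [Set.toFinset_card]
  · rw [map_prod, Finset.prod_ne_zero_iff]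
    intro j hj
    exact hE1 j (by simpa using hj)
  · intro y v hy hk hv
    rw [map_prod, Finset.prod_ne_zero_iff] at hy
    funext j
    by_cases hj : j ∈ s
    · exact hv j (by simpa using hj)
    · exact hE2 j hj y v (hy j (by simpa using hj)) hk (fun i hi => hv i (by simpa using hi))

end lemT
end EM

namespace EM

/-- numerical hypotheses -/
structure Par (c dm dq k : ℕ) : Prop where
  h0 : 1 ≤ dm
  h1 : dm + dq + 1 = k
  h2 : (c+3)*dm + 2*dq = 2*k

lemma Par.h3 {c dm dq k : ℕ} (h : Par c dm dq k) : (c+2)*dm + dq = k+1 := by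
  have h1 := h.h1
  have h2 := h.h2
  have : (c+3)*dm = (c+2)*dm + dm := by ring
  omega

/-- parametrisation -/
def FF (c k : ℕ) {dm dq : ℕ} (m : Fin (dm+1) → ℂ) (q : Fin (dq+1) → ℂ) : Fin (2*k+1) → ℂ :=
  ofP (2*k+1) (toP m ^ (c+3) * toP q ^ 2)

/-- image of the parametrisation -/
def Scone (c dm dq k : ℕ) : Set (Fin (2*k+1) → ℂ) :=
  {a | ∃ (m : Fin (dm+1) → ℂ) (q : Fin (dq+1) → ℂ), a = FF c k m q}

/-- the dual condition -/
def Gam (c dm dq k : ℕ) : Set (Fin (2*k+1) → ℂ) :=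
  {h | ∃ m q : Polynomial ℂ, m ≠ 0 ∧ q ≠ 0 ∧ m.natDegree ≤ dm ∧ q.natDegree ≤ dq ∧
    apo k h (m ^ (c+2) * q)}

section curve
variable {σ : Type} [Fintype σ] [DecidableEq σ]

lemma hasDerivAt_eval (γ : ℂ → σ → ℂ) (γ' : σ → ℂ) (t0 : ℂ)
    (h : ∀ i, HasDerivAt (fun t => γ t i) (γ' i) t0) (p : MvPolynomial σ ℂ) :
    HasDerivAt (fun t => eval (γ t) p) (dl (γ t0) γ' p) t0 := by
  induction p using MvPolynomial.induction_on with
  | C a => simpa [dl_C] using hasDerivAt_const t0 a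
  | add p q hp hq => simpa [dl_add] using hp.fun_add hq
  | mul_X p i hp => 
    have := hp.fun_mul (h i)
    rw [dl_mul, dl_X]
    simpa using this

/-- coefficientwise derivative -/
def HDc (A : ℂ → Polynomial ℂ) (A' : Polynomial ℂ) (t0 : ℂ) : Prop :=
  ∀ i, HasDerivAt (fun t => (A t).coeff i) (A'.coeff i) t0

lemma HDc.mul {A B : ℂ → Polynomial ℂ} {A' B' : Polynomial ℂ} {t0 : ℂ} (hA : HDc A A' t0) (hB : HDc B B' t0) :
    HDc (fun t => A t * B t) (A' * B t0 + A t0 * B') t0 := by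
  intro i
  simp only [Polynomial.coeff_add, Polynomial.coeff_mul]
  rw [← Finset.sum_add_distrib]
  exact HasDerivAt.fun_sum fun s _ => (hA _).fun_mul (hB _)

lemma HDc.pow {A : ℂ → Polynomial ℂ} {A' : Polynomial ℂ} {t0 : ℂ} (hA : HDc A A' t0) (n : ℕ) :
    HDc (fun t => A t ^ (n+1)) (Polynomial.C ((n:ℂ)+1) * A t0 ^ n * A') t0 := by
  induction n with
  | zero => simpa using hA
  | succ n ih =>
    have := ih.mul hA
    have e : Polynomial.C (((n+1:ℕ):ℂ)+1) * A t0 ^ (n+1) * A'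
        = Polynomial.C ((n:ℂ)+1) * A t0 ^ n * A' * A t0 + A t0 ^ (n+1) * A' := by
      push_cast
      simp only [map_add, map_one]
      ring
    rw [e]
    simpa only [pow_succ] using this
end curve

lemma HDc_line {n : ℕ} (a b : Fin n → ℂ) : HDc (fun t => toP (a + t • b)) (toP b) 0 := by
  intro i
  simp only [toP_add, toP_smul, Polynomial.coeff_add, Polynomial.coeff_C_mul]
  have := ((hasDerivAt_id (0:ℂ)).mul_const ((toP b).coeff i)).const_add ((toP a).coeff i)
  simpa using this

section tan
variable {c dm dq k : ℕ}

lemma tan_curve (p : MvPolynomial (Fin (2*k+1)) ℂ)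
    (hp : ∀ y ∈ Scone c dm dq k, eval y p = 0) (m m' : Fin (dm+1) → ℂ) (q q' : Fin (dq+1) → ℂ) :
    dl (FF c k m q) (ofP (2*k+1) (toP m ^ (c+2) * toP q *
      (Polynomial.C ((c:ℂ)+3) * toP m' * toP q + Polynomial.C 2 * toP m * toP q'))) p = 0 := by
  have h1 := ((HDc_line m m').pow (c+2)).mul ((HDc_line q q').pow 1)
  have h2 := hasDerivAt_eval (fun t : ℂ => FF c k (m + t • m') (q + t • q')) _ 0 (fun i => h1 (i:ℕ)) p
  have h3 : (fun t : ℂ => eval (FF c k (m + t • m') (q + t • q')) p) = fun _ => 0 := by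
    funext t; exact hp _ ⟨_, _, rfl⟩
  rw [h3] at h2
  have h4 := h2.unique (hasDerivAt_const (0:ℂ) (0:ℂ))
  simp only [zero_smul, add_zero] at h4
  rw [← h4]
  congr 1
  unfold ofP
  funext i
  congr 1
  push_cast
  simp only [map_add, map_one, map_natCast, map_ofNat]
  ring

/-- as linear maps -/
def toPl (n : ℕ) : (Fin n → ℂ) →ₗ[ℂ] Polynomial ℂ where
  toFun := toP
  map_add' := toP_add
  map_smul' c b := by rw [toP_smul, Polynomial.smul_eq_C_mul]; rfl

/-- coefficient map -/
def ofPl (n : ℕ) : Polynomial ℂ →ₗ[ℂ] (Fin n → ℂ) where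
  toFun := ofP n
  map_add' p q := by ext; simp [ofP]
  map_smul' c b := by ext; simp [ofP]

/-- tangent map -/
def Tl (c k : ℕ) (m : Fin (dm+1) → ℂ) (q : Fin (dq+1) → ℂ) :
    ((Fin (dm+1) → ℂ) × (Fin (dq+1) → ℂ)) →ₗ[ℂ] (Fin k → ℂ) :=
  ofPl k ∘ₗ ((LinearMap.mulLeft ℂ (Polynomial.C ((c:ℂ)+3) * toP q)) ∘ₗ toPl _ ∘ₗ LinearMap.fst _ _ _ +
    (LinearMap.mulLeft ℂ (Polynomial.C 2 * toP m)) ∘ₗ toPl _ ∘ₗ LinearMap.snd _ _ _)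

lemma Tl_apply (m m' : Fin (dm+1) → ℂ) (q q' : Fin (dq+1) → ℂ) : Tl c k m q (m', q') =
    ofP k (Polynomial.C ((c:ℂ)+3) * toP m' * toP q + Polynomial.C 2 * toP m * toP q') := by
  have : Polynomial.C ((c:ℂ)+3) * toP m' * toP q = Polynomial.C ((c:ℂ)+3) * toP q * toP m' := by ring
  rw [this]
  rfl

lemma Tl_apply' (m : Fin (dm+1) → ℂ) (q : Fin (dq+1) → ℂ) (x) : Tl c k m q x =
    ofP k (Polynomial.C ((c:ℂ)+3) * toP x.1 * toP q + Polynomial.C 2 * toP m * toP x.2) := 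
  Tl_apply m x.1 q x.2

lemma Tl_surj (h : Par c dm dq k) : Function.Surjective
    (Tl c k (ofP (dm+1) (1 : Polynomial ℂ)) (ofP (dq+1) (Polynomial.X ^ dq : Polynomial ℂ))) := by
  intro r
  have hk := h.h1
  obtain ⟨k', rfl⟩ : ∃ k', k = k' + 1 := ⟨k - 1, by omega⟩
  have hmon : (Polynomial.X ^ dq : Polynomial ℂ).Monic := Polynomial.monic_X_pow dq
  have hr := natDegree_toP r
  refine ⟨(ofP _ (Polynomial.C (((c:ℂ)+3)⁻¹) * (toP r /ₘ Polynomial.X ^ dq)),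
    ofP _ (Polynomial.C ((2:ℂ)⁻¹) * (toP r %ₘ Polynomial.X ^ dq))), ?_⟩
  rw [Tl_apply, toP_ofP, toP_ofP, toP_ofP, toP_ofP]
  · have e1 : Polynomial.C ((c:ℂ)+3) * (Polynomial.C (((c:ℂ)+3)⁻¹) * (toP r /ₘ Polynomial.X ^ dq)) * Polynomial.X ^ dq
      + Polynomial.C 2 * 1 * (Polynomial.C ((2:ℂ)⁻¹) * (toP r %ₘ Polynomial.X ^ dq)) = toP r := by
      have h3 : ((c:ℂ)+3) ≠ 0 := by exact_mod_cast (by omega : c + 3 ≠ 0)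
      rw [← mul_assoc (Polynomial.C ((c:ℂ)+3)), ← Polynomial.C_mul, mul_inv_cancel₀ h3, mul_one,
        ← mul_assoc (Polynomial.C (2:ℂ)), ← Polynomial.C_mul, mul_inv_cancel₀ two_ne_zero, Polynomial.C_1,
        one_mul, one_mul]
      have := Polynomial.modByMonic_add_div (toP r) (Polynomial.X ^ dq)
      rw [mul_comm, add_comm]; exact this
    rw [e1, ofP_toP]
  · refine (Polynomial.natDegree_C_mul_le _ _).trans ?_
    rcases Nat.eq_zero_or_pos dq with h0 | h0
    · subst h0; simp
    · have := Polynomial.natDegree_modByMonic_lt (toP r) hmon (by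
        intro h1
        have := congrArg Polynomial.natDegree h1
        simp at this; omega)
      simp at this; omega
  · simp
  · simp
  · refine (Polynomial.natDegree_C_mul_le _ _).trans ?_
    rw [Polynomial.natDegree_divByMonic _ hmon]
    simp
    omega

lemma natDegree_gr (h : Par c dm dq k) {m q r : Polynomial ℂ} (hm : m.natDegree ≤ dm) (hq : q.natDegree ≤ dq)
    (hr : r.natDegree < k) : (m ^ (c+2) * q * r).natDegree ≤ 2*k := by
  have h3 := h.h3
  have := natDegree_mul_le' (natDegree_mul_le' (Polynomial.natDegree_pow_le_of_le (c+2) hm) hq) 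
    (show r.natDegree ≤ k - 1 by omega)
  omega

lemma dl_add_right {σ : Type} [Fintype σ] (y v w : σ → ℂ) (p) : dl y (v + w) p = dl y v p + dl y w p := by
  simp [dl, mul_add, Finset.sum_add_distrib]
lemma dl_smul_right {σ : Type} [Fintype σ] (y v : σ → ℂ) (c : ℂ) (p) : dl y (c • v) p = c * dl y v p := by
  simp only [dl, Finset.mul_sum, Pi.smul_apply, smul_eq_mul]
  exact Finset.sum_congr rfl fun i _ => by ring

lemma LP.coord {ι : Type} (i : ι) : LP (fun x : ι → ℂ => x i) :=
  LP.linear (LinearMap.proj (R := ℂ) (φ := fun _ : ι => ℂ) i)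
lemma LP.fst {U W : Type} [AddCommGroup U] [Module ℂ U] [AddCommGroup W] [Module ℂ W] {f : U → ℂ}
    (hf : LP f) : LP (fun x : U × W => f x.1) := hf.comp_linear (LinearMap.fst ℂ U W)
lemma LP.snd {U W : Type} [AddCommGroup U] [Module ℂ U] [AddCommGroup W] [Module ℂ W] {f : W → ℂ}
    (hf : LP f) : LP (fun x : U × W => f x.2) := hf.comp_linear (LinearMap.snd ℂ U W)

lemma LP_dl {V : Type} [AddCommGroup V] [Module ℂ V] {σ : Type} [Fintype σ] {y v : V → σ → ℂ}
    (hy : ∀ i, LP (fun x => y x i)) (hv : ∀ i, LP (fun x => v x i)) (p : MvPolynomial σ ℂ) :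
    LP (fun x => dl (y x) (v x) p) :=
  LP.sum _ fun i => (LP.eval hy _).mul (hv i)

lemma LP_FF {V : Type} [AddCommGroup V] [Module ℂ V] {m : V → Fin (dm+1) → ℂ} {q : V → Fin (dq+1) → ℂ}
    (hm : ∀ i, LP (fun x => m x i)) (hq : ∀ i, LP (fun x => q x i)) (i) :
    LP (fun x => FF c k (m x) (q x) i) := by
  show LP (fun x => (toP (m x) ^ (c+3) * toP (q x) ^ 2).coeff (i:ℕ))
  exact (((LPP.toP hm).pow (c+3)).mul ((LPP.toP hq).pow 2)) (i:ℕ)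

lemma tan_all (h : Par c dm dq k) (p : MvPolynomial (Fin (2*k+1)) ℂ)
    (hp : ∀ y ∈ Scone c dm dq k, eval y p = 0) (m : Fin (dm+1) → ℂ) (q : Fin (dq+1) → ℂ) (r : Fin k → ℂ) :
    dl (FF c k m q) (ofP (2*k+1) (toP m ^ (c+2) * toP q * toP r)) p = 0 := by
  set m0 := ofP (dm+1) (1 : Polynomial ℂ)
  set q0 := ofP (dq+1) (Polynomial.X ^ dq : Polynomial ℂ)
  obtain ⟨s, hs⟩ := (Tl c k m0 q0).exists_rightInverse_of_surjective (LinearMap.range_eq_top.2 (Tl_surj h))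
  let V := (Fin (dm+1) → ℂ) × (Fin (dq+1) → ℂ) × (Fin k → ℂ)
  let A : V → Matrix (Fin k) (Fin k) ℂ := fun x => LinearMap.toMatrix' (Tl c k x.1 x.2.1 ∘ₗ s)
  have hm : ∀ i, LP (fun x : V => x.1 i) := fun i => LP.fst (LP.coord i)
  have hq : ∀ i, LP (fun x : V => x.2.1 i) := fun i => LP.snd (LP.fst (LP.coord i))
  have hr : ∀ i, LP (fun x : V => x.2.2 i) := fun i => LP.snd (LP.snd (LP.coord i))
  have hA : ∀ i j, LP (fun x : V => A x i j) := by
    intro i j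
    simp only [A, LinearMap.toMatrix'_apply]
    simp only [LinearMap.comp_apply]
    simp only [Tl_apply', ofP]
    exact (((LPP.const _).mul (LPP.toP hq)).add (((LPP.const _).mul (LPP.toP hm)).mul (LPP.const _))) (i:ℕ)
  refine LP.domain (V := V) (f := fun x => dl (FF c k x.1 x.2.1) (ofP (2*k+1) (toP x.1 ^ (c+2) * toP x.2.1 * toP x.2.2)) p)
    (g := fun x => (A x).det) ?_ (LP.det hA) ?_ (w := (m0, q0, 0)) ?_ (m, q, r)
  · exact LP_dl (LP_FF hm hq) (fun i => ((((LPP.toP hm).pow _).mul (LPP.toP hq)).mul (LPP.toP hr)) (i:ℕ)) p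
  · rintro ⟨m, q, r⟩ hdet
    simp only at hdet ⊢
    set m' := (s ((A (m,q,r)).adjugate.mulVec r)).1
    set q' := (s ((A (m,q,r)).adjugate.mulVec r)).2
    have h1 : (A (m,q,r)).det • r = Tl c k m q (m', q') := by
      have : Tl c k m q (m', q') = (A (m,q,r)).mulVec ((A (m,q,r)).adjugate.mulVec r) := by
        simp only [A, LinearMap.toMatrix'_mulVec]; rfl
      rw [this, Matrix.mulVec_mulVec, Matrix.mul_adjugate, Matrix.smul_mulVec, Matrix.one_mulVec]
    have h2 := tan_curve p hp m m' q q'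
    have h3 : (Polynomial.C ((c:ℂ)+3) * toP m' * toP q + Polynomial.C 2 * toP m * toP q')
        = Polynomial.C (A (m,q,r)).det * toP r := by
      rw [← toP_smul (A (m,q,r)).det r, h1, Tl_apply]
      have hk := h.h1
      obtain ⟨k', rfl⟩ : ∃ k', k = k' + 1 := ⟨k - 1, by omega⟩
      rw [toP_ofP]
      apply Polynomial.natDegree_add_le_of_degree_le
      · rw [mul_assoc]
        refine (Polynomial.natDegree_C_mul_le _ _).trans ?_
        have := natDegree_mul_le' (natDegree_toP m') (natDegree_toP q)
        omega
      · rw [mul_assoc]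
        refine (Polynomial.natDegree_C_mul_le _ _).trans ?_
        have := natDegree_mul_le' (natDegree_toP m) (natDegree_toP q')
        omega
    rw [h3] at h2
    have h4 : ofP (2*k+1) (toP m ^ (c+2) * toP q * (Polynomial.C (A (m,q,r)).det * toP r))
      = (A (m,q,r)).det • ofP (2*k+1) (toP m ^ (c+2) * toP q * toP r) := by
      rw [show toP m ^ (c+2) * toP q * (Polynomial.C (A (m,q,r)).det * toP r)
        = Polynomial.C (A (m,q,r)).det * (toP m ^ (c+2) * toP q * toP r) by ring]
      funext i
      simp only [ofP, Polynomial.coeff_C_mul, Pi.smul_apply, smul_eq_mul]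
    rw [h4, dl_smul_right] at h2
    exact (mul_eq_zero.1 h2).resolve_left hdet
  · simp only [A]
    rw [hs]
    simp

end tan
end EM

namespace EM

section smooth
variable {c dm dq k : ℕ}

lemma map_toP {R S : Type} [CommSemiring R] [CommSemiring S] (f : R →+* S) {n : ℕ} (a : Fin n → R) :
    (toP a).map f = toP (fun i => f (a i)) := by
  ext i
  rw [Polynomial.coeff_map, coeff_toP, coeff_toP]
  split <;> simp

lemma eval_aeval {σ τ : Type} (φ : σ → MvPolynomial τ ℂ) (x : τ → ℂ) (p : MvPolynomial σ ℂ) :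
    eval x (aeval φ p) = eval (fun i => eval x (φ i)) p := by
  induction p using MvPolynomial.induction_on with
  | C a => simp
  | add p q hp hq => rw [map_add, map_add, map_add, hp, hq]
  | mul_X p i hp => rw [map_mul, map_mul, map_mul, hp, aeval_X, eval_X]

/-- chart -/
def chart (c dm dq k : ℕ) : Fin (2*k+1) → MvPolynomial (Fin dm ⊕ Fin (dq+1)) ℂ := fun i =>
  (toP (Fin.cons 1 (fun j => X (Sum.inl j)) : Fin (dm+1) → MvPolynomial (Fin dm ⊕ Fin (dq+1)) ℂ) ^ (c+3) *
    toP (fun j : Fin (dq+1) => (X (Sum.inr j) : MvPolynomial (Fin dm ⊕ Fin (dq+1)) ℂ)) ^ 2).coeff i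

lemma eval_chart (x : Fin dm ⊕ Fin (dq+1) → ℂ) (i : Fin (2*k+1)) :
    eval x (chart c dm dq k i) = FF c k (Fin.cons 1 (fun j => x (Sum.inl j)) : Fin (dm+1) → ℂ) (fun j => x (Sum.inr j)) i := by
  unfold chart FF ofP
  rw [← Polynomial.coeff_map, Polynomial.map_mul, Polynomial.map_pow, Polynomial.map_pow, map_toP, map_toP]
  congr 3
  · congr 1
    funext j
    refine Fin.cases ?_ (fun j => ?_) j <;> simp
  · simp

lemma toP_C_smul {n : ℕ} (s : ℂ) (q : Fin n → ℂ) (e : ℕ) : toP (s • q) ^ e = Polynomial.C (s^e) * toP q ^ e := by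
  rw [toP_smul, mul_pow, Polynomial.C_pow]

lemma FF_chart (m : Fin (dm+1) → ℂ) (q : Fin (dq+1) → ℂ) (hm : m 0 ≠ 0) :
    ∃ x, FF c k m q = fun i => eval x (chart c dm dq k i) := by
  obtain ⟨s, hs⟩ := IsAlgClosed.exists_pow_nat_eq ((m 0) ^ (c+3)) zero_lt_two
  refine ⟨Sum.elim (fun j => (m 0)⁻¹ * m j.succ) (s • q), ?_⟩
  funext i
  rw [eval_chart]
  simp only [Sum.elim_inl, Sum.elim_inr]
  have h2 : m = (m 0) • (Fin.cons 1 (fun j => (m 0)⁻¹ * m j.succ) : Fin (dm+1) → ℂ) := by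
    funext j
    refine Fin.cases ?_ (fun j => ?_) j
    · simp
    · simp [hm]
  unfold FF ofP
  have h3 : toP m ^ (c+3) = Polynomial.C ((m 0)^(c+3)) * toP (Fin.cons 1 (fun j => (m 0)⁻¹ * m j.succ) : Fin (dm+1) → ℂ) ^ (c+3) := by
    rw [← toP_C_smul, ← h2]
  rw [h3, show (fun j => (s • q) j) = s • q from rfl, toP_C_smul, hs]
  refine congrArg (fun p : Polynomial ℂ => p.coeff i) ?_
  ring

lemma vanish_of_chart (p : MvPolynomial (Fin (2*k+1)) ℂ) (hp : aeval (chart c dm dq k) p = 0) :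
    ∀ y ∈ Scone c dm dq k, eval y p = 0 := by
  rintro y ⟨m, q, rfl⟩
  have hml : ∀ i, LP (fun x : (Fin (dm+1) → ℂ) × (Fin (dq+1) → ℂ) => x.1 i) := fun i => LP.fst (LP.coord i)
  have hql : ∀ i, LP (fun x : (Fin (dm+1) → ℂ) × (Fin (dq+1) → ℂ) => x.2 i) := fun i => LP.snd (LP.coord i)
  have hmain := LP.domain (LP.eval (LP_FF (c := c) (k := k) hml hql) p) (hml 0) ?_
    (w := (fun _ => 1, fun _ => 0)) (by simp)
  · exact hmain (m, q)
  intro x hm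
  obtain ⟨y, hy⟩ := FF_chart (c := c) (k := k) x.1 x.2 hm
  have h1 := eval_aeval (chart c dm dq k) y p
  rw [hp, map_zero] at h1
  rw [hy, h1]

lemma zTangent_eq {σ : Type} [Fintype σ] [DecidableEq σ] (S : Set (σ → ℂ)) (a v : σ → ℂ) :
    v ∈ zTangentAt S a ↔ ∀ p, (∀ y ∈ S, eval y p = 0) → dl a v p = 0 := Iff.rfl

/-- tangent space as a submodule -/
def tanSub {σ : Type} [Fintype σ] [DecidableEq σ] (S : Set (σ → ℂ)) (a : σ → ℂ) : Submodule ℂ (σ → ℂ) where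
  carrier := zTangentAt S a
  add_mem' := by
    intro v w hv hw p hp
    have := dl_add_right a v w p
    have h1 : dl a v p = 0 := hv p hp
    have h2 : dl a w p = 0 := hw p hp
    rw [h1, h2, add_zero] at this
    exact this
  zero_mem' := by intro p _; simp
  smul_mem' := by
    intro c v hv p hp
    have := dl_smul_right a v c p
    have h1 : dl a v p = 0 := hv p hp
    rw [h1, mul_zero] at this
    exact this

lemma span_zTangent {σ : Type} [Fintype σ] [DecidableEq σ] (S : Set (σ → ℂ)) (a : σ → ℂ) :
    Submodule.span ℂ (zTangentAt S a) = tanSub S a := Submodule.span_eq (tanSub S a)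

/-- multiplication by `g` -/
def mulG (k : ℕ) (g : Polynomial ℂ) : (Fin k → ℂ) →ₗ[ℂ] (Fin (2*k+1) → ℂ) :=
  ofPl (2*k+1) ∘ₗ LinearMap.mulLeft ℂ g ∘ₗ toPl k

lemma mulG_apply (k : ℕ) (g : Polynomial ℂ) (r) : mulG k g r = ofP (2*k+1) (g * toP r) := rfl

lemma natDegree_toP_lt {K : Type} [CommSemiring K] {k : ℕ} (hk : 0 < k) (r : Fin k → K) : (toP r).natDegree < k := by
  obtain ⟨k', rfl⟩ : ∃ k', k = k' + 1 := ⟨k - 1, by omega⟩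
  exact Nat.lt_succ_of_le (natDegree_toP r)

lemma mulG_inj (k : ℕ) (hk : 0 < k) (g : Polynomial ℂ) (hg : g ≠ 0) (hd : g.natDegree ≤ k+1) :
    Function.Injective (mulG k g) := by
  rw [← LinearMap.ker_eq_bot, LinearMap.ker_eq_bot']
  intro r hr
  rw [mulG_apply] at hr
  have h1 : (g * toP r).natDegree ≤ 2*k := by
    have := natDegree_mul_le' hd (Nat.le_sub_one_of_lt (natDegree_toP_lt hk r))
    omega
  have h2 : g * toP r = 0 := by rw [← toP_ofP _ h1, hr, toP_zero]
  exact toP_injective (by simpa using (mul_eq_zero.1 h2).resolve_left hg)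

lemma smooth (h : Par c dm dq k) : ∃ E : MvPolynomial (Fin (2*k+1)) ℂ,
    (∃ (m : Fin (dm+1) → ℂ) (q : Fin (dq+1) → ℂ), eval (FF c k m q) E ≠ 0) ∧
    ∀ (m : Fin (dm+1) → ℂ) (q : Fin (dq+1) → ℂ), eval (FF c k m q) E ≠ 0 → m ≠ 0 → q ≠ 0 →
      zTangentDim (Scone c dm dq k) (FF c k m q) = k ∧
      ∀ v ∈ zTangentAt (Scone c dm dq k) (FF c k m q), ∃ r : Fin k → ℂ,
        v = ofP (2*k+1) (toP m ^ (c+2) * toP q * toP r) := by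
  obtain ⟨B, E, hB, hE1, hE2⟩ := lemT (chart c dm dq k)
  have hk1 := h.h1
  refine ⟨E, ?_, ?_⟩
  · by_contra hcon
    push Not at hcon
    apply hE1
    apply MvPolynomial.funext
    intro x
    rw [eval_aeval, map_zero, ← hcon (Fin.cons 1 (fun j => x (Sum.inl j))) (fun j => x (Sum.inr j))]
    congr 2
    funext i
    exact eval_chart x i
  · intro m q hE hm hq
    set S := Scone c dm dq k
    set a := FF c k m q
    have hm' : toP m ≠ 0 := fun h => hm (toP_injective (by simpa using h))
    have hq' : toP q ≠ 0 := fun h => hq (toP_injective (by simpa using h))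
    have hg : toP m ^ (c+2) * toP q ≠ 0 := mul_ne_zero (pow_ne_zero _ hm') hq'
    have hgd : (toP m ^ (c+2) * toP q).natDegree ≤ k + 1 := by
      have := natDegree_mul_le' (Polynomial.natDegree_pow_le_of_le (c+2) (natDegree_toP m)) (natDegree_toP q)
      have := h.h3
      omega
    have hle : LinearMap.range (mulG k (toP m ^ (c+2) * toP q)) ≤ tanSub S a := by
      rintro _ ⟨r, rfl⟩
      intro p hp
      exact tan_all h p hp m q r
    have hrk : Module.finrank ℂ (LinearMap.range (mulG k (toP m ^ (c+2) * toP q))) = k := by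
      rw [LinearMap.finrank_range_of_inj (mulG_inj k (by omega) _ hg hgd)]
      simp
    have hup : Module.finrank ℂ (tanSub S a) ≤ k := by
      let f : tanSub S a →ₗ[ℂ] (B → ℂ) := LinearMap.pi fun i => LinearMap.proj (i : Fin (2*k+1)) ∘ₗ (tanSub S a).subtype
      have hf : Function.Injective f := by
        rw [← LinearMap.ker_eq_bot, LinearMap.ker_eq_bot']
        rintro ⟨v, hv⟩ hv0
        apply Subtype.ext
        refine hE2 a v hE (fun p hp => hv p (vanish_of_chart p hp)) ?_
        intro i hi
        exact congrFun hv0 ⟨i, hi⟩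
      have := LinearMap.finrank_le_finrank_of_injective hf
      simp at this hB
      omega
    have heq := Submodule.eq_of_le_of_finrank_le hle (by rw [hrk]; exact hup)
    refine ⟨?_, ?_⟩
    · unfold zTangentDim
      rw [span_zTangent, ← heq, hrk]
    · intro v hv
      have : v ∈ tanSub S a := hv
      rw [← heq] at this
      obtain ⟨r, rfl⟩ := this
      exact ⟨r, rfl⟩

lemma Lf_ofP {K : Type} [Field K] {d : ℕ} (h : Fin (d+1) → K) (p : Polynomial K) (hp : p.natDegree ≤ d) :
    Lf d h (toP (ofP (d+1) p)) = Lf d h p := by rw [toP_ofP p hp]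

theorem propI (h : Par c dm dq k) : dualConeOf (2*k) (Scone c dm dq k) k = zClosure (Gam c dm dq k) := by
  have hk1 := h.h1
  apply Set.Subset.antisymm
  · intro x hx p hp
    apply hx p
    rintro y ⟨_, a, ⟨m, q, rfl⟩, ha0, _, hv⟩
    apply hp
    have hm : toP m ≠ 0 := by
      intro h0; apply ha0; unfold FF; rw [h0]; ext; simp [ofP]
    have hq : toP q ≠ 0 := by
      intro h0; apply ha0; unfold FF; rw [h0]; ext; simp [ofP]
    refine ⟨toP m, toP q, hm, hq, natDegree_toP m, natDegree_toP q, ?_⟩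
    apply apo_of
    intro r hr
    have hr' : toP (ofP k r) = r := by
      obtain ⟨k', rfl⟩ : ∃ k', k = k' + 1 := ⟨k - 1, by omega⟩
      exact toP_ofP r (by omega)
    have h1 := hv (ofP (2*k+1) (toP m ^ (c+2) * toP q * r)) (by
      intro p hp
      have := tan_all h p hp m q (ofP k r)
      rw [hr'] at this
      exact this)
    rw [apolarPair_eq, Lf_ofP _ _ (natDegree_gr h (natDegree_toP m) (natDegree_toP q) hr)] at h1
    exact h1
  · intro x hx p hp
    apply hx p
    rintro h0 ⟨m1, q1, hm1, hq1, hmd, hqd, hapo⟩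
    have hg : m1 ^ (c+2) * q1 ≠ 0 := mul_ne_zero (pow_ne_zero _ hm1) hq1
    have hgd : (m1 ^ (c+2) * q1).natDegree ≤ k + 1 := by
      have := natDegree_mul_le' (Polynomial.natDegree_pow_le_of_le (c+2) hmd) hqd
      have := h.h3
      omega
    obtain ⟨S, hS⟩ := MM_rightInv k _ hg hgd
    obtain ⟨h', hh', hh0⟩ : ∃ h' : Fin (2*k+1) → ℂ, (MM k (m1 ^ (c+2) * q1)).mulVec h' = 0 ∧ h' ≠ 0 := by
      have h1 : LinearMap.ker (MM k (m1 ^ (c+2) * q1)).mulVecLin ≠ ⊥ := by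
        intro h0
        have := LinearMap.finrank_le_finrank_of_injective (LinearMap.ker_eq_bot.1 h0)
        simp at this
        omega
      obtain ⟨z, hz, hz0⟩ := Submodule.exists_mem_ne_zero_of_ne_bot h1
      exact ⟨z, by simpa using hz, hz0⟩
    obtain ⟨i, hi⟩ := Function.ne_iff.1 hh0
    obtain ⟨E, ⟨m2, q2, hE⟩, hsm⟩ := smooth h
    have ha1 : toP (FF c k (ofP (dm+1) m1) (ofP (dq+1) q1)) ≠ 0 := by
      unfold FF
      rw [toP_ofP m1 hmd, toP_ofP q1 hqd, toP_ofP]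
      · exact mul_ne_zero (pow_ne_zero _ hm1) (pow_ne_zero _ hq1)
      · have := natDegree_mul_le' (Polynomial.natDegree_pow_le_of_le (c+3) hmd) (Polynomial.natDegree_pow_le_of_le 2 hqd)
        have := h.h2
        omega
    obtain ⟨l, hl⟩ : ∃ l, FF c k (ofP (dm+1) m1) (ofP (dq+1) q1) l ≠ 0 := by
      by_contra hcon
      push Not at hcon
      exact ha1 (by rw [show FF c k (ofP (dm+1) m1) (ofP (dq+1) q1) = 0 from funext hcon, toP_zero])
    let V := (Fin (dm+1) → ℂ) × (Fin (dq+1) → ℂ) × (Fin (2*k+1) → ℂ)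
    have hm : ∀ i, LP (fun x : V => x.1 i) := fun i => LP.fst (LP.coord i)
    have hq : ∀ i, LP (fun x : V => x.2.1 i) := fun i => LP.snd (LP.fst (LP.coord i))
    have hz : ∀ i, LP (fun x : V => x.2.2 i) := fun i => LP.snd (LP.snd (LP.coord i))
    let H : V → Fin (2*k+1) → ℂ := fun x => kerProj (MM k (toP x.1 ^ (c+2) * toP x.2.1)) S x.2.2
    have hH : ∀ i, LP (fun x => H x i) := LP.kerProj (LPP.MM (((LPP.toP hm).pow (c+2)).mul (LPP.toP hq)))
      (fun _ _ => LP.const _) hz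
    have hEL : LP (fun x : V => eval (FF c k x.1 x.2.1) E) := LP.eval (LP_FF hm hq) E
    have hmain : ∀ x : V, eval (H x) p = 0 := by
      refine LP.domain (LP.eval hH p) (hH i) ?_ (w := (ofP (dm+1) m1, ofP (dq+1) q1, h')) ?_
      · intro x hx
        refine LP.domain (f := fun x => eval (H x) p * H x i) ((LP.eval hH p).mul (hH i)) hEL ?_ (w := (m2, q2, 0)) hE x |> mul_eq_zero.1 |>.resolve_right hx
        intro x hxE
        refine LP.domain (f := fun x => eval (H x) p * H x i * eval (FF c k x.1 x.2.1) E) (((LP.eval hH p).mul (hH i)).mul hEL) (LP_FF hm hq l) ?_ 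
          (w := (ofP (dm+1) m1, ofP (dq+1) q1, 0)) hl x |> mul_eq_zero.1 |>.resolve_right hxE
        intro x hxl
        by_cases hxi : H x i = 0
        · rw [hxi]; ring
        by_cases hxE : eval (FF c k x.1 x.2.1) E = 0
        · rw [hxE]; ring
        rw [hp (H x), zero_mul, zero_mul]
        have hFn : FF c k x.1 x.2.1 ≠ 0 := fun h0 => hxl (by rw [h0]; rfl)
        have hm0 : x.1 ≠ 0 := by
          intro h0; apply hFn; unfold FF; rw [h0]; ext; simp [ofP]
        have hq0 : x.2.1 ≠ 0 := by
          intro h0; apply hFn; unfold FF; rw [h0]; ext; simp [ofP]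
        obtain ⟨hs1, hs2⟩ := hsm x.1 x.2.1 hxE hm0 hq0
        refine ⟨fun h0 => hxi (by rw [h0]; rfl), _, ⟨x.1, x.2.1, rfl⟩, hFn, hs1, ?_⟩
        intro v hv
        obtain ⟨r, rfl⟩ := hs2 v hv
        have hr := natDegree_toP_lt (show 0 < k by omega) r
        rw [apolarPair_eq, Lf_ofP _ _ (natDegree_gr h (natDegree_toP _) (natDegree_toP _) hr)]
        refine apo_mul ?_ _ hr
        rw [apo_iff_MM]
        exact mulVec_kerProj _ _ _
      · simp only [H]
        rw [toP_ofP m1 hmd, toP_ofP q1 hqd, kerProj_eq _ _ _ hS hh']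
        exact hi
    have := hmain (ofP (dm+1) m1, ofP (dq+1) q1, h0)
    simp only [H] at this
    rwa [toP_ofP m1 hmd, toP_ofP q1 hqd, kerProj_eq _ _ _ hS ((apo_iff_MM _ _ _).1 hapo)] at this

end smooth
end EM

namespace EM

section split

lemma exists_lin_factor (n : ℕ) (p : Polynomial ℂ) (hp : p.natDegree ≤ n+1) :
    ∃ (p' : Polynomial ℂ) (u v : ℂ), p'.natDegree ≤ n ∧ ¬ (u = 0 ∧ v = 0) ∧ p = p' * lin u v := by
  by_cases h : p.natDegree ≤ n
  · exact ⟨p, 1, 0, h, by simp, by simp [lin]⟩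
  · have hd : p.degree ≠ 0 := by
      intro h0
      have := Polynomial.natDegree_eq_zero_iff_degree_le_zero.2 h0.le
      omega
    obtain ⟨z, hz⟩ := IsAlgClosed.exists_root p hd
    obtain ⟨p', h1, h2⟩ := exists_factor n p hp (-z) 1 (by simp) (by
      rw [hev_one _ _ hp, neg_neg]; exact hz)
    exact ⟨p', -z, 1, h1, by simp, h2⟩

lemma split_lin (n : ℕ) (p : Polynomial ℂ) (hp : p.natDegree ≤ n) :
    ∃ (t : ℂ) (u v : Fin n → ℂ), p = Polynomial.C t * ∏ i, lin (u i) (v i) := by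
  induction n generalizing p with
  | zero => exact ⟨p.coeff 0, Fin.elim0, Fin.elim0, by
      simpa using Polynomial.eq_C_of_natDegree_le_zero hp⟩
  | succ n ih =>
    obtain ⟨p', u, v, h1, _, rfl⟩ := exists_lin_factor n p hp
    obtain ⟨t, u', v', rfl⟩ := ih p' h1
    refine ⟨t, Fin.cons u u', Fin.cons v v', ?_⟩
    rw [Fin.prod_univ_succ]
    simp only [Fin.cons_zero, Fin.cons_succ]
    ring

lemma natDegree_prod_lin {K : Type} [Field K] (n : ℕ) (u v : Fin n → K) : (∏ i, lin (u i) (v i)).natDegree ≤ n := by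
  refine (Polynomial.natDegree_prod_le _ _).trans ?_
  refine (Finset.sum_le_sum fun i _ => natDegree_lin _ _).trans ?_
  simp

lemma par3 (K : ℕ) : Par 0 2 K (K+3) := ⟨by omega, by omega, by omega⟩
lemma par4 (K : ℕ) : Par 1 1 (K+1) (K+3) := ⟨by omega, by omega, by omega⟩

lemma natDegree_FF {c dm dq k : ℕ} (h : Par c dm dq k) {m q : Polynomial ℂ} (hm : m.natDegree ≤ dm) (hq : q.natDegree ≤ dq) :
    (m ^ (c+3) * q ^ 2).natDegree ≤ 2*k := by
  have := natDegree_mul_le' (Polynomial.natDegree_pow_le_of_le (c+3) hm) (Polynomial.natDegree_pow_le_of_le 2 hq)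
  have := h.h2
  omega

lemma mem_Scone {c dm dq k : ℕ} (h : Par c dm dq k) (a : Fin (2*k+1) → ℂ) : a ∈ Scone c dm dq k ↔
    ∃ m q : Polynomial ℂ, m.natDegree ≤ dm ∧ q.natDegree ≤ dq ∧ toP a = m ^ (c+3) * q ^ 2 := by
  constructor
  · rintro ⟨m, q, rfl⟩
    refine ⟨toP m, toP q, natDegree_toP m, natDegree_toP q, ?_⟩
    unfold FF
    rw [toP_ofP]
    exact natDegree_FF h (natDegree_toP m) (natDegree_toP q)
  · rintro ⟨m, q, hm, hq, e⟩
    refine ⟨ofP _ m, ofP _ q, ?_⟩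
    apply toP_injective
    unfold FF
    rw [toP_ofP m hm, toP_ofP q hq, toP_ofP _ (natDegree_FF h hm hq), e]

lemma crl3 (K : ℕ) : crlCone (2*(K+3)) (K+3-1) (fun t => if (t : ℕ) < 2 then 3 else 2) = Scone 0 2 K (K+3) := by
  ext a
  change a ∈ crlCone (2*(K+3)) (K+2) (fun t => if (t : ℕ) < 2 then 3 else 2) ↔ _
  rw [mem_crlCone_iff _ (by
    rw [Fin.sum_univ_succ, Fin.sum_univ_succ]; simp; ring), mem_Scone (par3 K)]
  simp only [Fin.prod_univ_succ]
  constructor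
  · rintro ⟨t, u, v, e⟩
    obtain ⟨s, hs⟩ := IsAlgClosed.exists_pow_nat_eq t zero_lt_two
    refine ⟨lin (u 0) (v 0) * lin (u (Fin.succ 0)) (v (Fin.succ 0)), Polynomial.C s * ∏ i : Fin K, lin (u i.succ.succ) (v i.succ.succ), 
      natDegree_mul_le' (natDegree_lin _ _) (natDegree_lin _ _), ?_, ?_⟩
    · exact (Polynomial.natDegree_C_mul_le _ _).trans (natDegree_prod_lin K (fun i => u i.succ.succ) (fun i => v i.succ.succ))
    · rw [e, mul_pow (Polynomial.C s), ← Polynomial.C_pow, hs, ← Finset.prod_pow]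
      simp
      ring
  · rintro ⟨m, q, hm, hq, e⟩
    obtain ⟨t1, u1, v1, rfl⟩ := split_lin 2 m hm
    obtain ⟨t2, u2, v2, rfl⟩ := split_lin K q hq
    refine ⟨t1^3*t2^2, Fin.cons (u1 0) (Fin.cons (u1 1) u2), Fin.cons (v1 0) (Fin.cons (v1 1) v2), ?_⟩
    rw [e]
    simp [mul_pow, Finset.prod_pow]
    ring

lemma crl4 (K : ℕ) : crlCone (2*(K+3)) (K+3-1) (fun t => if (t : ℕ) = 0 then 4 else 2) = Scone 1 1 (K+1) (K+3) := by
  ext a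
  change a ∈ crlCone (2*(K+3)) (K+2) (fun t => if (t : ℕ) = 0 then 4 else 2) ↔ _
  rw [mem_crlCone_iff _ (by
    rw [Fin.sum_univ_succ]; simp; ring), mem_Scone (par4 K)]
  rw [show K + 2 = (K+1)+1 from rfl]
  constructor
  · rintro ⟨t, u, v, e⟩
    obtain ⟨s, hs⟩ := IsAlgClosed.exists_pow_nat_eq t zero_lt_two
    refine ⟨lin (u 0) (v 0), Polynomial.C s * ∏ i : Fin (K+1), lin (u i.succ) (v i.succ), 
      (natDegree_lin _ _), ?_, ?_⟩
    · exact (Polynomial.natDegree_C_mul_le _ _).trans (natDegree_prod_lin (K+1) (fun i => u i.succ) (fun i => v i.succ))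
    · rw [e, Fin.prod_univ_succ, mul_pow (Polynomial.C s), ← Polynomial.C_pow, hs, ← Finset.prod_pow]
      simp
      ring
  · rintro ⟨m, q, hm, hq, e⟩
    obtain ⟨t1, u1, v1, rfl⟩ := split_lin 1 m hm
    obtain ⟨t2, u2, v2, rfl⟩ := split_lin (K+1) q hq
    refine ⟨t1^4*t2^2, Fin.cons (u1 0) u2, Fin.cons (v1 0) v2, ?_⟩
    rw [e, Fin.prod_univ_succ (n := K+1)]
    simp only [Fin.cons_zero, Fin.cons_succ]
    simp [mul_pow, Finset.prod_pow]
    ring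
end split

section zc
variable {σ : Type} [Fintype σ] [DecidableEq σ]

lemma zClosure_mono {S T : Set (σ → ℂ)} (h : S ⊆ T) : zClosure S ⊆ zClosure T :=
  fun _ hx p hp => hx p fun y hy => hp y (h hy)
lemma subset_zClosure (S : Set (σ → ℂ)) : S ⊆ zClosure S := fun x hx _ hp => hp x hx
lemma zClosure_min {S T : Set (σ → ℂ)} (h : S ⊆ zClosure T) : zClosure S ⊆ zClosure T :=
  fun _ hx p hp => hx p fun _ hy => h hy p hp
lemma zClosure_union (S T : Set (σ → ℂ)) : zClosure (S ∪ T) = zClosure S ∪ zClosure T := by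
  apply Set.Subset.antisymm
  · intro x hx
    by_contra hcon
    simp only [Set.mem_union, not_or] at hcon
    obtain ⟨h1, h2⟩ := hcon
    simp only [zClosure, Set.mem_ofPred_eq, not_forall] at h1 h2
    obtain ⟨p, hp, hpx⟩ := h1
    obtain ⟨q, hq, hqx⟩ := h2
    have := hx (p * q) (by
      rintro y (hy | hy)
      · rw [map_mul, hp y hy, zero_mul]
      · rw [map_mul, hq y hy, mul_zero])
    rw [map_mul] at this
    exact (mul_ne_zero hpx hqx) this
  · exact Set.union_subset (zClosure_mono Set.subset_union_left) (zClosure_mono Set.subset_union_right)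
end zc

section realpts

lemma poly_zero_of_nhds (P : Polynomial ℂ) (h : ∀ᶠ t : ℝ in nhds 0, P.eval (t:ℂ) = 0) : P = 0 := by
  obtain ⟨ε, hε, hb⟩ := Metric.eventually_nhds_iff.1 h
  apply Polynomial.eq_zero_of_infinite_isRoot
  have hinf : (Set.Ioo (0:ℝ) ε).Infinite := Set.Ioo_infinite hε
  refine (hinf.image (Complex.ofReal_injective.injOn)).mono ?_
  rintro _ ⟨t, ⟨h1, h2⟩, rfl⟩
  exact hb (by simpa [abs_of_pos h1] using h2)

lemma LP.realpts {V : Type} [AddCommGroup V] [Module ℂ V] {W : Type} [NormedAddCommGroup W] [NormedSpace ℝ W]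
    (ι : W → V) (hadd : ∀ a b, ι (a + b) = ι a + ι b) (hsm : ∀ (t : ℝ) a, ι (t • a) = (t : ℂ) • ι a)
    (hdec : ∀ x : V, ∃ a b, x = ι a + Complex.I • ι b)
    {f : V → ℂ} (hf : LP f) (w0 : W) (h : ∀ᶠ w in nhds w0, f (ι w) = 0) (x : V) : f x = 0 := by
  have h1 : ∀ w, f (ι w) = 0 := by
    intro w
    obtain ⟨P, hP⟩ := hf (ι w0) (ι (w - w0))
    have hP0 : P = 0 := by
      apply poly_zero_of_nhds
      have hc : Filter.Tendsto (fun t : ℝ => w0 + t • (w - w0)) (nhds 0) (nhds w0) := by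
        have : Continuous (fun t : ℝ => w0 + t • (w - w0)) := by fun_prop
        simpa using this.tendsto 0
      filter_upwards [hc.eventually h] with t ht
      rw [← hP, ← hsm, ← hadd]
      exact ht
    have := hP 1
    rw [one_smul, ← hadd] at this
    simpa [hP0] using this
  obtain ⟨a, b, rfl⟩ := hdec x
  obtain ⟨P, hP⟩ := hf (ι a) (ι b)
  have hP0 : P = 0 := by
    apply poly_zero_of_nhds
    refine Filter.Eventually.of_forall fun t => ?_
    rw [← hP, ← hsm, ← hadd, h1]
  rw [hP, hP0, Polynomial.eval_zero]
end realpts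
end EM

namespace EM

/-- real rooted forms of degree `n`, with normalised factors -/
def RR (n : ℕ) (p : Polynomial ℝ) : Prop :=
  ∃ (c : ℝ) (u v : Fin n → ℝ), c ≠ 0 ∧ (∀ i, u i ^ 2 + v i ^ 2 = 1) ∧ p = Polynomial.C c * ∏ i, lin (u i) (v i)

/-- forms with distinct real roots -/
def DR : ℕ → Polynomial ℝ → Prop
  | 0, p => ∃ c : ℝ, c ≠ 0 ∧ p = Polynomial.C c
  | n+1, p => ∃ (p' : Polynomial ℝ) (u v : ℝ), DR n p' ∧ ¬ (u = 0 ∧ v = 0) ∧ p = p' * lin u v ∧ hev n p' v (-u) ≠ 0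

lemma DR.natDegree {n : ℕ} {p : Polynomial ℝ} (h : DR n p) : p.natDegree ≤ n := by
  induction n generalizing p with
  | zero => obtain ⟨c, _, rfl⟩ := h; simp
  | succ n ih =>
    obtain ⟨p', u, v, h1, _, rfl, _⟩ := h
    exact natDegree_mul_le' (ih h1) (natDegree_lin _ _)

lemma DR.ne_zero {n : ℕ} {p : Polynomial ℝ} (h : DR n p) : p ≠ 0 := by
  induction n generalizing p with
  | zero => obtain ⟨c, hc, rfl⟩ := h; simpa using hc
  | succ n ih =>
    obtain ⟨p', u, v, h1, h2, rfl, _⟩ := h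
    exact mul_ne_zero (ih h1) (lin_ne_zero h2)

lemma DR.smul {n : ℕ} {p : Polynomial ℝ} (h : DR n p) {c : ℝ} (hc : c ≠ 0) : DR n (Polynomial.C c * p) := by
  induction n generalizing p with
  | zero => obtain ⟨c', hc', rfl⟩ := h; exact ⟨c * c', mul_ne_zero hc hc', by simp⟩
  | succ n ih =>
    obtain ⟨p', u, v, h1, h2, rfl, h3⟩ := h
    exact ⟨Polynomial.C c * p', u, v, ih h1, h2, by ring, by rw [hev_C_mul]; exact mul_ne_zero hc h3⟩

lemma hev_mul_lin {K : Type} [CommRing K] {n : ℕ} {p : Polynomial K} (hp : p.natDegree ≤ n) (u v x y : K) :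
    hev (n+1) (p * lin u v) x y = hev n p x y * (u * x + v * y) := by
  rw [hev_mul n 1 p _ hp (natDegree_lin _ _), hev_lin]

lemma hev_zeroP (c x y : ℝ) : hev 0 (Polynomial.C c) x y = c := by simp [hev]

/-- removing a root of a form with distinct roots -/
lemma DR.remove {n : ℕ} {p : Polynomial ℝ} (h : DR (n+1) p) {u v : ℝ} (huv : ¬ (u = 0 ∧ v = 0))
    (h0 : hev (n+1) p v (-u) = 0) : ∃ p', p = p' * lin u v ∧ DR n p' ∧ hev n p' v (-u) ≠ 0 := by
  induction n generalizing p with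
  | zero =>
    obtain ⟨p', u', v', h1, h2, rfl, h3⟩ := h
    rw [hev_mul_lin h1.natDegree] at h0
    have h0' : hev 1 (lin u v) v' (-u') = 0 := by
      rw [hev_lin]
      have h4 : hev 0 p' v (-u) ≠ 0 := by
        obtain ⟨c, hc, rfl⟩ := h1
        rwa [hev_zeroP]
      have := (mul_eq_zero.1 h0).resolve_left h4
      linarith
    obtain ⟨c, hc⟩ := lin_prop huv (show hev 1 (lin u' v') v (-u) = 0 by rw [hev_lin] at h0' ⊢; linarith)
    have hc0 : c ≠ 0 := by
      rintro rfl
      exact lin_ne_zero h2 (by simpa using hc)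
    refine ⟨Polynomial.C c * p', by rw [hc]; ring, h1.smul hc0, ?_⟩
    obtain ⟨c', hc', rfl⟩ := h1
    rw [← Polynomial.C_mul, hev_zeroP]
    exact mul_ne_zero hc0 hc'
  | succ n ih =>
    obtain ⟨p', u', v', h1, h2, rfl, h3⟩ := h
    rw [hev_mul_lin h1.natDegree] at h0
    by_cases hp : u' * v + v' * (-u) = 0
    · obtain ⟨c, hc⟩ := lin_prop huv (show hev 1 (lin u' v') v (-u) = 0 by rw [hev_lin]; exact hp)
      have hc0 : c ≠ 0 := by
        rintro rfl
        exact lin_ne_zero h2 (by simpa using hc)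
      have hu : u' = c * u := by have := congrArg (fun p => Polynomial.coeff p 0) hc; simpa using this
      have hv : v' = c * v := by have := congrArg (fun p => Polynomial.coeff p 1) hc; simpa using this
      refine ⟨Polynomial.C c * p', by rw [hc]; ring, h1.smul hc0, ?_⟩
      rw [hev_C_mul]
      refine mul_ne_zero hc0 ?_
      intro h4
      apply h3
      obtain ⟨r, hr, e⟩ := exists_factor n p' h1.natDegree u v huv h4
      rw [e, hev_mul_lin hr, hu, hv]
      ring
    · have h4 := (mul_eq_zero.1 h0).resolve_right hp
      obtain ⟨r, rfl, hr1, hr2⟩ := ih h1 h4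
      refine ⟨r * lin u' v', by ring, ⟨r, u', v', hr1, h2, rfl, ?_⟩, ?_⟩
      · rw [hev_mul_lin hr1.natDegree] at h3
        exact left_ne_zero_of_mul h3
      · rw [hev_mul_lin hr1.natDegree]
        exact mul_ne_zero hr2 hp

/-- real-rootedness, inductive forms -/
lemma RR.natDegree {n : ℕ} {p : Polynomial ℝ} (h : RR n p) : p.natDegree ≤ n := by
  obtain ⟨c, u, v, _, _, rfl⟩ := h
  exact (Polynomial.natDegree_C_mul_le _ _).trans (natDegree_prod_lin n u v)

lemma unit_ne {u v : ℝ} (h : u ^ 2 + v ^ 2 = 1) : ¬ (u = 0 ∧ v = 0) := by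
  rintro ⟨rfl, rfl⟩; norm_num at h

lemma RR.ne_zero {n : ℕ} {p : Polynomial ℝ} (h : RR n p) : p ≠ 0 := by
  obtain ⟨c, u, v, hc, h1, rfl⟩ := h
  refine mul_ne_zero (by simpa using hc) (Finset.prod_ne_zero_iff.2 fun i _ => lin_ne_zero (unit_ne (h1 i)))

lemma RR.zero_iff {p : Polynomial ℝ} : RR 0 p ↔ ∃ c : ℝ, c ≠ 0 ∧ p = Polynomial.C c := by
  constructor
  · rintro ⟨c, u, v, hc, _, e⟩; exact ⟨c, hc, by simpa using e⟩
  · rintro ⟨c, hc, rfl⟩; exact ⟨c, Fin.elim0, Fin.elim0, hc, fun i => i.elim0, by simp⟩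

lemma RR.cons {n : ℕ} {p : Polynomial ℝ} (h : RR n p) {u v : ℝ} (huv : ¬ (u = 0 ∧ v = 0)) : RR (n+1) (p * lin u v) := by
  obtain ⟨c, u', v', hc, h1, rfl⟩ := h
  have hpos : 0 < u^2 + v^2 := by
    by_contra hcon
    apply huv
    constructor <;> nlinarith [sq_nonneg u, sq_nonneg v]
  set s := Real.sqrt (u^2+v^2) with hs
  have hs0 : 0 < s := Real.sqrt_pos.2 hpos
  have hss : s ^ 2 = u^2+v^2 := Real.sq_sqrt hpos.le
  refine ⟨c * s, Fin.cons (u/s) u', Fin.cons (v/s) v', mul_ne_zero hc hs0.ne', ?_, ?_⟩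
  · intro i
    refine Fin.cases ?_ (fun i => ?_) i
    · simp only [Fin.cons_zero]
      rw [div_pow, div_pow, ← add_div, hss, div_self hpos.ne']
    · simpa using h1 i
  · rw [Fin.prod_univ_succ]
    simp only [Fin.cons_zero, Fin.cons_succ]
    have : lin u v = Polynomial.C s * lin (u/s) (v/s) := by
      unfold lin
      rw [mul_add, ← mul_assoc, ← Polynomial.C_mul, ← Polynomial.C_mul, mul_div_cancel₀ _ hs0.ne', mul_div_cancel₀ _ hs0.ne']
    rw [this, Polynomial.C_mul]
    ring

lemma RR.uncons {n : ℕ} {p : Polynomial ℝ} (h : RR (n+1) p) : ∃ p' u v, RR n p' ∧ ¬ (u = 0 ∧ v = 0) ∧ p = p' * lin u v := by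
  obtain ⟨c, u, v, hc, h1, rfl⟩ := h
  refine ⟨Polynomial.C c * ∏ i : Fin n, lin (u i.succ) (v i.succ), u 0, v 0, ⟨c, _, _, hc, fun i => h1 i.succ, rfl⟩, unit_ne (h1 0), ?_⟩
  rw [Fin.prod_univ_succ]
  ring

lemma RR.smul {n : ℕ} {p : Polynomial ℝ} (h : RR n p) {c : ℝ} (hc : c ≠ 0) : RR n (Polynomial.C c * p) := by
  obtain ⟨c', u, v, hc', h1, rfl⟩ := h
  exact ⟨c * c', u, v, mul_ne_zero hc hc', h1, by rw [Polynomial.C_mul]; ring⟩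

lemma DR.rr {n : ℕ} {p : Polynomial ℝ} (h : DR n p) : RR n p := by
  induction n generalizing p with
  | zero => exact RR.zero_iff.2 h
  | succ n ih =>
    obtain ⟨p', u, v, h1, h2, rfl, _⟩ := h
    exact (ih h1).cons h2

lemma RR.remove {n : ℕ} {g : Polynomial ℝ} (h : RR n g) {u v : ℝ} (huv : ¬ (u = 0 ∧ v = 0))
    (h0 : hev n g v (-u) = 0) : ∃ n' p', n = n' + 1 ∧ RR n' p' ∧ g = p' * lin u v := by
  induction n generalizing g with
  | zero =>
    obtain ⟨c, hc, rfl⟩ := RR.zero_iff.1 h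
    rw [hev_zeroP] at h0
    exact absurd h0 hc
  | succ n ih =>
    obtain ⟨g', u', v', h1, h2, rfl⟩ := h.uncons
    rw [hev_mul_lin h1.natDegree] at h0
    by_cases hp : u' * v + v' * (-u) = 0
    · obtain ⟨c, hc⟩ := lin_prop huv (show hev 1 (lin u' v') v (-u) = 0 by rw [hev_lin]; exact hp)
      have hc0 : c ≠ 0 := by
        rintro rfl
        exact lin_ne_zero h2 (by simpa using hc)
      exact ⟨n, Polynomial.C c * g', rfl, h1.smul hc0, by rw [hc]; ring⟩
    · obtain ⟨n', p', rfl, h3, rfl⟩ := ih h1 ((mul_eq_zero.1 h0).resolve_right hp)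
      exact ⟨n'+1, p' * lin u' v', rfl, h3.cons h2, by ring⟩

lemma RR.cancel {n : ℕ} {p : Polynomial ℝ} {u v : ℝ} (huv : ¬ (u = 0 ∧ v = 0)) (hp : p.natDegree ≤ n)
    (h : RR (n+1) (p * lin u v)) : RR n p := by
  obtain ⟨n', p', hn, h1, h2⟩ := h.remove huv (by rw [hev_mul_lin hp]; ring)
  obtain rfl : n = n' := by omega
  rwa [mul_right_cancel₀ (lin_ne_zero huv) h2]

/-- trichotomy -/
lemma RR.tri {n : ℕ} {p : Polynomial ℝ} (h : RR n p) : DR n p ∨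
    (∃ (n' : ℕ) (p' : Polynomial ℝ) (u v : ℝ), n = n' + 2 ∧ ¬ (u = 0 ∧ v = 0) ∧ DR n' p' ∧ hev n' p' v (-u) ≠ 0 ∧ p = lin u v ^ 2 * p') ∨
    (∃ (n' : ℕ) (p' : Polynomial ℝ) (u v : ℝ), n = n' + 3 ∧ ¬ (u = 0 ∧ v = 0) ∧ RR n' p' ∧ p = lin u v ^ 3 * p') ∨
    (∃ (n' : ℕ) (p' : Polynomial ℝ) (u v u' v' : ℝ), n = n' + 4 ∧ ¬ (u = 0 ∧ v = 0) ∧ ¬ (u' = 0 ∧ v' = 0) ∧ RR n' p' ∧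
      p = (lin u v * lin u' v') ^ 2 * p') := by
  induction n generalizing p with
  | zero => exact Or.inl (RR.zero_iff.1 h)
  | succ n ih =>
    obtain ⟨g, u, v, h1, h2, rfl⟩ := h.uncons
    rcases ih h1 with h3 | ⟨n', p', u', v', rfl, h3, h4, h5, rfl⟩ | ⟨n', p', u', v', rfl, h3, h4, rfl⟩ | 
      ⟨n', p', u', v', u'', v'', rfl, h3, h4, h5, rfl⟩
    · by_cases h0 : hev n g v (-u) = 0
      · cases n with
        | zero =>
          obtain ⟨c, hc, rfl⟩ := h3
          rw [hev_zeroP] at h0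
          exact absurd h0 hc
        | succ n =>
          obtain ⟨g', rfl, h5, h6⟩ := h3.remove h2 h0
          right; left
          exact ⟨n, g', u, v, rfl, h2, h5, h6, by ring⟩
      · left; exact ⟨g, u, v, h3, h2, rfl, h0⟩
    · by_cases hp : u * v' + v * (-u') = 0
      · obtain ⟨c, hc⟩ := lin_prop h3 (show hev 1 (lin u v) v' (-u') = 0 by rw [hev_lin]; exact hp)
        have hc0 : c ≠ 0 := by
          rintro rfl
          exact lin_ne_zero h2 (by simpa using hc)
        right; right; left
        exact ⟨n', Polynomial.C c * p', u', v', rfl, h3, h4.rr.smul hc0, by rw [hc]; ring⟩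
      · by_cases h0 : hev n' p' v (-u) = 0
        · right; right; right
          obtain ⟨n'', p'', rfl, h6, rfl⟩ := h4.rr.remove h2 h0
          exact ⟨n'', p'', u, v, u', v', rfl, h2, h3, h6, by ring⟩
        · right; left
          refine ⟨n'+1, p' * lin u v, u', v', rfl, h3, ⟨p', u, v, h4, h2, rfl, h0⟩, ?_, by ring⟩
          rw [hev_mul_lin h4.natDegree]
          exact mul_ne_zero h5 hp
    · right; right; left
      exact ⟨n'+1, p' * lin u v, u', v', rfl, h3, h4.cons h2, by ring⟩
    · right; right; right
      exact ⟨n'+1, p' * lin u v, u', v', u'', v'', rfl, h3, h4, h5.cons h2, by ring⟩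

/-- weak dichotomy -/
lemma RR.di {n : ℕ} {p : Polynomial ℝ} (h : RR n p) : DR n p ∨
    (∃ (n' : ℕ) (p' : Polynomial ℝ) (u v : ℝ), n = n' + 2 ∧ ¬ (u = 0 ∧ v = 0) ∧ RR n' p' ∧ p = lin u v ^ 2 * p') := by
  rcases h.tri with h3 | ⟨n', p', u', v', rfl, h3, h4, h5, rfl⟩ | ⟨n', p', u', v', rfl, h3, h4, rfl⟩ | 
      ⟨n', p', u', v', u'', v'', rfl, h3, h4, h5, rfl⟩
  · exact Or.inl h3
  · exact Or.inr ⟨n', p', u', v', rfl, h3, h4.rr, rfl⟩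
  · exact Or.inr ⟨n'+1, p' * lin u' v', u', v', rfl, h3, h4.cons h3, by ring⟩
  · exact Or.inr ⟨n'+2, p' * lin u'' v'' * lin u'' v'', u', v', rfl, h3, (h5.cons h4).cons h4, by ring⟩

/-- homogeneous evaluation, linear map -/
def hevL (d : ℕ) (x y : ℝ) : Polynomial ℝ →ₗ[ℝ] ℝ where
  toFun p := hev d p x y
  map_add' p q := hev_add d p q x y
  map_smul' c p := by rw [Polynomial.smul_eq_C_mul, hev_C_mul]; rfl

def LfL {K : Type} [Field K] (d : ℕ) (a : Fin (d+1) → K) : Polynomial K →ₗ[K] K where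
  toFun p := Lf d a p
  map_add' p q := Lf_add a p q
  map_smul' c p := by rw [Polynomial.smul_eq_C_mul, Lf_C_mul]; rfl

lemma DR.functional {n d m : ℕ} {p : Polynomial ℝ} (h : DR n p) (hd : n + m = d) (L : Polynomial ℝ →ₗ[ℝ] ℝ)
    (hL : ∀ r : Polynomial ℝ, r.natDegree ≤ m → L (p * r) = 0) :
    ∃ β u v : Fin n → ℝ, ∀ P : Polynomial ℝ, P.natDegree ≤ d → L P = ∑ i, β i * hev d P (u i) (v i) := by
  induction n generalizing p m L with
  | zero =>
    obtain ⟨c, hc, rfl⟩ := h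
    refine ⟨Fin.elim0, Fin.elim0, Fin.elim0, fun P hP => ?_⟩
    have h1 := hL (Polynomial.C c⁻¹ * P) ((Polynomial.natDegree_C_mul_le _ _).trans (by omega))
    rw [← mul_assoc, ← Polynomial.C_mul, mul_inv_cancel₀ hc] at h1
    simpa using h1
  | succ n ih =>
    obtain ⟨p', u, v, h1, h2, rfl, h3⟩ := h
    obtain ⟨r1, hr1, hr1'⟩ := exists_nonvanish' (m+1) u v h2
    have key : ∀ r : Polynomial ℝ, r.natDegree ≤ m + 1 → L (p' * r) = hev (m+1) r v (-u) * L (p' * r1) := by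
      intro r hr
      have hd' : (r - Polynomial.C (hev (m+1) r v (-u)) * r1).natDegree ≤ m + 1 := by
        refine (Polynomial.natDegree_sub_le _ _).trans (max_le hr ((Polynomial.natDegree_C_mul_le _ _).trans hr1))
      obtain ⟨r', hr', e⟩ := exists_factor m _ hd' u v h2 (by
        rw [sub_eq_add_neg, ← neg_mul, ← Polynomial.C_neg, hev_add, hev_C_mul, hr1']; ring)
      have h4 := hL r' hr'
      rw [mul_assoc, mul_comm (lin u v), ← e, mul_sub, map_sub, sub_eq_zero] at h4
      rw [h4, ← mul_assoc, mul_comm p', mul_assoc, ← Polynomial.smul_eq_C_mul, map_smul, smul_eq_mul]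
    obtain ⟨β, u', v', hβ⟩ := ih h1 (m := m+1) (by omega) (L - (L (p' * r1) / hev n p' v (-u)) • hevL d v (-u)) (by
      intro r hr
      have h5 : hev d (p' * r) v (-u) = hev n p' v (-u) * hev (m+1) r v (-u) := by
        rw [← hd, show n + 1 + m = n + (m+1) by ring, hev_mul n (m+1) _ _ h1.natDegree hr]
      simp only [LinearMap.sub_apply, LinearMap.smul_apply, smul_eq_mul]
      change _ - _ * hev d (p' * r) v (-u) = 0
      rw [key r hr, h5]
      field_simp
      ring)
    refine ⟨Fin.cons (L (p' * r1) / hev n p' v (-u)) β, Fin.cons v u', Fin.cons (-u) v', fun P hP => ?_⟩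
    rw [Fin.sum_univ_succ]
    simp only [Fin.cons_zero, Fin.cons_succ]
    rw [← hβ P hP]
    simp only [LinearMap.sub_apply, LinearMap.smul_apply, smul_eq_mul]
    change _ = _ * hev d P v (-u) + (_ - _ * hev d P v (-u))
    ring

lemma DR.rankLE {k : ℕ} (hk : 1 ≤ k) {g : Polynomial ℝ} (h : DR (k+1) g) {a : Fin (2*k+1) → ℝ} (ha : apo k a g) :
    rankLE (2*k) (k+1) a := by
  obtain ⟨β, u, v, hβ⟩ := h.functional (m := k-1) (d := 2*k) (by omega) (LfL (2*k) a) (fun r hr => apo_mul ha r (by omega))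
  exact rankLE_of_Lf a β u v hβ

lemma rankLE.rr {d r m : ℕ} (hd : r + m = d) (hd1 : 1 ≤ d) {a : Fin (d+1) → ℝ} (h : rankLE d r a) :
    ∃ g, RR r g ∧ ∀ q : Polynomial ℝ, q.natDegree ≤ m → Lf d a (g * q) = 0 := by
  obtain ⟨β, x, y, hL⟩ := Lf_of_rankLE a h
  have key : ∀ r (x y : Fin r → ℝ), ∃ g, RR r g ∧ ∀ i, (x i = 0 ∧ y i = 0) ∨ hev r g (x i) (y i) = 0 := by
    intro r
    induction r with
    | zero => exact fun _ _ => ⟨1, RR.zero_iff.2 ⟨1, one_ne_zero, by simp⟩, fun i => i.elim0⟩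
    | succ r ih =>
      intro x y
      obtain ⟨g, hg, hg'⟩ := ih (fun i => x i.succ) (fun i => y i.succ)
      by_cases h0 : x 0 = 0 ∧ y 0 = 0
      · refine ⟨g * lin 1 0, hg.cons (by simp), fun i => ?_⟩
        refine Fin.cases (Or.inl h0) (fun i => ?_) i
        rcases hg' i with h1 | h1
        · exact Or.inl h1
        · right; rw [hev_mul_lin hg.natDegree, h1, zero_mul]
      · refine ⟨g * lin (- y 0) (x 0), hg.cons (by simpa [and_comm] using h0), fun i => ?_⟩
        refine Fin.cases ?_ (fun i => ?_) i
        · right; rw [hev_mul_lin hg.natDegree]; ring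
        rcases hg' i with h1 | h1
        · exact Or.inl h1
        · right; rw [hev_mul_lin hg.natDegree, h1, zero_mul]
  obtain ⟨g, hg, hg'⟩ := key r x y
  refine ⟨g, hg, fun q hq => ?_⟩
  rw [hL]
  apply Finset.sum_eq_zero
  intro i _
  subst hd
  rw [hev_mul r m _ _ hg.natDegree hq]
  rcases hg' i with h1 | h1
  · have : hev (r+m) (g * q) (x i) (y i) = 0 := by
      rw [h1.1, h1.2, hev_zero_left, zero_pow (by omega), mul_zero]
    rw [hev_mul r m _ _ hg.natDegree hq] at this
    rw [this, mul_zero]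
  · rw [h1]; ring
end EM

namespace EM

/-- Hankel (catalecticant) matrix -/
def HN (d l n : ℕ) (a : Fin (d+1) → ℝ) : Matrix (Fin l) (Fin n) ℝ :=
  fun j i => Lf d a (Polynomial.X ^ ((i:ℕ) + (j:ℕ)))

lemma HN_mulVec {d l n : ℕ} (a : Fin (d+1) → ℝ) (z : Fin n → ℝ) (j : Fin l) :
    (HN d l n a).mulVec z j = Lf d a (toP z * Polynomial.X ^ (j:ℕ)) := by
  unfold toP
  rw [Finset.sum_mul, Lf_sum]
  unfold HN Matrix.mulVec dotProduct
  refine Finset.sum_congr rfl fun i _ => ?_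
  rw [mul_assoc, Lf_C_mul, ← pow_add, mul_comm]

lemma HN_vecMul {d l n : ℕ} (a : Fin (d+1) → ℝ) (z : Fin l → ℝ) (j : Fin n) :
    Matrix.vecMul z (HN d l n a) j = Lf d a (toP z * Polynomial.X ^ (j:ℕ)) := by
  unfold toP
  rw [Finset.sum_mul, Lf_sum]
  unfold HN Matrix.vecMul dotProduct
  refine Finset.sum_congr rfl fun i _ => ?_
  rw [mul_assoc, Lf_C_mul, ← pow_add, add_comm]

abbrev NN (k : ℕ) (a : Fin (2*k+1) → ℝ) := HN (2*k) k (k+2) a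

lemma apo_iff_NN {k : ℕ} (a : Fin (2*k+1) → ℝ) (z : Fin (k+2) → ℝ) :
    apo k a (toP z) ↔ (NN k a).mulVec z = 0 := by
  constructor
  · intro h; funext j; rw [HN_mulVec]; exact h j j.2
  · intro h j hj
    rw [← HN_mulVec (n := k+2) a z ⟨j, hj⟩]; exact congrFun h _

/-- right invertibility of the catalecticant -/
def NRI (k : ℕ) (a : Fin (2*k+1) → ℝ) : Prop := ∃ S : Matrix (Fin (k+2)) (Fin k) ℝ, NN k a * S = 1

/-- `q` kills `a` in degree `l` -/
lemma Lf_mul_eq_zero {d l : ℕ} {K : Type} [Field K] {a : Fin (d+1) → K} {q : Polynomial K}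
    (h : ∀ j ≤ l, Lf d a (q * Polynomial.X ^ j) = 0) (r : Polynomial K) (hr : r.natDegree ≤ l) : Lf d a (q * r) = 0 := by
  rw [Polynomial.as_sum_range' r (l+1) (by omega), Finset.mul_sum, Lf_sum]
  apply Finset.sum_eq_zero
  intro i hi
  rw [← Polynomial.C_mul_X_pow_eq_monomial, mul_left_comm, Lf_C_mul, h i (by simpa [Nat.lt_succ_iff] using hi), mul_zero]

lemma NRI_of {k : ℕ} (hk : 1 ≤ k) {a : Fin (2*k+1) → ℝ}
    (h : ∀ q : Polynomial ℝ, q.natDegree ≤ k - 1 → (∀ j ≤ k+1, Lf (2*k) a (q * Polynomial.X ^ j) = 0) → q = 0) : NRI k a := by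
  apply exists_rightInv
  intro c hc
  apply toP_injective
  rw [toP_zero]
  apply h
  · have := natDegree_toP_lt (show 0 < k by omega) c
    omega
  · intro j hj
    rw [← HN_vecMul (n := k+2) a c ⟨j, by omega⟩]
    exact congrFun hc _

lemma continuous_Lf {d : ℕ} (p : Polynomial ℝ) : Continuous fun a : Fin (d+1) → ℝ => Lf d a p := by
  unfold Lf; fun_prop

lemma continuous_HN {d l n : ℕ} : Continuous fun a : Fin (d+1) → ℝ => HN d l n a :=
  continuous_matrix fun _ _ => continuous_Lf _

lemma NRI_of_det {k : ℕ} {a : Fin (2*k+1) → ℝ} (S : Matrix (Fin (k+2)) (Fin k) ℝ) (h : (NN k a * S).det ≠ 0) : NRI k a :=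
  ⟨S * (NN k a * S)⁻¹, by rw [← Matrix.mul_assoc]; exact Matrix.mul_nonsing_inv _ (isUnit_iff_ne_zero.2 h)⟩

lemma isOpen_NRI (k : ℕ) : IsOpen {a | NRI k a} := by
  rw [isOpen_iff_eventually]
  rintro a ⟨S, hS⟩
  have hc : Continuous fun a => (NN k a * S).det := (continuous_HN.matrix_mul continuous_const).matrix_det
  have : ∀ᶠ b in nhds a, (NN k b * S).det ≠ 0 := by
    apply hc.continuousAt.eventually_ne
    rw [hS]; simp
  filter_upwards [this] with b hb
  exact NRI_of_det S hb

lemma continuous_kerProj {X : Type} [TopologicalSpace X] {k n : ℕ} {N : X → Matrix (Fin k) (Fin n) ℝ} {S : X → Matrix (Fin n) (Fin k) ℝ}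
    {z : X → Fin n → ℝ} (hN : Continuous N) (hS : Continuous S) (hz : Continuous z) :
    Continuous fun x => kerProj (N x) (S x) (z x) := by
  unfold kerProj
  exact ((hN.matrix_mul hS).matrix_det.smul hz).sub
    (hS.matrix_mulVec ((hN.matrix_mul hS).matrix_adjugate.matrix_mulVec (hN.matrix_mulVec hz)))

/-- two-dimensional kernel -/
lemma NRI.pencil {k : ℕ} {a : Fin (2*k+1) → ℝ} (h : NRI k a) {g1 g2 g : Polynomial ℝ}
    (hd1 : g1.natDegree ≤ k+1) (hd2 : g2.natDegree ≤ k+1) (hd : g.natDegree ≤ k+1)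
    (h1 : apo k a g1) (h2 : apo k a g2) (hg : apo k a g)
    (hli : ∀ c1 c2 : ℝ, Polynomial.C c1 * g1 + Polynomial.C c2 * g2 = 0 → c1 = 0 ∧ c2 = 0) :
    ∃ c1 c2 : ℝ, g = Polynomial.C c1 * g1 + Polynomial.C c2 * g2 := by
  set z1 := ofP (k+2) g1 with hz1
  set z2 := ofP (k+2) g2 with hz2
  set z := ofP (k+2) g with hz
  have e1 : toP z1 = g1 := toP_ofP _ hd1
  have e2 : toP z2 = g2 := toP_ofP _ hd2
  have e : toP z = g := toP_ofP _ hd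
  have m1 : z1 ∈ LinearMap.ker (NN k a).mulVecLin := by
    rw [← e1, apo_iff_NN] at h1; simpa using h1
  have m2 : z2 ∈ LinearMap.ker (NN k a).mulVecLin := by
    rw [← e2, apo_iff_NN] at h2; simpa using h2
  have m : z ∈ LinearMap.ker (NN k a).mulVecLin := by
    rw [← e, apo_iff_NN] at hg; simpa using hg
  obtain ⟨S, hS⟩ := h
  have hsurj : Function.Surjective (NN k a).mulVecLin := by
    intro y
    exact ⟨S.mulVec y, by simp [hS]⟩
  have hfr : Module.finrank ℝ (LinearMap.ker (NN k a).mulVecLin) = 2 := by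
    have := LinearMap.finrank_range_add_finrank_ker (NN k a).mulVecLin
    rw [LinearMap.range_eq_top.2 hsurj] at this
    simp at this
    omega
  have hind : LinearIndependent ℝ ![z1, z2] := by
    rw [LinearIndependent.pair_iff]
    intro s t hst
    apply hli
    rw [← e1, ← e2, ← toP_smul, ← toP_smul, ← toP_add, hst, toP_zero]
  have hle : Submodule.span ℝ {z1, z2} ≤ LinearMap.ker (NN k a).mulVecLin := by
    rw [Submodule.span_le]
    rintro x (rfl | rfl)
    · exact m1
    · exact m2
  have hsp : Module.finrank ℝ (Submodule.span ℝ {z1, z2}) = 2 := by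
    have := finrank_span_eq_card hind
    rw [Matrix.range_cons_cons_empty] at this
    simpa using this
  have heq := Submodule.eq_of_le_of_finrank_le hle (by rw [hfr, hsp])
  rw [← heq, Submodule.mem_span_pair] at m
  obtain ⟨c1, c2, hc⟩ := m
  refine ⟨c1, c2, ?_⟩
  rw [← e1, ← e2, ← toP_smul, ← toP_smul, ← toP_add, hc, e]

section density

lemma rankLE_det {k : ℕ} (hk : 1 ≤ k) {a : Fin (2*k+1) → ℝ} (h : rankLE (2*k) k a) :
    (HN (2*k) (k+1) (k+1) a).det = 0 := by
  obtain ⟨g, hg, hg'⟩ := h.rr (m := k) (by omega) (by omega)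
  rw [← Matrix.exists_mulVec_eq_zero_iff]
  have e : toP (ofP (k+1) g) = g := toP_ofP _ hg.natDegree
  refine ⟨ofP (k+1) g, ?_, ?_⟩
  · intro h0
    apply hg.ne_zero
    rw [← e, h0, toP_zero]
  · funext j
    rw [HN_mulVec, e]
    exact hg' _ (by simp; omega)

lemma HN_add {d l n : ℕ} (a b : Fin (d+1) → ℝ) (t : ℝ) : HN d l n (a + t • b) = t • HN d l n b + HN d l n a := by
  ext i j
  simp only [HN, Lf, Matrix.add_apply, Matrix.smul_apply, smul_eq_mul, Pi.add_apply, Pi.smul_apply, Finset.mul_sum, ← Finset.sum_add_distrib]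
  refine Finset.sum_congr rfl fun i _ => by ring

lemma exists_det (k : ℕ) : ∃ b : Fin (2*k+1) → ℝ, (HN (2*k) (k+1) (k+1) b).det ≠ 0 := by
  let b : Fin (2*k+1) → ℝ := fun i => if (i:ℕ) = k then 1 else 0
  refine ⟨b, ?_⟩
  intro h0
  rw [← Matrix.exists_mulVec_eq_zero_iff] at h0
  obtain ⟨z, hz, hz0⟩ := h0
  apply hz
  funext i
  have h1 := congrFun hz0 ⟨k - i, by omega⟩
  rw [Matrix.mulVec, dotProduct, Finset.sum_eq_single i] at h1
  · have h2 : HN (2*k) (k+1) (k+1) b ⟨k - i, by omega⟩ i = wt ℝ (2*k) k := by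
      unfold HN
      have := Lf_X_pow b ⟨(i:ℕ) + (k - i), by omega⟩
      simp only at this
      rw [this]
      have hik : (i:ℕ) + (k - i) = k := by omega
      simp [b, hik]
    rw [h2] at h1
    exact (mul_eq_zero.1 h1).resolve_left (wt_ne_zero _ _)
  · intro j _ hj
    unfold HN
    have := Lf_X_pow b ⟨(j:ℕ) + (k - i), by omega⟩
    simp only at this
    rw [this]
    have hik : (j:ℕ) + (k - i) ≠ k := by
      intro h; apply hj; apply Fin.ext; omega
    simp [b, hik]
  · simp

lemma dense_det (k : ℕ) : Dense {a : Fin (2*k+1) → ℝ | (HN (2*k) (k+1) (k+1) a).det ≠ 0} := by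
  obtain ⟨b, hb⟩ := exists_det k
  intro a
  rw [mem_closure_iff_frequently]
  intro hcon
  let P : Polynomial ℝ := ((Polynomial.X : Polynomial ℝ) • (HN (2*k) (k+1) (k+1) b).map Polynomial.C + (HN (2*k) (k+1) (k+1) a).map Polynomial.C).det
  have hPe : ∀ t, P.eval t = (HN (2*k) (k+1) (k+1) (a + t • b)).det := by
    intro t
    rw [HN_add]
    change Polynomial.evalRingHom t P = _
    rw [RingHom.map_det]
    congr 1
    ext i j
    simp
    try ring
  have hP : P ≠ 0 := by
    intro h0
    have := Polynomial.coeff_det_X_add_C_card (HN (2*k) (k+1) (k+1) b) (HN (2*k) (k+1) (k+1) a)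
    change P.coeff _ = _ at this
    rw [h0, Polynomial.coeff_zero] at this
    exact hb this.symm
  have hc : Filter.Tendsto (fun t : ℝ => a + t • b) (nhds 0) (nhds a) := by
    have : Continuous (fun t : ℝ => a + t • b) := by fun_prop
    simpa using this.tendsto 0
  have h1 := hc.eventually hcon
  obtain ⟨ε, hε, hb⟩ := Metric.eventually_nhds_iff.1 h1
  apply hP
  apply Polynomial.eq_zero_of_infinite_isRoot
  refine (Set.Ioo_infinite hε).mono ?_
  rintro t ⟨h1, h2⟩
  have := hb (y := t) (by simpa [abs_of_pos h1] using h2)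
  simp only [Set.mem_ofPred_eq, not_not] at this
  change P.eval t = 0
  rw [hPe, this]

lemma mem_Rdr_of_interior {k : ℕ} (hk : 1 ≤ k) {a : Fin (2*k+1) → ℝ}
    (h : ∀ᶠ b in nhds a, rankLE (2*k) (k+1) b) : a ∈ interior (closure (Rdr (2*k) (k+1))) := by
  set U := interior {b : Fin (2*k+1) → ℝ | rankLE (2*k) (k+1) b} with hU
  have haU : a ∈ U := mem_interior_iff_mem_nhds.2 h
  have hopen : IsOpen {a : Fin (2*k+1) → ℝ | (HN (2*k) (k+1) (k+1) a).det ≠ 0} :=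
    isOpen_ne_fun (continuous_HN.matrix_det) continuous_const
  have h1 : U ∩ {a : Fin (2*k+1) → ℝ | (HN (2*k) (k+1) (k+1) a).det ≠ 0} ⊆ Rdr (2*k) (k+1) := by
    refine interior_maximal ?_ (isOpen_interior.inter hopen)
    rintro b ⟨hb1, hb2⟩
    rw [realRankSet, Set.mem_ofPred_eq, waringRank_eq_iff]
    exact ⟨(show b ∈ {b : Fin (2*k+1) → ℝ | rankLE (2*k) (k+1) b} from interior_subset hb1), fun h => hb2 (rankLE_det hk h)⟩
  have h2 : U ⊆ closure (Rdr (2*k) (k+1)) :=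
    ((dense_det k).open_subset_closure_inter isOpen_interior).trans (closure_mono h1)
  exact interior_maximal h2 isOpen_interior haU
end density

end EM

namespace EM

/-- continuous families of polynomials -/
def CP {X : Type} [TopologicalSpace X] (F : X → Polynomial ℝ) : Prop := ∀ i, Continuous fun x => (F x).coeff i

section CP
variable {X : Type} [TopologicalSpace X] {F G : X → Polynomial ℝ}
lemma CP.const (p : Polynomial ℝ) : CP fun _ : X => p := fun _ => continuous_const
lemma CP.C {f : X → ℝ} (hf : Continuous f) : CP fun x => Polynomial.C (f x) := by
  intro i
  simp only [Polynomial.coeff_C]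
  split_ifs
  · exact hf
  · exact continuous_const
lemma CP.add (hF : CP F) (hG : CP G) : CP fun x => F x + G x := by
  intro i; simp only [Polynomial.coeff_add]; exact (hF i).add (hG i)
lemma CP.sub (hF : CP F) (hG : CP G) : CP fun x => F x - G x := by
  intro i; simp only [Polynomial.coeff_sub]; exact (hF i).sub (hG i)
lemma CP.mul (hF : CP F) (hG : CP G) : CP fun x => F x * G x := by
  intro i; simp only [Polynomial.coeff_mul]
  exact continuous_finsetSum _ fun j _ => (hF _).mul (hG _)
lemma CP.pow (hF : CP F) (n : ℕ) : CP fun x => F x ^ n := by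
  induction n with
  | zero => simpa using CP.const 1
  | succ n ih => simpa only [pow_succ] using ih.mul hF
lemma CP.prod {ι : Type} (s : Finset ι) {F : ι → X → Polynomial ℝ} (hF : ∀ i, CP (F i)) : CP fun x => ∏ i ∈ s, F i x := by
  classical
  induction s using Finset.induction_on with
  | empty => simpa using CP.const 1
  | insert a s ha ih => simpa only [Finset.prod_insert ha] using (hF a).mul ih
lemma CP.lin {f g : X → ℝ} (hf : Continuous f) (hg : Continuous g) : CP fun x => EM.lin (f x) (g x) :=
  (CP.C hf).add ((CP.C hg).mul (CP.const _))
lemma CP.toP {n : ℕ} {f : X → Fin n → ℝ} (hf : Continuous f) : CP fun x => EM.toP (f x) := by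
  intro i
  simp only [coeff_toP]
  split_ifs with h
  · exact (continuous_apply (⟨i, h⟩ : Fin n)).comp hf
  · exact continuous_const
lemma CP.ofP (hF : CP F) (n : ℕ) : Continuous fun x => EM.ofP n (F x) :=
  continuous_pi fun i => hF i
lemma CP.hev (hF : CP F) (n : ℕ) {f g : X → ℝ} (hf : Continuous f) (hg : Continuous g) :
    Continuous fun x => EM.hev n (F x) (f x) (g x) := by
  unfold EM.hev
  exact continuous_finsetSum _ fun j _ => ((hF j).mul (hf.pow _)).mul (hg.pow _)
lemma CP.Lf (hF : CP F) {d : ℕ} {f : X → Fin (d+1) → ℝ} (hf : Continuous f) :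
    Continuous fun x => EM.Lf d (f x) (F x) := by
  unfold EM.Lf
  exact continuous_finsetSum _ fun j _ => (continuous_const.mul ((continuous_apply j).comp hf)).mul (hF j)
end CP

lemma ofP_add {n : ℕ} (p q : Polynomial ℝ) : ofP n (p + q) = ofP n p + ofP n q := by
  funext i; simp [ofP]
lemma ofP_C_mul {n : ℕ} (c : ℝ) (q : Polynomial ℝ) : ofP n (Polynomial.C c * q) = c • ofP n q := by
  funext i; simp [ofP]

def mulB (n m : ℕ) : (Fin (n+1) → ℝ) →ₗ[ℝ] (Fin (m+1) → ℝ) →ₗ[ℝ] (Fin (n+m+1) → ℝ) :=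
  LinearMap.mk₂ ℝ (fun a b => ofP (n+m+1) (toP a * toP b))
    (fun a b c => by rw [toP_add, add_mul, ofP_add])
    (fun a b c => by rw [toP_smul, mul_assoc, ofP_C_mul])
    (fun a b c => by rw [toP_add, mul_add, ofP_add])
    (fun a b c => by rw [toP_smul, mul_left_comm, ofP_C_mul])

lemma mulB_open {n m : ℕ} (x0 : (Fin (n+1) → ℝ) × (Fin (m+1) → ℝ))
    (hs : ∀ r : Polynomial ℝ, r.natDegree ≤ n + m → ∃ b l : Polynomial ℝ, b.natDegree ≤ n ∧ l.natDegree ≤ m ∧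
      r = toP x0.1 * l + b * toP x0.2) :
    Filter.map (fun x : (Fin (n+1) → ℝ) × (Fin (m+1) → ℝ) => ofP (n+m+1) (toP x.1 * toP x.2)) (nhds x0)
      = nhds (ofP (n+m+1) (toP x0.1 * toP x0.2)) := by
  let B := (mulB n m).toContinuousBilinearMap
  have hB := B.isBoundedBilinearMap.hasStrictFDerivAt x0
  have := hB.map_nhds_eq_of_surj ?_
  · exact this
  · rw [LinearMap.range_eq_top]
    intro y
    obtain ⟨b, l, hb, hl, e⟩ := hs (toP y) (natDegree_toP y)
    refine ⟨(ofP (n+1) b, ofP (m+1) l), ?_⟩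
    change ofP (n+m+1) (toP x0.1 * toP (ofP (m+1) l)) + ofP (n+m+1) (toP (ofP (n+1) b) * toP x0.2) = y
    rw [toP_ofP _ hb, toP_ofP _ hl, ← ofP_add, ← e, ofP_toP]

lemma mult_open {n m : ℕ} {p0 q0 : Polynomial ℝ} (hp : p0.natDegree ≤ n) (hq : q0.natDegree ≤ m)
    (hs : ∀ r : Polynomial ℝ, r.natDegree ≤ n + m → ∃ b l : Polynomial ℝ, b.natDegree ≤ n ∧ l.natDegree ≤ m ∧
      r = p0 * l + b * q0) {A : Polynomial ℝ → Polynomial ℝ → Prop}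
    (hA : ∀ᶠ x : (Fin (n+1) → ℝ) × (Fin (m+1) → ℝ) in nhds (ofP (n+1) p0, ofP (m+1) q0), A (toP x.1) (toP x.2)) :
    ∀ᶠ c in nhds (ofP (n+m+1) (p0 * q0)), ∃ p q : Polynomial ℝ, p.natDegree ≤ n ∧ q.natDegree ≤ m ∧ A p q ∧ toP c = p * q := by
  have h := mulB_open (ofP (n+1) p0, ofP (m+1) q0) (by
    simp only [toP_ofP _ hp, toP_ofP _ hq]; exact hs)
  simp only [toP_ofP _ hp, toP_ofP _ hq] at h
  rw [← h, Filter.eventually_map]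
  filter_upwards [hA] with x hx
  exact ⟨toP x.1, toP x.2, natDegree_toP _, natDegree_toP _, hx, toP_ofP _ (natDegree_mul_le' (natDegree_toP _) (natDegree_toP _))⟩

lemma surj_lin {n : ℕ} (m : ℕ) {p : Polynomial ℝ} {u v : ℝ} (hp : p.natDegree ≤ n) (huv : ¬ (u = 0 ∧ v = 0))
    (h : hev n p v (-u) ≠ 0) (r : Polynomial ℝ) (hr : r.natDegree ≤ n + (m + 1)) :
    ∃ b l : Polynomial ℝ, b.natDegree ≤ n + m ∧ l.natDegree ≤ m + 1 ∧ r = p * l + b * lin u v := by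
  obtain ⟨s, hs, hs1⟩ := exists_nonvanish' (m+1) u v huv
  set c := hev (n+m+1) r v (-u) / hev n p v (-u) with hc
  obtain ⟨b, hb, e⟩ := exists_factor (n+m) (r + Polynomial.C (-c) * (p * s)) (by
    refine (Polynomial.natDegree_add_le _ _).trans (max_le hr ?_)
    exact (Polynomial.natDegree_C_mul_le _ _).trans ((natDegree_mul_le' hp hs).trans (by omega))) u v huv (by
    rw [hev_add, hev_C_mul, add_assoc, hev_mul n (m+1) p s hp hs, hs1, hc, add_assoc]
    field_simp; ring)
  refine ⟨b, Polynomial.C c * s, hb, (Polynomial.natDegree_C_mul_le _ _).trans hs, ?_⟩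
  rw [← e]; simp; ring

lemma surj_lin_sq {n : ℕ} {p : Polynomial ℝ} {u v : ℝ} (hp : p.natDegree ≤ n) (huv : ¬ (u = 0 ∧ v = 0))
    (h : hev n p v (-u) ≠ 0) (r : Polynomial ℝ) (hr : r.natDegree ≤ n + 2) :
    ∃ b l : Polynomial ℝ, b.natDegree ≤ n ∧ l.natDegree ≤ 2 ∧ r = p * l + b * lin u v ^ 2 := by
  obtain ⟨b1, l1, hb1, hl1, rfl⟩ := surj_lin 1 hp huv h r hr
  obtain ⟨b2, l2, hb2, hl2, rfl⟩ := surj_lin 0 hp huv h b1 hb1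
  refine ⟨b2, l1 + l2 * lin u v, hb2, ?_, by ring⟩
  refine (Polynomial.natDegree_add_le _ _).trans (max_le hl1 ?_)
  exact natDegree_mul_le' hl2 (natDegree_lin _ _)

lemma DR.eventually {n : ℕ} {p : Polynomial ℝ} (h : DR n p) : ∀ᶠ a in nhds (ofP (n+1) p), DR n (toP a) := by
  induction n generalizing p with
  | zero =>
    obtain ⟨c, hc, rfl⟩ := h
    have h1 : ∀ᶠ a : Fin 1 → ℝ in nhds (ofP 1 (Polynomial.C c)), a 0 ≠ 0 := by
      apply (continuous_apply (0 : Fin 1)).continuousAt.eventually_ne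
      simpa [ofP] using hc
    filter_upwards [h1] with a ha
    exact ⟨a 0, ha, by simp [toP]⟩
  | succ n ih =>
    obtain ⟨p', u, v, h1, h2, rfl, h3⟩ := h
    have hA : ∀ᶠ x : (Fin (n+1) → ℝ) × (Fin (1+1) → ℝ) in nhds (ofP (n+1) p', ofP (1+1) (lin u v)),
        DR n (toP x.1) ∧ ¬ ((toP x.2).coeff 0 = 0 ∧ (toP x.2).coeff 1 = 0) ∧ hev n (toP x.1) ((toP x.2).coeff 1) (-(toP x.2).coeff 0) ≠ 0 := by
      have e1 : ∀ᶠ x : (Fin (n+1) → ℝ) × (Fin (1+1) → ℝ) in nhds (ofP (n+1) p', ofP (1+1) (lin u v)), DR n (toP x.1) :=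
        (continuous_fst.continuousAt (x := (ofP (n+1) p', ofP (1+1) (lin u v)))).eventually (p := fun y => DR n (toP y)) (ih h1)
      have c1 : CP fun x : (Fin (n+1) → ℝ) × (Fin (1+1) → ℝ) => toP x.1 := CP.toP continuous_fst
      have c2 : CP fun x : (Fin (n+1) → ℝ) × (Fin (1+1) → ℝ) => toP x.2 := CP.toP continuous_snd
      have e2 : ∀ᶠ x : (Fin (n+1) → ℝ) × (Fin (1+1) → ℝ) in nhds (ofP (n+1) p', ofP (1+1) (lin u v)), hev n (toP x.1) ((toP x.2).coeff 1) (-(toP x.2).coeff 0) ≠ 0 := by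
        apply (c1.hev n (c2 1) (c2 0).fun_neg).continuousAt.eventually_ne
        simp only
        rw [toP_ofP _ h1.natDegree, toP_ofP _ (natDegree_lin u v)]
        simpa using h3
      have e3 : ∀ᶠ x : (Fin (n+1) → ℝ) × (Fin (1+1) → ℝ) in nhds (ofP (n+1) p', ofP (1+1) (lin u v)),
          ((toP x.2).coeff 0)^2 + ((toP x.2).coeff 1)^2 ≠ 0 := by
        apply (((c2 0).fun_pow 2).fun_add ((c2 1).fun_pow 2)).continuousAt.eventually_ne
        simp only
        rw [toP_ofP _ (natDegree_lin u v)]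
        simp only [coeff_lin_zero, coeff_lin_one]
        intro h0
        apply h2
        constructor <;> nlinarith [sq_nonneg u, sq_nonneg v]
      filter_upwards [e1, e2, e3] with x h1 h2 h3
      refine ⟨h1, ?_, h2⟩
      rintro ⟨ha, hb⟩
      apply h3
      rw [ha, hb]; ring
    have := mult_open (A := fun p q => DR n p ∧ ¬ (q.coeff 0 = 0 ∧ q.coeff 1 = 0) ∧ hev n p (q.coeff 1) (-q.coeff 0) ≠ 0) h1.natDegree (natDegree_lin u v) (surj_lin 0 h1.natDegree h2 h3) hA
    filter_upwards [this] with a ha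
    obtain ⟨p, q, hp, hq, ⟨a1, a2, a3⟩, e⟩ := ha
    exact ⟨p, _, _, a1, a2, by rw [e, ← lin_eq_toP q hq], a3⟩

/-- interior lemma -/
lemma Wint {k : ℕ} (hk : 1 ≤ k) {g : Polynomial ℝ} (h : DR (k+1) g) {a : Fin (2*k+1) → ℝ} (ha : apo k a g)
    (hN : NRI k a) : a ∈ interior (closure (Rdr (2*k) (k+1))) := by
  apply mem_Rdr_of_interior hk
  obtain ⟨S, hS⟩ := hN
  have hc : Continuous fun b => kerProj (NN k b) S (ofP (k+2) g) :=
    continuous_kerProj continuous_HN continuous_const continuous_const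
  have e : kerProj (NN k a) S (ofP (k+2) g) = ofP (k+2) g := by
    apply kerProj_eq _ _ _ hS
    rw [← apo_iff_NN, toP_ofP _ h.natDegree]; exact ha
  have h1 := hc.continuousAt (x := a)
  rw [ContinuousAt, e] at h1
  filter_upwards [h1.eventually h.eventually] with b hb
  refine hb.rankLE hk ?_
  rw [apo_iff_NN]
  exact mulVec_kerProj _ _ _

/-- product of unit linear forms -/
def gw {n : ℕ} (w : Fin n → ℝ × ℝ) : Polynomial ℝ := ∏ i, lin (w i).1 (w i).2

def Kw (n : ℕ) : Set (Fin n → ℝ × ℝ) := Set.univ.pi fun _ => {x | x.1 ^ 2 + x.2 ^ 2 = 1}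

lemma isCompact_Kw (n : ℕ) : IsCompact (Kw n) := by
  apply isCompact_univ_pi
  intro _
  apply Metric.isCompact_of_isClosed_isBounded
  · exact isClosed_eq (by fun_prop) continuous_const
  · apply (Metric.isBounded_closedBall (x := (0 : ℝ × ℝ)) (r := 1)).subset
    rintro ⟨x, y⟩ h
    simp only [Set.mem_ofPred_eq] at h
    simp only [Metric.mem_closedBall, dist_zero_right, Prod.norm_def, Real.norm_eq_abs]
    apply max_le <;> rw [abs_le_one_iff_mul_self_le_one] <;> nlinarith [sq_nonneg x, sq_nonneg y]

lemma CP_gw {n : ℕ} : CP fun w : Fin n → ℝ × ℝ => gw w :=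
  CP.prod _ fun i => CP.lin (by fun_prop) (by fun_prop)

lemma RR_iff_gw {n : ℕ} {p : Polynomial ℝ} : RR n p ↔ ∃ c : ℝ, c ≠ 0 ∧ ∃ w ∈ Kw n, p = Polynomial.C c * gw w := by
  constructor
  · rintro ⟨c, u, v, hc, h, rfl⟩
    exact ⟨c, hc, fun i => (u i, v i), fun i _ => h i, rfl⟩
  · rintro ⟨c, hc, w, hw, rfl⟩
    exact ⟨c, fun i => (w i).1, fun i => (w i).2, hc, fun i => hw i trivial, rfl⟩

lemma RR_gw {n : ℕ} {w : Fin n → ℝ × ℝ} (hw : w ∈ Kw n) : RR n (gw w) :=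
  RR_iff_gw.2 ⟨1, one_ne_zero, w, hw, by simp⟩

/-- forms in the closure have an apolar form with real roots -/
lemma closure_RR {k : ℕ} (hk : 1 ≤ k) {a : Fin (2*k+1) → ℝ} (ha : a ∈ closure (Rdr (2*k) (k+1))) :
    ∃ g, RR (k+1) g ∧ apo k a g := by
  by_contra hcon
  have hP : ∀ w ∈ Kw (k+1), ∀ᶠ z : (Fin (2*k+1) → ℝ) × (Fin (k+1) → ℝ × ℝ) in nhds (a, w), ¬ apo k z.1 (gw z.2) := by
    intro w hw
    have : ¬ apo k a (gw w) := fun h => hcon ⟨_, RR_gw hw, h⟩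
    unfold apo at this
    push Not at this
    obtain ⟨j, hj, hne⟩ := this
    have hc : CP fun z : (Fin (2*k+1) → ℝ) × (Fin (k+1) → ℝ × ℝ) => gw z.2 * Polynomial.X ^ j :=
      CP.mul (fun i => (CP_gw i).comp continuous_snd) (CP.const _)
    have := (hc.Lf continuous_fst).continuousAt.eventually_ne (x := (a, w)) hne
    filter_upwards [this] with z hz h
    exact hz (h j hj)
  have h1 := (isCompact_Kw (k+1)).eventually_forall_of_forall_eventually (x₀ := a) (P := fun b w => ¬ apo k b (gw w)) hP
  rw [mem_closure_iff_frequently] at ha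
  obtain ⟨b, hb, hb'⟩ := (ha.and_eventually h1).exists
  have hr : b ∈ realRankSet (2*k) (k+1) := interior_subset hb
  rw [realRankSet, Set.mem_ofPred_eq, waringRank_eq_iff] at hr
  obtain ⟨g, hg, hg'⟩ := hr.1.rr (m := k - 1) (by omega) (by omega)
  obtain ⟨c, hc, w, hw, rfl⟩ := RR_iff_gw.1 hg
  apply hb' w hw
  intro j hj
  have := hg' (Polynomial.X ^ j) (by simp; omega)
  rw [mul_assoc, Lf_C_mul] at this
  exact (mul_eq_zero.1 this).resolve_left hc

end EM

namespace EM

/-- complexification of a coefficient vector -/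
abbrev cx {n : ℕ} (a : Fin n → ℝ) : Fin n → ℂ := fun i => ((a i : ℝ) : ℂ)

abbrev mapC (p : Polynomial ℝ) : Polynomial ℂ := p.map Complex.ofRealHom

lemma Lf_map {d : ℕ} (a : Fin (d+1) → ℝ) (p : Polynomial ℝ) : Lf d (cx a) (mapC p) = ((Lf d a p : ℝ) : ℂ) := by
  unfold Lf
  simp [wt]

lemma apo_map {k : ℕ} {a : Fin (2*k+1) → ℝ} {g : Polynomial ℝ} (h : apo k a g) : apo k (cx a) (mapC g) := by
  intro j hj
  have := Lf_map a (g * Polynomial.X ^ j)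
  rw [h j hj] at this
  simpa [mapC] using this

lemma Gam_of_real {c dm dq k : ℕ} {a : Fin (2*k+1) → ℝ} {m q : Polynomial ℝ} (hm : m ≠ 0) (hq : q ≠ 0)
    (hm' : m.natDegree ≤ dm) (hq' : q.natDegree ≤ dq) (h : apo k a (m ^ (c+2) * q)) : cx a ∈ Gam c dm dq k := by
  refine ⟨mapC m, mapC q, ?_, ?_, ?_, ?_, ?_⟩
  · rwa [Ne, Polynomial.map_eq_zero_iff Complex.ofRealHom.injective]
  · rwa [Ne, Polynomial.map_eq_zero_iff Complex.ofRealHom.injective]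
  · exact Polynomial.natDegree_map_le.trans hm'
  · exact Polynomial.natDegree_map_le.trans hq'
  · have := apo_map h
    simpa [mapC] using this

lemma hev_smul (n : ℕ) (p : Polynomial ℝ) (t x y : ℝ) : hev n p (t * x) (t * y) = t ^ n * hev n p x y := by
  unfold hev
  rw [Finset.mul_sum]
  refine Finset.sum_congr rfl fun i hi => ?_
  have : i ≤ n := by simpa [Nat.lt_succ_iff] using hi
  have e : t ^ n = t ^ (n - i) * t ^ i := by rw [← pow_add]; congr 1; omega
  rw [e]; ring

lemma DR.mul {n m : ℕ} {p q : Polynomial ℝ} (hp : DR n p) (hq : DR m q)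
    (h : ∀ x y : ℝ, ¬ (x = 0 ∧ y = 0) → hev m q x y = 0 → hev n p x y ≠ 0) : DR (n + m) (p * q) := by
  induction m generalizing q with
  | zero =>
    obtain ⟨c, hc, rfl⟩ := hq
    rw [mul_comm]
    exact hp.smul hc
  | succ m ih =>
    obtain ⟨q', u, v, h1, h2, rfl, h3⟩ := hq
    refine ⟨p * q', u, v, ih h1 ?_, h2, by ring, ?_⟩
    · intro x y hxy h0
      apply h x y hxy
      rw [hev_mul_lin h1.natDegree, h0, zero_mul]
    · change hev (n + m) (p * q') v (-u) ≠ 0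
      rw [hev_mul n m p q' hp.natDegree h1.natDegree]
      refine mul_ne_zero (h _ _ ?_ ?_) h3
      · rintro ⟨rfl, h⟩; exact h2 ⟨by linarith, rfl⟩
      · rw [hev_mul_lin h1.natDegree]; ring

lemma DR_lin {u v : ℝ} (h : ¬ (u = 0 ∧ v = 0)) : DR 1 (lin u v) :=
  ⟨Polynomial.C 1, u, v, ⟨1, one_ne_zero, rfl⟩, h, by simp, by rw [hev_zeroP]; exact one_ne_zero⟩

lemma exists_hev_ne {n : ℕ} {p : Polynomial ℝ} (hp : p ≠ 0) (hd : p.natDegree ≤ n) :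
    ∃ u v : ℝ, ¬ (u = 0 ∧ v = 0) ∧ hev n p v (-u) ≠ 0 := by
  by_contra hcon
  push Not at hcon
  apply hp
  apply Polynomial.funext
  intro t
  have := hcon (-t) 1 (by simp)
  rw [hev_one n p hd] at this
  simpa using this

/-- a quadratic form taking both signs splits -/
lemma DR_quad {b : Polynomial ℝ} (hb : b.natDegree ≤ 2) {x0 y0 x1 y1 : ℝ} (h0 : 0 < hev 2 b x0 y0)
    (h1 : hev 2 b x1 y1 < 0) : DR 2 b := by
  have eb : b = Polynomial.C (b.coeff 0) + Polynomial.C (b.coeff 1) * Polynomial.X + Polynomial.C (b.coeff 2) * Polynomial.X ^ 2 := by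
    conv_lhs => rw [Polynomial.as_sum_range_C_mul_X_pow' (n := 3) b (by omega)]
    simp [Finset.sum_range_succ]
  simp only [hev, Finset.sum_range_succ, Finset.sum_range_zero] at h0 h1
  set A := b.coeff 0
  set B := b.coeff 1
  set C := b.coeff 2
  norm_num at h0 h1
  have hdisc : 0 < B ^ 2 - 4 * A * C := by
    by_contra hcon
    push Not at hcon
    have hC0 : 0 ≤ C * (A * x0 ^ 2 + B * x0 * y0 + C * y0 ^ 2) := by
      nlinarith [sq_nonneg (2 * C * y0 + B * x0), mul_nonneg (sq_nonneg x0) (sub_nonneg.2 hcon)]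
    have hC1 : 0 ≤ C * (A * x1 ^ 2 + B * x1 * y1 + C * y1 ^ 2) := by
      nlinarith [sq_nonneg (2 * C * y1 + B * x1), mul_nonneg (sq_nonneg x1) (sub_nonneg.2 hcon)]
    have hA0 : 0 ≤ A * (A * x0 ^ 2 + B * x0 * y0 + C * y0 ^ 2) := by
      nlinarith [sq_nonneg (2 * A * x0 + B * y0), mul_nonneg (sq_nonneg y0) (sub_nonneg.2 hcon)]
    have hA1 : 0 ≤ A * (A * x1 ^ 2 + B * x1 * y1 + C * y1 ^ 2) := by
      nlinarith [sq_nonneg (2 * A * x1 + B * y1), mul_nonneg (sq_nonneg y1) (sub_nonneg.2 hcon)]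
    have C1 : 0 ≤ C := nonneg_of_mul_nonneg_left hC0 h0
    have C2 : C ≤ 0 := by by_contra h; push Not at h; nlinarith
    have A1 : 0 ≤ A := nonneg_of_mul_nonneg_left hA0 h0
    have A2 : A ≤ 0 := by by_contra h; push Not at h; nlinarith
    have hA : A = 0 := le_antisymm A2 A1
    have hC : C = 0 := le_antisymm C2 C1
    have hB : B = 0 := by
      have : B ^ 2 ≤ 0 := by rw [hA] at hcon; linarith
      exact pow_eq_zero_iff (two_ne_zero) |>.1 (le_antisymm this (sq_nonneg B))
    rw [hA, hB, hC] at h0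
    norm_num at h0
  set s := Real.sqrt (B ^ 2 - 4 * A * C) with hs
  have hs0 : 0 < s := Real.sqrt_pos.2 hdisc
  have hs2 : s ^ 2 = B ^ 2 - 4 * A * C := Real.sq_sqrt hdisc.le
  by_cases hC : C = 0
  · have hB : B ≠ 0 := by rintro hB; rw [hB, hC] at hdisc; norm_num at hdisc
    refine ⟨lin A B, 1, 0, DR_lin (by tauto), by simp, ?_, ?_⟩
    · rw [eb, hC]; simp [lin]
    · rw [hev_lin]; simpa using hB
  · refine ⟨lin ((B - s)/2) C, (B+s)/(2*C), 1, DR_lin (by tauto), by simp, ?_, ?_⟩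
    · rw [eb]
      have e1 : A = (B - s)/2 * ((B+s)/(2*C)) := by field_simp; linarith
      have e2 : B = (B-s)/2 + C * ((B+s)/(2*C)) := by field_simp; ring
      simp only [lin, Polynomial.C_1]
      generalize (B+s)/(2*C) = t at e1 e2 ⊢
      generalize (B-s)/2 = r at e1 e2 ⊢
      rw [e1, e2]
      simp only [Polynomial.C_add, Polynomial.C_mul]
      ring
    · rw [hev_lin]
      have : (B - s) / 2 * 1 + C * -((B + s) / (2 * C)) = - s := by field_simp; ring
      rw [this]; exact neg_ne_zero.2 hs0.ne'

lemma exists_ker_indep {k : ℕ} {a : Fin (2*k+1) → ℝ} {g1 : Polynomial ℝ}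
    (hd1 : g1.natDegree ≤ k+1) (h0 : g1 ≠ 0) (h1 : apo k a g1) :
    ∃ g2 : Polynomial ℝ, g2.natDegree ≤ k+1 ∧ apo k a g2 ∧
      ∀ c1 c2 : ℝ, Polynomial.C c1 * g1 + Polynomial.C c2 * g2 = 0 → c1 = 0 ∧ c2 = 0 := by
  have hfr : 1 < Module.finrank ℝ (LinearMap.ker (NN k a).mulVecLin) := by
    have := LinearMap.finrank_range_add_finrank_ker (NN k a).mulVecLin
    have h2 := Submodule.finrank_le (LinearMap.range (NN k a).mulVecLin)
    simp at this h2
    omega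
  have e1 : toP (ofP (k+2) g1) = g1 := toP_ofP _ hd1
  have m1 : ofP (k+2) g1 ∈ LinearMap.ker (NN k a).mulVecLin := by
    rw [← e1, apo_iff_NN] at h1; simpa using h1
  obtain ⟨⟨z, hz⟩, hli⟩ := exists_linearIndependent_pair_of_one_lt_finrank hfr (x := ⟨_, m1⟩) (by
    intro h
    apply h0
    rw [← e1]
    have := congrArg Subtype.val h
    simp only [Submodule.coe_zero] at this
    rw [this, toP_zero])
  refine ⟨toP z, natDegree_toP z, ?_, ?_⟩
  · rw [apo_iff_NN]; simpa using hz
  · intro c1 c2 h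
    rw [LinearIndependent.pair_iff] at hli
    apply hli
    apply Subtype.ext
    apply toP_injective
    simp only [Submodule.coe_add, Submodule.coe_smul, Submodule.coe_zero]
    rw [toP_add, toP_smul, toP_smul, e1, h, toP_zero]

lemma exists_nonvanish_ker {k : ℕ} {a : Fin (2*k+1) → ℝ} {g1 : Polynomial ℝ}
    (hd1 : g1.natDegree ≤ k+1) (h0 : g1 ≠ 0) (h1 : apo k a g1)
    (hno : ∀ q : Polynomial ℝ, q.natDegree ≤ k → (∀ j ≤ k, Lf (2*k) a (q * Polynomial.X ^ j) = 0) → q = 0)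
    {u v : ℝ} (huv : ¬ (u = 0 ∧ v = 0)) :
    ∃ g2 : Polynomial ℝ, g2.natDegree ≤ k+1 ∧ apo k a g2 ∧ hev (k+1) g2 v (-u) ≠ 0 := by
  by_contra hcon
  push Not at hcon
  obtain ⟨g2, hd2, h2, hli⟩ := exists_ker_indep hd1 h0 h1
  obtain ⟨w1, hw1, rfl⟩ := exists_factor k g1 hd1 u v huv (hcon g1 hd1 h1)
  obtain ⟨w2, hw2, rfl⟩ := exists_factor k g2 hd2 u v huv (hcon g2 hd2 h2)
  have rel : ∀ w : Polynomial ℝ, apo k a (w * lin u v) → ∀ j < k,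
      u * Lf (2*k) a (w * Polynomial.X ^ j) + v * Lf (2*k) a (w * Polynomial.X ^ (j+1)) = 0 := by
    intro w hw j hj
    have := hw j hj
    rw [← Lf_C_mul, ← Lf_C_mul, ← Lf_add, ← this]
    congr 1
    simp only [lin]; ring
  have key : ∃ e ≤ k, ∀ w : Polynomial ℝ, apo k a (w * lin u v) → Lf (2*k) a (w * Polynomial.X ^ e) = 0 →
      ∀ j ≤ k, Lf (2*k) a (w * Polynomial.X ^ j) = 0 := by
    by_cases hv : v = 0
    · have hu : u ≠ 0 := by tauto
      refine ⟨k, le_rfl, fun w hw hk j hj => ?_⟩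
      rcases hj.lt_or_eq with h | rfl
      · have := rel w hw j h
        rw [hv, zero_mul, add_zero] at this
        exact (mul_eq_zero.1 this).resolve_left hu
      · exact hk
    · refine ⟨0, Nat.zero_le _, fun w hw hk j hj => ?_⟩
      induction j with
      | zero => exact hk
      | succ j ih =>
        have := rel w hw j (by omega)
        rw [ih (by omega), mul_zero, zero_add] at this
        exact (mul_eq_zero.1 this).resolve_left hv
  obtain ⟨e, he, key⟩ := key
  have comb : ∀ c1 c2 : ℝ, c1 * Lf (2*k) a (w1 * Polynomial.X ^ e) + c2 * Lf (2*k) a (w2 * Polynomial.X ^ e) = 0 → c1 = 0 ∧ c2 = 0 := by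
    intro c1 c2 hc
    have hz : Polynomial.C c1 * w1 + Polynomial.C c2 * w2 = 0 := by
      apply hno
      · refine (Polynomial.natDegree_add_le _ _).trans (max_le ?_ ?_)
        · exact (Polynomial.natDegree_C_mul_le _ _).trans hw1
        · exact (Polynomial.natDegree_C_mul_le _ _).trans hw2
      · apply key
        · intro j hj
          have a1 := h1 j hj
          have a2 := h2 j hj
          have : (Polynomial.C c1 * w1 + Polynomial.C c2 * w2) * lin u v * Polynomial.X ^ j =
            Polynomial.C c1 * (w1 * lin u v * Polynomial.X ^ j) + Polynomial.C c2 * (w2 * lin u v * Polynomial.X ^ j) := by ring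
          rw [this, Lf_add, Lf_C_mul, Lf_C_mul, a1, a2]; ring
        · rw [add_mul, mul_assoc, mul_assoc, Lf_add, Lf_C_mul, Lf_C_mul, hc]
    apply hli
    have : Polynomial.C c1 * (w1 * lin u v) + Polynomial.C c2 * (w2 * lin u v) = (Polynomial.C c1 * w1 + Polynomial.C c2 * w2) * lin u v := by ring
    rw [this, hz, zero_mul]
  have c := comb (Lf (2*k) a (w2 * Polynomial.X ^ e)) (-Lf (2*k) a (w1 * Polynomial.X ^ e)) (by ring)
  have := comb 1 0 (by rw [neg_eq_zero.1 c.2]; ring)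
  exact one_ne_zero this.1

/-- perturbing a double root -/
lemma perturb_double {n : ℕ} {p' g2 : Polynomial ℝ} {u v : ℝ} (huv : ¬ (u = 0 ∧ v = 0)) (hp : DR n p')
    (hpu : hev n p' v (-u) ≠ 0) (hg2 : g2.natDegree ≤ n + 2) (hgu : hev (n+2) g2 v (-u) ≠ 0) :
    ∃ ε : ℝ, DR (n+2) (p' * lin u v ^ 2 + Polynomial.C ε * g2) := by
  have hpos : 0 < u ^ 2 + v ^ 2 := by
    by_contra hcon
    apply huv
    constructor <;> nlinarith [sq_nonneg u, sq_nonneg v]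
  have hl2 : (lin u v ^ 2).natDegree ≤ 2 := by
    simpa using Polynomial.natDegree_pow_le_of_le 2 (natDegree_lin u v)
  have hevl : ∀ x y, hev 2 (lin u v ^ 2) x y = (u * x + v * y) ^ 2 := by
    intro x y
    have := hev_pow 1 2 (lin u v) (natDegree_lin u v) x y
    simpa using this
  let x0 : (Fin (n+1) → ℝ) × (Fin (2+1) → ℝ) := (ofP (n+1) p', ofP (2+1) (lin u v ^ 2))
  have c1 : CP fun x : (Fin (n+1) → ℝ) × (Fin (2+1) → ℝ) => toP x.1 := CP.toP continuous_fst
  have c2 : CP fun x : (Fin (n+1) → ℝ) × (Fin (2+1) → ℝ) => toP x.2 := CP.toP continuous_snd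
  have E1 : toP x0.1 = p' := toP_ofP _ hp.natDegree
  have E2 : toP x0.2 = lin u v ^ 2 := toP_ofP _ hl2
  have a1 : ∀ᶠ x : (Fin (n+1) → ℝ) × (Fin (2+1) → ℝ) in nhds x0, DR n (toP x.1) :=
    (continuous_fst.continuousAt (x := x0)).eventually (p := fun y => DR n (toP y)) hp.eventually
  have a2 : ∀ᶠ x : (Fin (n+1) → ℝ) × (Fin (2+1) → ℝ) in nhds x0, 0 < hev n (toP x.1) v (-u) * hev n p' v (-u) := by
    refine Filter.Tendsto.eventually_const_lt ?_ (((c1.hev n continuous_const continuous_const).fun_mul continuous_const).tendsto x0)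
    simp only [E1]
    exact mul_self_pos.2 hpu
  have a3 : ∀ᶠ x : (Fin (n+1) → ℝ) × (Fin (2+1) → ℝ) in nhds x0, 0 < hev 2 (toP x.2) u v := by
    refine Filter.Tendsto.eventually_const_lt ?_ ((c2.hev 2 continuous_const continuous_const).tendsto x0)
    simp only [E2, hevl]
    have : 0 < u * u + v * v := by nlinarith
    positivity
  have a4 : ∀ᶠ x : (Fin (n+1) → ℝ) × (Fin (2+1) → ℝ) in nhds x0, ∀ y ∈ Metric.sphere (0 : ℝ × ℝ) 1, hev 2 (toP x.2) y.1 y.2 ^ 2 + hev n (toP x.1) y.1 y.2 ^ 2 ≠ 0 := by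
    apply (isCompact_sphere (0 : ℝ × ℝ) 1).eventually_forall_of_forall_eventually (P := fun (x : (Fin (n+1) → ℝ) × (Fin (2+1) → ℝ)) (y : ℝ × ℝ) => hev 2 (toP x.2) y.1 y.2 ^ 2 + hev n (toP x.1) y.1 y.2 ^ 2 ≠ 0)
    intro y hy
    have d1 : CP fun x : ((Fin (n+1) → ℝ) × (Fin (2+1) → ℝ)) × (ℝ × ℝ) => toP x.1.1 := CP.toP (by fun_prop)
    have d2 : CP fun x : ((Fin (n+1) → ℝ) × (Fin (2+1) → ℝ)) × (ℝ × ℝ) => toP x.1.2 := CP.toP (by fun_prop)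
    have cc : Continuous fun x : ((Fin (n+1) → ℝ) × (Fin (2+1) → ℝ)) × (ℝ × ℝ) => hev 2 (toP x.1.2) x.2.1 x.2.2 ^ 2 + hev n (toP x.1.1) x.2.1 x.2.2 ^ 2 :=
      ((d2.hev 2 (by fun_prop) (by fun_prop)).fun_pow 2).fun_add ((d1.hev n (by fun_prop) (by fun_prop)).fun_pow 2)
    apply cc.continuousAt.eventually_ne
    simp only [E1, E2, hevl]
    intro h
    have hy0 : ¬ (y.1 = 0 ∧ y.2 = 0) := by
      rintro ⟨h1, h2⟩
      have : y = 0 := Prod.ext h1 h2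
      rw [this] at hy; simp at hy
    have z1 : u * y.1 + v * y.2 = 0 := by
      have : (u * y.1 + v * y.2) ^ 2 = 0 := by nlinarith [sq_nonneg ((u * y.1 + v * y.2)^2), sq_nonneg (hev n p' y.1 y.2), sq_nonneg (u * y.1 + v * y.2)]
      exact pow_eq_zero_iff two_ne_zero |>.1 this
    have z2 : hev n p' y.1 y.2 = 0 := by
      have : (hev n p' y.1 y.2) ^ 2 = 0 := by rw [z1] at h; nlinarith
      exact pow_eq_zero_iff two_ne_zero |>.1 this
    set t := (v * y.1 - u * y.2) / (u^2+v^2) with ht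
    have t1 : y.1 = t * v := by rw [ht]; field_simp; linear_combination u * z1
    have t2 : y.2 = t * (-u) := by rw [ht]; field_simp; linear_combination v * z1
    rw [t1, t2, hev_smul] at z2
    rcases mul_eq_zero.1 z2 with h | h
    · have h3 : t = 0 := by
        by_contra h4; exact pow_ne_zero n h4 h
      exact hy0 ⟨by rw [t1, h3, zero_mul], by rw [t2, h3, zero_mul]⟩
    · exact hpu h
  have hM := mult_open (A := fun p b => DR n p ∧ 0 < hev n p v (-u) * hev n p' v (-u) ∧ 0 < hev 2 b u v ∧
      ∀ y ∈ Metric.sphere (0 : ℝ × ℝ) 1, hev 2 b y.1 y.2 ^ 2 + hev n p y.1 y.2 ^ 2 ≠ 0) hp.natDegree hl2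
      (surj_lin_sq hp.natDegree huv hpu) (a1.and (a2.and (a3.and a4)))
  set c := hev (n+2) g2 v (-u) * hev n p' v (-u) with hc
  have hcne : c ≠ 0 := mul_ne_zero hgu hpu
  have hcont : Continuous fun t : ℝ => ofP (n+2+1) (p' * lin u v ^ 2 + Polynomial.C (-t * c) * g2) :=
    CP.ofP ((CP.const _).add ((CP.C (by fun_prop)).mul (CP.const _))) _
  have ht := hcont.continuousAt (x := 0)
  rw [ContinuousAt] at ht
  have e0 : ofP (n+2+1) (p' * lin u v ^ 2 + Polynomial.C (-(0:ℝ) * c) * g2) = ofP (n+2+1) (p' * lin u v ^ 2) := by simp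
  rw [e0] at ht
  have hev1 := (ht.eventually hM).filter_mono (nhdsWithin_le_nhds (s := Set.Ioi 0))
  obtain ⟨t, ⟨p, b, hp1, hb1, ⟨b1, b2, b3, b4⟩, e⟩, ht0⟩ := (hev1.and (self_mem_nhdsWithin)).exists
  have ht0 : 0 < t := ht0
  have hdd : (p' * lin u v ^ 2 + Polynomial.C (-t * c) * g2).natDegree ≤ n + 2 := by
    refine (Polynomial.natDegree_add_le _ _).trans (max_le (natDegree_mul_le' hp.natDegree hl2) ?_)
    exact (Polynomial.natDegree_C_mul_le _ _).trans hg2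
  rw [toP_ofP _ hdd] at e
  refine ⟨-t * c, ?_⟩
  rw [e]
  have hval : hev n p v (-u) * hev 2 b v (-u) = -t * c * hev (n+2) g2 v (-u) := by
    rw [← hev_mul n 2 p b hp1 hb1, ← e, hev_add, hev_C_mul, hev_mul n 2 _ _ hp.natDegree hl2, hevl]
    ring
  have hbneg : hev 2 b v (-u) < 0 := by
    by_contra hcon
    push Not at hcon
    have h1 : 0 ≤ (hev n p v (-u) * hev n p' v (-u)) * hev 2 b v (-u) := mul_nonneg b2.le hcon
    have h2 : (hev n p v (-u) * hev n p' v (-u)) * hev 2 b v (-u) = - (t * c ^ 2) := by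
      rw [mul_right_comm, hval, hc]; ring
    have : 0 < t * c ^ 2 := by positivity
    linarith
  refine b1.mul (DR_quad hb1 b3 hbneg) ?_
  intro x y hxy hb0 hp0
  have hn : ‖((x, y) : ℝ × ℝ)‖ ≠ 0 := by
    rw [norm_ne_zero_iff]
    intro h
    exact hxy ⟨congrArg Prod.fst h, congrArg Prod.snd h⟩
  set s := ‖((x, y) : ℝ × ℝ)‖⁻¹ with hs
  apply b4 (s * x, s * y)
  · have : ((s * x, s * y) : ℝ × ℝ) = s • (x, y) := rfl
    rw [this, mem_sphere_zero_iff_norm, norm_smul, hs, norm_inv, norm_norm]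
    exact inv_mul_cancel₀ hn
  · simp only
    rw [hev_smul, hev_smul, hb0, hp0]; ring

/-- boundary points lie on one of the two dual cones -/
lemma propII (K : ℕ) {a : Fin (2*(K+3)+1) → ℝ} (ha : a ∈ topBoundary (2*(K+3)) (K+3+1)) :
    cx a ∈ Gam 0 2 K (K+3) ∪ Gam 1 1 (K+1) (K+3) := by
  obtain ⟨hcl, hinterior⟩ := ha
  obtain ⟨g, hg, hga⟩ := closure_RR (by omega) hcl
  by_cases h0 : ∃ q : Polynomial ℝ, q.natDegree ≤ K+2 ∧ (∀ j ≤ K+3+1, Lf (2*(K+3)) a (q * Polynomial.X ^ j) = 0) ∧ q ≠ 0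
  · right
    obtain ⟨q, hq, hk, hq0⟩ := h0
    obtain ⟨p', u, v, hp', huv, e⟩ := exists_lin_factor (K+1) (mapC q) (Polynomial.natDegree_map_le.trans hq)
    have hq1 : mapC q ≠ 0 := by rwa [Ne, Polynomial.map_eq_zero_iff Complex.ofRealHom.injective]
    refine ⟨lin u v, p', lin_ne_zero huv, ?_, natDegree_lin _ _, hp', ?_⟩
    · rintro rfl; rw [zero_mul] at e; exact hq1 e
    · have hk' : ∀ j ≤ K+3+1, Lf (2*(K+3)) (cx a) (mapC q * Polynomial.X ^ j) = 0 := by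
        intro j hj
        have := Lf_map a (q * Polynomial.X ^ j)
        rw [hk j hj] at this
        simpa [mapC] using this
      intro j hj
      have e2 : lin u v ^ (1+2) * p' * Polynomial.X ^ j = mapC q * (lin u v ^ 2 * Polynomial.X ^ j) := by rw [e]; ring
      rw [e2]
      apply Lf_mul_eq_zero hk'
      refine (natDegree_mul_le' (n := 2) (m := j) (by simpa using Polynomial.natDegree_pow_le_of_le 2 (natDegree_lin u v)) (by simp)).trans (by omega)
  have hN : NRI (K+3) a := NRI_of (by omega) (by
    intro q hq hk
    by_contra hne
    exact h0 ⟨q, hq, hk, hne⟩)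
  have hW : ∀ g, DR (K+3+1) g → apo (K+3) a g → False := fun g h h' => hinterior (Wint (by omega) h h' hN)
  by_cases hA : ∃ q : Polynomial ℝ, q.natDegree ≤ K+3 ∧ (∀ j ≤ K+3, Lf (2*(K+3)) a (q * Polynomial.X ^ j) = 0) ∧ q ≠ 0
  · obtain ⟨q, hq, hk, hq0⟩ := hA
    have hlin : ∀ u v : ℝ, apo (K+3) a (q * lin u v) := by
      intro u v j hj
      rw [mul_assoc]
      apply Lf_mul_eq_zero hk
      exact (natDegree_mul_le' (n := 1) (m := j) (natDegree_lin _ _) (by simp)).trans (by omega)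
    obtain ⟨c1, c2, e⟩ := hN.pencil (g1 := q * lin 1 0) (g2 := q * lin 0 1) (g := g)
      (natDegree_mul_le' hq (natDegree_lin _ _)) (natDegree_mul_le' hq (natDegree_lin _ _)) hg.natDegree (hlin _ _) (hlin _ _) hga (by
        intro c1 c2 h
        have : q * lin c1 c2 = 0 := by rw [← h]; simp [lin]; ring
        exact lin_eq_zero_iff.1 ((mul_eq_zero.1 this).resolve_left hq0))
    have e' : g = q * lin c1 c2 := by rw [e]; simp [lin]; ring
    have hc : ¬ (c1 = 0 ∧ c2 = 0) := by
      intro h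
      apply hg.ne_zero
      rw [e', lin_eq_zero_iff.2 h, mul_zero]
    rw [e'] at hg
    rcases (RR.cancel hc hq hg).di with h | ⟨n', p', u, v, hn, huv, hp', rfl⟩
    · exfalso
      obtain ⟨u, v, huv, hne⟩ := exists_hev_ne hq0 hq
      exact hW (q * lin u v) ⟨q, u, v, h, huv, rfl, hne⟩ (hlin u v)
    · right
      refine Gam_of_real (m := lin u v) (q := p') (lin_ne_zero huv) hp'.ne_zero (natDegree_lin _ _) (hp'.natDegree.trans (by omega)) ?_
      have := hlin u v
      convert this using 1
      ring
  · rcases hg.tri with h | ⟨n', p', u, v, hn, huv, hp', hne, rfl⟩ | ⟨n', p', u, v, hn, huv, hp', rfl⟩ | ⟨n', p', u, v, u', v', hn, huv, huv', hp', rfl⟩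
    · exact (hW g h hga).elim
    · exfalso
      obtain rfl : n' = K + 2 := by omega
      obtain ⟨g2, hg2, h2, h2'⟩ := exists_nonvanish_ker hg.natDegree hg.ne_zero hga (by
        intro q hq hk
        by_contra hne
        exact hA ⟨q, hq, hk, hne⟩) huv
      obtain ⟨ε, hε⟩ := perturb_double huv hp' hne hg2 h2'
      refine hW _ hε ?_
      intro j hj
      have a1 := hga j hj
      have a2 := h2 j hj
      rw [add_mul, Lf_add, mul_assoc (Polynomial.C ε), Lf_C_mul, a2, mul_comm p', a1]; ring
    · right
      refine Gam_of_real (m := lin u v) (q := p') (lin_ne_zero huv) hp'.ne_zero (natDegree_lin _ _) (hp'.natDegree.trans (by omega)) hga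
    · left
      refine Gam_of_real (m := lin u v * lin u' v') (q := p') (mul_ne_zero (lin_ne_zero huv) (lin_ne_zero huv')) hp'.ne_zero
        (natDegree_mul_le' (natDegree_lin _ _) (natDegree_lin _ _)) (hp'.natDegree.trans (by omega)) hga

end EM

namespace EM

/-- the functional as a linear form on coefficient vectors -/
def LfV {d : ℕ} (a : Fin (d+1) → ℝ) : (Fin (d+1) → ℝ) →ₗ[ℝ] ℝ where
  toFun z := Lf d a (toP z)
  map_add' p q := by rw [toP_add, Lf_add]
  map_smul' c p := by rw [toP_smul, Lf_C_mul]; rfl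

def phiL (k : ℕ) (g Q : Polynomial ℝ) : ((Fin k → ℝ) × (Fin k → ℝ)) →ₗ[ℝ] (Fin (2*k+1) → ℝ) where
  toFun := fun r => ofP (2*k+1) (g * toP r.1 + Q * toP r.2)
  map_add' := by
    intro x y
    simp only [Prod.fst_add, Prod.snd_add, toP_add]
    rw [← ofP_add]
    exact congrArg _ (by ring)
  map_smul' := by
    intro c x
    simp only [Prod.smul_fst, Prod.smul_snd, toP_smul, RingHom.id_apply]
    rw [← ofP_C_mul]
    exact congrArg _ (by ring)

lemma phiL_apply (k : ℕ) (g Q : Polynomial ℝ) (r : (Fin k → ℝ) × (Fin k → ℝ)) :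
    phiL k g Q r = ofP (2*k+1) (g * toP r.1 + Q * toP r.2) := rfl

lemma phiL_toP {k : ℕ} (hk : 0 < k) {g Q : Polynomial ℝ} (hg : g.natDegree ≤ k+1) (hQ : Q.natDegree ≤ k+1)
    (r : (Fin k → ℝ) × (Fin k → ℝ)) : toP (phiL k g Q r) = g * toP r.1 + Q * toP r.2 := by
  have h1 := natDegree_toP_lt hk r.1
  have h2 := natDegree_toP_lt hk r.2
  have h3 := natDegree_mul_le' hg (Nat.le_sub_one_of_lt h1)
  have h4 := natDegree_mul_le' hQ (Nat.le_sub_one_of_lt h2)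
  have h5 : (g * toP r.1 + Q * toP r.2).natDegree ≤ 2*k := by
    refine (Polynomial.natDegree_add_le _ _).trans (max_le ?_ ?_) <;> omega
  rw [phiL_apply, toP_ofP _ h5]

lemma coprime_form {k : ℕ} (hk : 1 ≤ k) {g Q : Polynomial ℝ} (hg : g.natDegree = k+1) (hQ : Q.natDegree ≤ k+1)
    (hc : IsCoprime g Q) : ∃ a, apo k a g ∧ apo k a Q ∧ NRI k a := by
  have hg0 : g ≠ 0 := by rintro rfl; simp at hg
  obtain ⟨a, ha, ha0⟩ : ∃ a ∈ LinearMap.ker ((MM k g).mulVecLin.prod (MM k Q).mulVecLin), a ≠ 0 := by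
    apply Submodule.exists_mem_ne_zero_of_ne_bot
    apply LinearMap.ker_ne_bot_of_finrank_lt
    simp
    omega
  rw [LinearMap.mem_ker] at ha
  have hag : apo k a g := by rw [apo_iff_MM]; exact congrArg Prod.fst ha
  have haQ : apo k a Q := by rw [apo_iff_MM]; exact congrArg Prod.snd ha
  refine ⟨a, hag, haQ, ?_⟩
  have hdiv : ∀ B : Polynomial ℝ, B.natDegree < k+1 → g ∣ B → B = 0 := by
    intro B hB hd
    by_contra h0
    have := Polynomial.natDegree_le_of_dvd hd h0
    omega
  set φ := phiL k g Q with hφ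
  have hk0 : 0 < k := hk
  have htoP : ∀ r, toP (φ r) = g * toP r.1 + Q * toP r.2 := phiL_toP hk0 hg.le hQ
  have hinj : Function.Injective φ := by
    rw [← LinearMap.ker_eq_bot, LinearMap.ker_eq_bot']
    intro r hr
    have h1 : g * toP r.1 + Q * toP r.2 = 0 := by rw [← htoP, hr, toP_zero]
    have h2 : toP r.2 = 0 := by
      apply hdiv _ ((natDegree_toP_lt hk0 r.2).trans (by omega))
      apply hc.dvd_of_dvd_mul_left
      exact ⟨- toP r.1, by linear_combination h1⟩
    have h3 : toP r.1 = 0 := by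
      rw [h2, mul_zero, add_zero] at h1
      exact (mul_eq_zero.1 h1).resolve_left hg0
    have h4 : r.1 = 0 := toP_injective (h3.trans toP_zero.symm)
    have h5 : r.2 = 0 := toP_injective (h2.trans toP_zero.symm)
    exact Prod.ext h4 h5
  have hrange : LinearMap.range φ = LinearMap.ker (LfV a) := by
    apply Submodule.eq_of_le_of_finrank_le
    · rintro _ ⟨r, rfl⟩
      rw [LinearMap.mem_ker]
      change Lf (2*k) a (toP (φ r)) = 0
      rw [htoP, Lf_add, apo_mul hag _ (natDegree_toP_lt hk0 _), apo_mul haQ _ (natDegree_toP_lt hk0 _), add_zero]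
    · rw [LinearMap.finrank_range_of_inj hinj]
      have h1 := LinearMap.finrank_range_add_finrank_ker (LfV a)
      have h2 : 1 ≤ Module.finrank ℝ (LinearMap.range (LfV a)) := by
        rw [Nat.one_le_iff_ne_zero]
        intro h0
        rw [Submodule.finrank_eq_zero, LinearMap.range_eq_bot] at h0
        apply ha0
        funext i
        have h3 := LinearMap.congr_fun h0 (ofP (2*k+1) (Polynomial.X ^ (i:ℕ)))
        change Lf (2*k) a (toP (ofP (2*k+1) (Polynomial.X ^ (i:ℕ)))) = 0 at h3
        rw [toP_ofP _ (by rw [Polynomial.natDegree_X_pow]; omega), Lf_X_pow] at h3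
        exact (mul_eq_zero.1 h3).resolve_left (wt_ne_zero _ _)
      simp at h1 ⊢
      omega
  apply NRI_of hk
  intro q hq hqa
  have hex : ∀ j ≤ k+1, ∃ r : (Fin k → ℝ) × (Fin k → ℝ), q * Polynomial.X ^ j = g * toP r.1 + Q * toP r.2 := by
    intro j hj
    have hd : (q * Polynomial.X ^ j).natDegree ≤ 2 * k := by
      have := natDegree_mul_le' hq (Polynomial.natDegree_X_pow_le (R := ℝ) j)
      omega
    have : ofP (2*k+1) (q * Polynomial.X ^ j) ∈ LinearMap.range φ := by
      rw [hrange, LinearMap.mem_ker]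
      change Lf (2*k) a (toP (ofP (2*k+1) (q * Polynomial.X ^ j))) = 0
      rw [toP_ofP _ hd, hqa j hj]
    obtain ⟨r, hr⟩ := this
    exact ⟨r, by rw [← htoP, hr, toP_ofP _ hd]⟩
  obtain ⟨r0, hr0⟩ := hex 0 (by omega)
  rw [pow_zero, mul_one] at hr0
  have hind : ∀ j ≤ k+1, ∃ A : Polynomial ℝ, (Polynomial.X ^ j * toP r0.2).natDegree < k ∧ q * Polynomial.X ^ j = g * A + Q * (Polynomial.X ^ j * toP r0.2) := by
    intro j
    induction j with
    | zero => intro _; exact ⟨toP r0.1, by simpa using natDegree_toP_lt hk0 _, by simpa using hr0⟩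
    | succ j ih =>
      intro hj
      obtain ⟨A, h1, h2⟩ := ih (by omega)
      obtain ⟨r, hr⟩ := hex (j+1) hj
      have hlt := natDegree_toP_lt hk0 r.2
      have h3 : toP r.2 - Polynomial.X ^ (j+1) * toP r0.2 = 0 := by
        apply hdiv
        · have h4 : (Polynomial.X ^ (j+1) * toP r0.2).natDegree ≤ 1 + (k-1) := by
            rw [show Polynomial.X ^ (j+1) * toP r0.2 = Polynomial.X * (Polynomial.X ^ j * toP r0.2) by ring]
            exact natDegree_mul_le' Polynomial.natDegree_X_le (by omega)
          refine lt_of_le_of_lt (Polynomial.natDegree_sub_le _ _) (max_lt ?_ ?_) <;> omega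
        · apply hc.dvd_of_dvd_mul_left
          exact ⟨A * Polynomial.X - toP r.1, by linear_combination Polynomial.X * h2 - hr⟩
      rw [sub_eq_zero] at h3
      exact ⟨toP r.1, by rw [← h3]; exact hlt, by rw [← h3]; exact hr⟩
  obtain ⟨_, h1, _⟩ := hind (k+1) le_rfl
  have h2 : toP r0.2 = 0 := by
    by_contra h0
    rw [Polynomial.natDegree_X_pow_mul _ h0] at h1
    omega
  apply hdiv q (by omega)
  exact ⟨toP r0.1, by rw [hr0, h2]; ring⟩

end EM

namespace EM

/-- the one-parameter family of kernel forms -/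
def gt (c : ℕ) (m q : Polynomial ℝ) (τ : ℝ) : Polynomial ℝ := (m ^ 2 + Polynomial.C τ) * m ^ c * q

lemma gt_zero (c : ℕ) (m q : Polynomial ℝ) : gt c m q 0 = m ^ (c+2) * q := by
  unfold gt; rw [Polynomial.C_0]; ring

lemma natDegree_gt {c dm dq k : ℕ} (h : Par c dm dq k) {m q : Polynomial ℝ} (hm : m.natDegree ≤ dm) (hq : q.natDegree ≤ dq) (τ : ℝ) :
    (gt c m q τ).natDegree ≤ k + 1 := by
  have h3 := h.h3
  have e1 : (m ^ 2 + Polynomial.C τ).natDegree ≤ 2 * dm := by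
    refine (Polynomial.natDegree_add_le _ _).trans (max_le ?_ (by simp))
    exact Polynomial.natDegree_pow_le.trans (Nat.mul_le_mul_left _ hm)
  have e2 : (m ^ c).natDegree ≤ c * dm := Polynomial.natDegree_pow_le.trans (Nat.mul_le_mul_left _ hm)
  have := natDegree_mul_le' (natDegree_mul_le' e1 e2) hq
  have e : (c+2)*dm = 2 * dm + c * dm := by ring
  unfold gt
  omega

lemma CP.gt {X : Type} [TopologicalSpace X] {F G : X → Polynomial ℝ} {f : X → ℝ} (c : ℕ) (hF : CP F) (hG : CP G) (hf : Continuous f) :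
    CP fun x => EM.gt c (F x) (G x) (f x) :=
  (((hF.pow 2).add (CP.C hf)).mul (hF.pow c)).mul hG

lemma CP.MM {X : Type} [TopologicalSpace X] {F : X → Polynomial ℝ} (k : ℕ) (hF : CP F) : Continuous fun x => EM.MM k (F x) :=
  continuous_matrix fun i j => continuous_const.mul ((hF.mul (CP.const _)) _)

abbrev WR (dm dq k : ℕ) : Type := (Fin (dm+1) → ℝ) × (Fin (dq+1) → ℝ) × (Fin (2*k+1) → ℝ) × (Fin (2*k+1) → Fin k → ℝ)

def Hf (c : ℕ) {dm dq k : ℕ} (x : WR dm dq k × ℝ) : Fin (2*k+1) → ℝ :=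
  kerProj (MM k (gt c (toP x.1.1) (toP x.1.2.1) x.2)) (Matrix.of x.1.2.2.2) x.1.2.2.1

lemma continuous_Hf (c : ℕ) {dm dq k : ℕ} : Continuous fun x : WR dm dq k × ℝ => Hf c x := by
  unfold Hf
  apply continuous_kerProj
  · exact (CP.gt c (CP.toP (by fun_prop)) (CP.toP (by fun_prop)) (by fun_prop)).MM k
  · exact continuous_matrix fun i j => by simp only [Matrix.of_apply]; fun_prop
  · fun_prop

lemma apo_Hf (c : ℕ) {dm dq k : ℕ} (x : WR dm dq k × ℝ) : apo k (Hf c x) (gt c (toP x.1.1) (toP x.1.2.1) x.2) := by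
  rw [apo_iff_MM]; exact mulVec_kerProj _ _ _

/-- the nonexistence condition -/
def Non (n : ℕ) (A Q : Polynomial ℝ) : Prop := ∀ c1 c2 t : ℝ, ∀ w ∈ Kw n,
  Polynomial.C c1 * A + Polynomial.C c2 * Q = Polynomial.C t * gw w → c1 = 0 ∧ c2 = 0 ∧ t = 0

lemma boundary_real {c dm dq k : ℕ} (h : Par c dm dq k) (m0 : Fin (dm+1) → ℝ) (q0 : Fin (dq+1) → ℝ) (Q0 : Fin (k+2) → ℝ)
    (hm0 : (toP m0).natDegree = dm) (hq0 : (toP q0).natDegree = dq) (hm00 : toP m0 ≠ 0) (hq00 : toP q0 ≠ 0)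
    (h1 : ∀ᶠ x : (Fin (dm+1) → ℝ) × (Fin (dq+1) → ℝ) × (Fin (k+2) → ℝ) × ℝ in nhds (m0, q0, Q0, 0),
      0 < x.2.2.2 → Non (k+1) (gt c (toP x.1) (toP x.2.1) x.2.2.2) (toP x.2.2.1))
    (h2 : ∀ᶠ x : (Fin (dm+1) → ℝ) × (Fin (dq+1) → ℝ) × ℝ in nhds (m0, q0, 0),
      x.2.2 < 0 → DR (k+1) (gt c (toP x.1) (toP x.2.1) x.2.2))
    (h3 : ∃ᶠ Q in nhds Q0, IsCoprime (toP m0 ^ (c+2) * toP q0) (toP Q)) :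
    ∃ w0 : WR dm dq k, ∀ᶠ w in nhds w0, Hf c (w, 0) ∈ topBoundary (2*k) (k+1) := by
  have hk : 1 ≤ k := by have := h.h1; omega
  have h1' : ∀ᶠ Q in nhds Q0, ∀ᶠ x : (Fin (dm+1) → ℝ) × (Fin (dq+1) → ℝ) × (Fin (k+2) → ℝ) × ℝ in nhds (m0, q0, Q, 0),
      0 < x.2.2.2 → Non (k+1) (gt c (toP x.1) (toP x.2.1) x.2.2.2) (toP x.2.2.1) := by
    have hc : Continuous fun Q : Fin (k+2) → ℝ => (m0, q0, Q, (0:ℝ)) := by fun_prop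
    exact (hc.tendsto Q0).eventually h1.eventually_nhds
  obtain ⟨Q1, hcop, h1⟩ := (h3.and_eventually h1').exists
  have hdeg : (toP m0 ^ (c+2) * toP q0).natDegree = k+1 := by
    rw [Polynomial.natDegree_mul (pow_ne_zero _ hm00) hq00, Polynomial.natDegree_pow, hm0, hq0, h.h3]
  obtain ⟨a, ha1, ha2, ha3⟩ := coprime_form hk hdeg (natDegree_toP Q1) hcop
  obtain ⟨S1, hS1⟩ := id ha3
  obtain ⟨S0, hS0⟩ := MM_rightInv k _ (mul_ne_zero (pow_ne_zero (c+2) hm00) hq00) hdeg.le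
  let w0 : WR dm dq k := (m0, q0, a, fun i j => S0 i j)
  have hH0 : Hf c (w0, 0) = a := by
    unfold Hf
    simp only [w0, gt_zero]
    exact kerProj_eq _ _ _ hS0 ((apo_iff_MM _ _ _).1 ha1)
  have hcH := continuous_Hf c (dm := dm) (dq := dq) (k := k)
  have e1 : ∀ᶠ x in nhds (w0, (0:ℝ)), NRI k (Hf c x) := by
    apply (hcH.tendsto _).eventually
    rw [hH0]
    exact (isOpen_NRI k).eventually_mem ha3
  have e2 : ∀ᶠ x : WR dm dq k × ℝ in nhds (w0, (0:ℝ)), x.2 < 0 → DR (k+1) (gt c (toP x.1.1) (toP x.1.2.1) x.2) := by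
    have hc : Continuous fun x : WR dm dq k × ℝ => (x.1.1, x.1.2.1, x.2) := by fun_prop
    exact (hc.tendsto (w0, (0:ℝ))).eventually h2
  have e3 : ∀ᶠ x : WR dm dq k × ℝ in nhds (w0, (0:ℝ)), 0 < x.2 → Non (k+1) (gt c (toP x.1.1) (toP x.1.2.1) x.2)
      (toP (kerProj (NN k (Hf c x)) S1 Q1)) := by
    have hc : Continuous fun x : WR dm dq k × ℝ => (x.1.1, x.1.2.1, kerProj (NN k (Hf c x)) S1 Q1, x.2) := by
      have := continuous_kerProj (continuous_HN.comp hcH : Continuous fun x : WR dm dq k × ℝ => NN k (Hf c x)) (continuous_const (y := S1)) (continuous_const (y := Q1))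
      fun_prop
    have ht := hc.tendsto (w0, (0:ℝ))
    have : kerProj (NN k (Hf c (w0, 0))) S1 Q1 = Q1 := by
      rw [hH0]
      exact kerProj_eq _ _ _ hS1 ((apo_iff_NN _ _).1 ha2)
    rw [this] at ht
    exact ht.eventually h1
  have e4 : ∀ᶠ x : WR dm dq k × ℝ in nhds (w0, (0:ℝ)), (x.2 < 0 → Hf c x ∈ interior (closure (Rdr (2*k) (k+1)))) ∧
      (0 < x.2 → Hf c x ∉ closure (Rdr (2*k) (k+1))) := by
    filter_upwards [e1, e2, e3] with x f1 f2 f3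
    refine ⟨fun hx => Wint hk (f2 hx) (apo_Hf c x) f1, fun hx hcl => ?_⟩
    obtain ⟨g, hg, hga⟩ := closure_RR hk hcl
    have hN := f3 hx
    obtain ⟨w', hw'⟩ : ∃ w', w' ∈ Kw (k+1) := ⟨fun _ => (1, 0), fun _ _ => by simp⟩
    obtain ⟨c1, c2, hc⟩ := f1.pencil (natDegree_gt h (natDegree_toP _) (natDegree_toP _) x.2) (natDegree_toP _) hg.natDegree
      (apo_Hf c x) ((apo_iff_NN (Hf c x) _).2 (mulVec_kerProj _ S1 Q1)) hga (fun c1 c2 h0 => by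
        have := hN c1 c2 0 w' hw' (by rw [h0]; simp)
        exact ⟨this.1, this.2.1⟩)
    obtain ⟨t, ht, w, hw, rfl⟩ := RR_iff_gw.1 hg
    exact ht (hN c1 c2 t w hw hc.symm).2.2
  refine ⟨w0, ?_⟩
  have e5 := e4.curry_nhds
  filter_upwards [e5] with w hw
  have hcw : Filter.Tendsto (fun τ : ℝ => Hf c (w, τ)) (nhds 0) (nhds (Hf c (w, 0))) :=
    (hcH.comp (Continuous.prodMk_right w)).tendsto 0
  constructor
  · have : Hf c (w, 0) ∈ closure (closure (Rdr (2*k) (k+1))) := by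
      apply mem_closure_of_tendsto (hcw.mono_left (nhdsWithin_le_nhds (s := Set.Iio 0)))
      filter_upwards [hw.filter_mono nhdsWithin_le_nhds, self_mem_nhdsWithin] with τ hτ hτ0
      exact interior_subset (hτ.1 hτ0)
    rwa [closure_closure] at this
  · intro hin
    have f1 := hcw.eventually (isOpen_interior.eventually_mem hin)
    have : ∀ᶠ τ : ℝ in nhdsWithin 0 (Set.Ioi 0), False := by
      filter_upwards [hw.filter_mono nhdsWithin_le_nhds, f1.filter_mono nhdsWithin_le_nhds, self_mem_nhdsWithin] with τ hτ hτ1 hτ0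
      exact hτ.2 hτ0 (interior_subset hτ1)
    exact (Filter.eventually_false_iff_eq_bot.1 this) |> (inferInstance : (nhdsWithin (0:ℝ) (Set.Ioi 0)).NeBot).ne

abbrev WC (dm dq k : ℕ) : Type := (Fin (dm+1) → ℂ) × (Fin (dq+1) → ℂ) × (Fin (2*k+1) → ℂ) × (Fin (2*k+1) → Fin k → ℂ)

def Hc (c : ℕ) {dm dq k : ℕ} (x : WC dm dq k) : Fin (2*k+1) → ℂ :=
  kerProj (MM k (toP x.1 ^ (c+2) * toP x.2.1)) (Matrix.of x.2.2.2) x.2.2.1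

def iotaW {dm dq k : ℕ} (x : WR dm dq k) : WC dm dq k :=
  (cx x.1, cx x.2.1, cx x.2.2.1, fun i j => ((x.2.2.2 i j : ℝ) : ℂ))

lemma cx_apply {n : ℕ} (a : Fin n → ℝ) (i : Fin n) : cx a i = ((a i : ℝ) : ℂ) := rfl

lemma kerProj_map {k n : ℕ} (N : Matrix (Fin k) (Fin n) ℝ) (S : Matrix (Fin n) (Fin k) ℝ) (z : Fin n → ℝ) :
    kerProj (N.map Complex.ofRealHom) (S.map Complex.ofRealHom) (cx z) = cx (kerProj N S z) := by
  unfold kerProj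
  have hz : cx z = Complex.ofRealHom ∘ z := rfl
  have e1 : ∀ {a b : ℕ} (M : Matrix (Fin a) (Fin b) ℝ) (v : Fin b → ℝ), (M.map Complex.ofRealHom).mulVec (Complex.ofRealHom ∘ v) = Complex.ofRealHom ∘ (M.mulVec v) := by
    intro a b M v
    funext i
    exact (RingHom.map_mulVec Complex.ofRealHom M v i).symm
  rw [← Matrix.map_mul, hz, e1]
  have e2 : ((N * S).map Complex.ofRealHom).adjugate = (N * S).adjugate.map Complex.ofRealHom :=
    (RingHom.map_adjugate Complex.ofRealHom (N * S)).symm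
  have e3 : ((N * S).map Complex.ofRealHom).det = Complex.ofRealHom (N * S).det :=
    (RingHom.map_det Complex.ofRealHom (N * S)).symm
  rw [e2, e1, e1, e3]
  funext i
  simp only [Pi.sub_apply, Pi.smul_apply, Function.comp_apply, smul_eq_mul, cx_apply, Complex.ofRealHom_eq_coe, Complex.ofReal_sub, Complex.ofReal_mul]

lemma MM_map (k : ℕ) (p : Polynomial ℝ) : MM k (mapC p) = (MM k p).map Complex.ofRealHom := by
  ext i j
  simp only [MM, Matrix.map_apply, map_mul]
  have e1 : wt ℂ (2*k) j = Complex.ofRealHom (wt ℝ (2*k) j) := by simp [wt]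
  have e2 : mapC p * Polynomial.X ^ (i:ℕ) = (p * Polynomial.X ^ (i:ℕ)).map Complex.ofRealHom := by
    simp [mapC]
  rw [e1, e2, Polynomial.coeff_map]

lemma Hc_iota (c : ℕ) {dm dq k : ℕ} (x : WR dm dq k) : Hc c (iotaW x) = cx (Hf c (x, 0)) := by
  unfold Hc Hf
  rw [← kerProj_map, gt_zero, ← MM_map]
  have e1 : toP (iotaW x).1 = mapC (toP x.1) := by rw [mapC, map_toP Complex.ofRealHom x.1]; rfl
  have e2 : toP (iotaW x).2.1 = mapC (toP x.2.1) := by rw [mapC, map_toP Complex.ofRealHom x.2.1]; rfl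
  have e3 : mapC (toP x.1 ^ (c+2) * toP x.2.1) = mapC (toP x.1) ^ (c+2) * mapC (toP x.2.1) := by
    simp only [mapC, Polynomial.map_mul, Polynomial.map_pow]
  rw [e1, e2, e3]
  rfl

lemma LP_kp {V : Type} [AddCommGroup V] [Module ℂ V] (c : ℕ) {dm dq k : ℕ} {f1 : V → Fin (dm+1) → ℂ} {f2 : V → Fin (dq+1) → ℂ}
    {f3 : V → Fin (2*k+1) → ℂ} {f4 : V → Matrix (Fin (2*k+1)) (Fin k) ℂ}
    (h1 : ∀ i, LP fun x => f1 x i) (h2 : ∀ i, LP fun x => f2 x i) (h3 : ∀ i, LP fun x => f3 x i) (h4 : ∀ i j, LP fun x => f4 x i j)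
    (p : MvPolynomial (Fin (2*k+1)) ℂ) :
    LP (fun x : V => MvPolynomial.eval (kerProj (MM k (toP (f1 x) ^ (c+2) * toP (f2 x))) (f4 x) (f3 x)) p) := by
  apply LP.eval
  intro i
  refine LP.kerProj (fun i j => LPP.MM ?_ i j) h4 h3 i
  exact ((LPP.toP h1).pow _).mul (LPP.toP h2)

lemma LP_Hc (c : ℕ) {dm dq k : ℕ} (p : MvPolynomial (Fin (2*k+1)) ℂ) :
    LP (fun x : WC dm dq k => MvPolynomial.eval (Hc c x) p) := by
  unfold Hc
  refine LP_kp c (V := WC dm dq k) (f1 := fun x => x.1) (f2 := fun x => x.2.1) (f3 := fun x => x.2.2.1) (f4 := fun x => Matrix.of x.2.2.2) ?_ ?_ ?_ ?_ p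
  · intro i a b
    exact ⟨Polynomial.C (a.1 i) + Polynomial.C (b.1 i) * Polynomial.X, fun t => by simp [mul_comm t]⟩
  · intro i a b
    exact ⟨Polynomial.C (a.2.1 i) + Polynomial.C (b.2.1 i) * Polynomial.X, fun t => by simp [mul_comm t]⟩
  · intro i a b
    exact ⟨Polynomial.C (a.2.2.1 i) + Polynomial.C (b.2.2.1 i) * Polynomial.X, fun t => by simp [mul_comm t]⟩
  · intro i j a b
    exact ⟨Polynomial.C (a.2.2.2 i j) + Polynomial.C (b.2.2.2 i j) * Polynomial.X, fun t => by simp [mul_comm t]⟩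

lemma Gam_subset {c dm dq k : ℕ} (h : Par c dm dq k)
    (hw : ∃ w0 : WR dm dq k, ∀ᶠ w in nhds w0, Hf c (w, 0) ∈ topBoundary (2*k) (k+1)) :
    Gam c dm dq k ⊆ zClosure (cx '' topBoundary (2*k) (k+1)) := by
  obtain ⟨w0, hw0⟩ := hw
  rintro a ⟨m, q, hm, hq, hdm, hdq, ha⟩ p hp
  have hdeg : (m ^ (c+2) * q).natDegree ≤ k+1 := by
    have e2 : (m ^ (c+2)).natDegree ≤ (c+2) * dm := Polynomial.natDegree_pow_le.trans (Nat.mul_le_mul_left _ hdm)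
    have := natDegree_mul_le' e2 hdq
    rwa [h.h3] at this
  obtain ⟨S, hS⟩ := MM_rightInv k _ (mul_ne_zero (pow_ne_zero (c+2) hm) hq) hdeg
  have key := LP.realpts (iotaW (dm := dm) (dq := dq) (k := k)) ?_ ?_ ?_ (LP_Hc c p) w0 ?_ (ofP (dm+1) m, ofP (dq+1) q, a, fun i j => S i j)
  · have e : Hc c (ofP (dm+1) m, ofP (dq+1) q, a, fun i j => S i j) = a := by
      unfold Hc
      simp only
      rw [toP_ofP _ hdm, toP_ofP _ hdq]
      exact kerProj_eq _ _ _ hS ((apo_iff_MM _ _ _).1 ha)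
    rwa [e] at key
  · intro a b
    simp only [iotaW]
    ext <;> simp [cx_apply]
  · intro t a
    simp only [iotaW]
    ext <;> simp [cx_apply]
  · intro x
    refine ⟨(fun i => (x.1 i).re, fun i => (x.2.1 i).re, fun i => (x.2.2.1 i).re, fun i j => (x.2.2.2 i j).re),
      (fun i => (x.1 i).im, fun i => (x.2.1 i).im, fun i => (x.2.2.1 i).im, fun i j => (x.2.2.2 i j).im), ?_⟩
    simp only [iotaW]
    ext <;> simp [cx_apply, mul_comm Complex.I, Complex.re_add_im]
  · filter_upwards [hw0] with w hw
    rw [Hc_iota]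
    exact hp _ ⟨_, hw, rfl⟩

end EM

namespace EM

lemma CP.eventually_ne {X : Type} [TopologicalSpace X] {F : X → Polynomial ℝ} (hF : CP F) {x0 : X} (h : F x0 ≠ 0) :
    ∀ᶠ x in nhds x0, F x ≠ 0 := by
  obtain ⟨i, hi⟩ : ∃ i, (F x0).coeff i ≠ 0 := by
    by_contra hcon
    push Not at hcon
    exact h (Polynomial.ext fun i => by rw [hcon i, Polynomial.coeff_zero])
  filter_upwards [(hF i).continuousAt.eventually_ne hi] with x hx h0
  exact hx (by rw [h0, Polynomial.coeff_zero])

/-- compact set of normalized coefficient triples -/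
def K3 : Set (ℝ × ℝ × ℝ) := {y | y.1 ^ 2 + y.2.1 ^ 2 + y.2.2 ^ 2 = 1}

lemma isCompact_K3 : IsCompact K3 := by
  apply Metric.isCompact_of_isClosed_isBounded
  · exact isClosed_eq (by fun_prop) continuous_const
  · refine (Metric.isBounded_closedBall (x := (0 : ℝ × ℝ × ℝ)) (r := 1)).subset ?_
    intro y hy
    have hy : y.1 ^ 2 + y.2.1 ^ 2 + y.2.2 ^ 2 = 1 := hy
    rw [mem_closedBall_zero_iff, Prod.norm_def, Prod.norm_def]
    refine max_le ?_ (max_le ?_ ?_) <;> rw [Real.norm_eq_abs] <;> apply abs_le_one_iff_mul_self_le_one.2 <;>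
      nlinarith [sq_nonneg y.1, sq_nonneg y.2.1, sq_nonneg y.2.2]

/-- the pencil relation -/
def Rel {n : ℕ} (A Q : Polynomial ℝ) (y : ℝ × ℝ × ℝ) (w : Fin n → ℝ × ℝ) : Prop :=
  Polynomial.C y.1 * A + Polynomial.C y.2.1 * Q = Polynomial.C y.2.2 * gw w

lemma Non_eventually {X : Type} [TopologicalSpace X] {n : ℕ} {A Q : X → Polynomial ℝ} (hA : CP A) (hQ : CP Q) {x0 : X} {P : X → Prop}
    (hind : ∀ c1 c2 : ℝ, Polynomial.C c1 * A x0 + Polynomial.C c2 * Q x0 = 0 → c1 = 0 ∧ c2 = 0)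
    (hbase : ∀ c1 c2 : ℝ, c2 ≠ 0 → ¬ RR n (Polynomial.C c1 * A x0 + Polynomial.C c2 * Q x0))
    (hloc : ∀ w ∈ Kw n, ∀ c1 t : ℝ, c1 ≠ 0 → t ≠ 0 → Polynomial.C c1 * A x0 = Polynomial.C t * gw w →
      ∀ᶠ z : X × (ℝ × ℝ × ℝ) × (Fin n → ℝ × ℝ) in nhds (x0, (c1, 0, t), w), P z.1 → ¬ Rel (A z.1) (Q z.1) z.2.1 z.2.2) :
    ∀ᶠ x in nhds x0, P x → Non n (A x) (Q x) := by
  have key : ∀ᶠ x in nhds x0, ∀ y ∈ K3 ×ˢ Kw n, P x → ¬ Rel (A x) (Q x) y.1 y.2 := by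
    apply (isCompact_K3.prod (isCompact_Kw n)).eventually_forall_of_forall_eventually (x₀ := x0)
      (P := fun x y => P x → ¬ Rel (A x) (Q x) y.1 y.2)
    rintro ⟨y, w⟩ ⟨hy, hw⟩
    have hy : y.1 ^ 2 + y.2.1 ^ 2 + y.2.2 ^ 2 = 1 := hy
    have hw : w ∈ Kw n := hw
    by_cases hrel : Rel (A x0) (Q x0) y w
    · have ht : y.2.2 ≠ 0 := by
        intro ht
        unfold Rel at hrel
        rw [ht, Polynomial.C_0, zero_mul] at hrel
        obtain ⟨h1, h2⟩ := hind _ _ hrel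
        rw [h1, h2, ht] at hy
        norm_num at hy
      have h2 : y.2.1 = 0 := by
        by_contra h2
        apply hbase y.1 y.2.1 h2
        rw [hrel]
        exact RR_iff_gw.2 ⟨_, ht, w, hw, rfl⟩
      have hrel' : Polynomial.C y.1 * A x0 = Polynomial.C y.2.2 * gw w := by
        have := hrel
        unfold Rel at this
        rwa [h2, Polynomial.C_0, zero_mul, add_zero] at this
      have h1 : y.1 ≠ 0 := by
        intro h1
        rw [h1, Polynomial.C_0, zero_mul] at hrel'
        have := (mul_eq_zero.1 hrel'.symm).resolve_left (by simpa using ht)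
        exact (RR_gw hw).ne_zero this
      have := hloc w hw y.1 y.2.2 h1 ht hrel'
      have hyy : y = (y.1, 0, y.2.2) := by rw [← h2]
      rw [← hyy] at this
      exact this
    · have hc : CP fun z : X × (ℝ × ℝ × ℝ) × (Fin n → ℝ × ℝ) =>
          (Polynomial.C z.2.1.1 * A z.1 + Polynomial.C z.2.1.2.1 * Q z.1) - Polynomial.C z.2.1.2.2 * gw z.2.2 := by
        refine CP.sub (CP.add (CP.mul (CP.C (by fun_prop)) fun i => (hA i).comp continuous_fst)
          (CP.mul (CP.C (by fun_prop)) fun i => (hQ i).comp continuous_fst)) (CP.mul (CP.C (by fun_prop)) fun i => (CP_gw i).comp (by fun_prop))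
      filter_upwards [hc.eventually_ne (x0 := (x0, y, w)) (by rw [sub_ne_zero]; exact hrel)] with z hz _
      rw [sub_ne_zero] at hz
      exact hz
  filter_upwards [key] with x hx hP c1 c2 t w hw hr
  by_contra hcon
  have hpos : 0 < c1 ^ 2 + c2 ^ 2 + t ^ 2 := by
    rcases eq_or_ne c1 0 with h1 | h1
    · rcases eq_or_ne c2 0 with h2 | h2
      · rcases eq_or_ne t 0 with h3 | h3
        · exact absurd ⟨h1, h2, h3⟩ hcon
        · positivity
      · positivity
    · positivity
  set r := Real.sqrt (c1 ^ 2 + c2 ^ 2 + t ^ 2) with hrdef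
  have hr0 : r ≠ 0 := (Real.sqrt_pos.2 hpos).ne'
  have hr2 : r ^ 2 = c1 ^ 2 + c2 ^ 2 + t ^ 2 := Real.sq_sqrt hpos.le
  apply hx ((r⁻¹ * c1, r⁻¹ * c2, r⁻¹ * t), w) ⟨?_, hw⟩ hP
  · unfold Rel
    simp only [Polynomial.C_mul]
    linear_combination Polynomial.C r⁻¹ * hr
  · change (r⁻¹ * c1) ^ 2 + (r⁻¹ * c2) ^ 2 + (r⁻¹ * t) ^ 2 = 1
    field_simp
    linarith

lemma gw_eval {n : ℕ} (w : Fin n → ℝ × ℝ) (x : ℝ) : (gw w).eval x = ∏ i, ((w i).1 + (w i).2 * x) := by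
  simp [gw, Polynomial.eval_prod, lin]

lemma gw_root {n : ℕ} {w : Fin n → ℝ × ℝ} {x : ℝ} (h : (gw w).eval x = 0) : ∃ i, (w i).1 + (w i).2 * x = 0 := by
  rw [gw_eval, Finset.prod_eq_zero_iff] at h
  obtain ⟨i, _, hi⟩ := h
  exact ⟨i, hi⟩

lemma gw_eval_root {n : ℕ} {w : Fin n → ℝ × ℝ} {i : Fin n} (hi : (w i).2 ≠ 0) : (gw w).eval (-(w i).1 / (w i).2) = 0 := by
  rw [gw_eval]
  apply Finset.prod_eq_zero (Finset.mem_univ i)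
  field_simp
  ring

lemma gw_two {n : ℕ} (w : Fin n → ℝ × ℝ) {i j : Fin n} (hij : i ≠ j) : ∃ p, gw w = lin (w i).1 (w i).2 * lin (w j).1 (w j).2 * p := by
  refine ⟨∏ l ∈ (Finset.univ.erase i).erase j, lin (w l).1 (w l).2, ?_⟩
  rw [mul_assoc, Finset.mul_prod_erase (Finset.univ.erase i) (fun l => lin (w l).1 (w l).2) (by simp [hij.symm]),
    Finset.mul_prod_erase Finset.univ (fun l => lin (w l).1 (w l).2) (Finset.mem_univ i)]
  rfl

lemma gw_double {n : ℕ} {w : Fin n → ℝ × ℝ} {s : Polynomial ℝ} (h : gw w = Polynomial.X ^ 2 * s) (hw : w ∈ Kw n) :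
    ∃ i j, i ≠ j ∧ (w i).1 = 0 ∧ (w j).1 = 0 := by
  obtain ⟨i, hi⟩ := gw_root (w := w) (x := 0) (by rw [h]; simp)
  have hi : (w i).1 = 0 := by simpa using hi
  have hv : (w i).2 ≠ 0 := by
    intro h0
    have := hw i trivial
    simp only [Set.mem_setOf_eq] at this
    rw [hi, h0] at this
    norm_num at this
  have e : gw w = lin (w i).1 (w i).2 * ∏ l ∈ Finset.univ.erase i, lin (w l).1 (w l).2 :=
    (Finset.mul_prod_erase _ _ (Finset.mem_univ i)).symm
  have e2 : Polynomial.X * (Polynomial.X * s) = Polynomial.X * (Polynomial.C (w i).2 * ∏ l ∈ Finset.univ.erase i, lin (w l).1 (w l).2) := by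
    have : lin (w i).1 (w i).2 = Polynomial.C (w i).2 * Polynomial.X := by rw [hi]; simp [lin]
    rw [this, h] at e
    linear_combination e
  have e3 := mul_left_cancel₀ Polynomial.X_ne_zero e2
  have e4 := congrArg (Polynomial.eval 0) e3
  simp only [Polynomial.eval_mul, Polynomial.eval_X, zero_mul, Polynomial.eval_C, Polynomial.eval_prod] at e4
  have e5 := (mul_eq_zero.1 e4.symm).resolve_left hv
  rw [Finset.prod_eq_zero_iff] at e5
  obtain ⟨j, hj, hj0⟩ := e5
  exact ⟨i, j, (Finset.ne_of_mem_erase hj).symm, hi, by simpa [lin] using hj0⟩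

lemma RR.cancel_DR {n m : ℕ} {p q : Polynomial ℝ} (hq : DR m q) (hp : p.natDegree ≤ n) (h : RR (n+m) (p * q)) : RR n p := by
  induction m generalizing q with
  | zero =>
    obtain ⟨c, hc, rfl⟩ := hq
    have := h.smul (c := c⁻¹) (inv_ne_zero hc)
    rwa [mul_comm p, ← mul_assoc, ← Polynomial.C_mul, inv_mul_cancel₀ hc, Polynomial.C_1, one_mul] at this
  | succ m ih =>
    obtain ⟨q', u, v, h1, h2, rfl, h3⟩ := hq
    rw [← mul_assoc] at h
    exact ih h1 (RR.cancel (n := n+m) h2 (natDegree_mul_le' hp h1.natDegree) h)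

lemma nocommon_eventually {X : Type} [TopologicalSpace X] {F G : X → Polynomial ℝ} (n m : ℕ) (hF : CP F) (hG : CP G) {x0 : X}
    (h : ∀ x y : ℝ, ¬ (x = 0 ∧ y = 0) → hev m (G x0) x y = 0 → hev n (F x0) x y ≠ 0) :
    ∀ᶠ z in nhds x0, ∀ x y : ℝ, ¬ (x = 0 ∧ y = 0) → hev m (G z) x y = 0 → hev n (F z) x y ≠ 0 := by
  have key : ∀ᶠ z in nhds x0, ∀ y ∈ Metric.sphere (0 : ℝ × ℝ) 1, ¬ (hev m (G z) y.1 y.2 = 0 ∧ hev n (F z) y.1 y.2 = 0) := by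
    apply (isCompact_sphere (0 : ℝ × ℝ) 1).eventually_forall_of_forall_eventually (x₀ := x0)
      (P := fun z y => ¬ (hev m (G z) y.1 y.2 = 0 ∧ hev n (F z) y.1 y.2 = 0))
    intro y hy
    have hy0 : ¬ (y.1 = 0 ∧ y.2 = 0) := by
      rintro ⟨h1, h2⟩
      have : y = 0 := Prod.ext h1 h2
      rw [this] at hy; simp at hy
    have c1 : Continuous fun z : X × (ℝ × ℝ) => hev m (G z.1) z.2.1 z.2.2 :=
      CP.hev (F := fun z : X × (ℝ × ℝ) => G z.1) (fun i => (hG i).comp continuous_fst) m (by fun_prop) (by fun_prop)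
    have c2 : Continuous fun z : X × (ℝ × ℝ) => hev n (F z.1) z.2.1 z.2.2 :=
      CP.hev (F := fun z : X × (ℝ × ℝ) => F z.1) (fun i => (hF i).comp continuous_fst) n (by fun_prop) (by fun_prop)
    by_cases h0 : hev m (G x0) y.1 y.2 = 0
    · filter_upwards [c2.continuousAt.eventually_ne (x := (x0, y)) (h _ _ hy0 h0)] with z hz hcon
      exact hz hcon.2
    · filter_upwards [c1.continuousAt.eventually_ne (x := (x0, y)) h0] with z hz hcon
      exact hz hcon.1
  filter_upwards [key] with z hz x y hxy h1 h2
  set r := ‖(x, y)‖ with hr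
  have hr0 : r ≠ 0 := by
    rw [hr, norm_ne_zero_iff]
    intro h0
    exact hxy ⟨congrArg Prod.fst h0, congrArg Prod.snd h0⟩
  apply hz (r⁻¹ * x, r⁻¹ * y)
  · rw [mem_sphere_zero_iff_norm]
    have : (r⁻¹ * x, r⁻¹ * y) = r⁻¹ • (x, y) := rfl
    rw [this, norm_smul, norm_inv, ← hr, hr, norm_norm, ← hr, inv_mul_cancel₀ hr0]
  · simp only [hev_smul, h1, h2, mul_zero, and_self]

end EM

namespace EM

/-- sign condition for `τ < 0` -/
lemma DR_gt_eventually {c dm dq k : ℕ} (h : Par c dm dq k) (hc : c ≤ 1) {m0 q0 : Polynomial ℝ} (hm : DR dm m0) (hq : DR dq q0)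
    (hlead : m0.coeff dm ≠ 0)
    (hno : ∀ x y : ℝ, ¬ (x = 0 ∧ y = 0) → hev dq q0 x y = 0 → hev dm m0 x y ≠ 0) :
    ∀ᶠ x : (Fin (dm+1) → ℝ) × (Fin (dq+1) → ℝ) × ℝ in nhds (ofP (dm+1) m0, ofP (dq+1) q0, 0),
      x.2.2 < 0 → DR (k+1) (gt c (toP x.1) (toP x.2.1) x.2.2) := by
  have hdm := h.h0
  have em0 : toP (ofP (dm+1) m0) = m0 := toP_ofP _ hm.natDegree
  have eq0 : toP (ofP (dq+1) q0) = q0 := toP_ofP _ hq.natDegree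
  have hcont : ∀ ε : ℝ, Filter.Tendsto (fun x : (Fin (dm+1) → ℝ) × (Fin (dq+1) → ℝ) × ℝ => ofP (dm+1) (toP x.1 + Polynomial.C (ε * Real.sqrt (-x.2.2))))
      (nhds (ofP (dm+1) m0, ofP (dq+1) q0, 0)) (nhds (ofP (dm+1) m0)) := by
    intro ε
    have : Continuous (fun x : (Fin (dm+1) → ℝ) × (Fin (dq+1) → ℝ) × ℝ => ofP (dm+1) (toP x.1 + Polynomial.C (ε * Real.sqrt (-x.2.2)))) :=
      CP.ofP ((CP.toP (by fun_prop)).add (CP.C (by fun_prop))) _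
    have ht := this.tendsto (ofP (dm+1) m0, ofP (dq+1) q0, 0)
    simpa [em0] using ht
  have f1 := (hcont 1).eventually hm.eventually
  have f2 := (hcont (-1)).eventually hm.eventually
  have f0 := (hcont 0).eventually hm.eventually
  have f3 : ∀ᶠ x : (Fin (dm+1) → ℝ) × (Fin (dq+1) → ℝ) × ℝ in nhds (ofP (dm+1) m0, ofP (dq+1) q0, 0), DR dq (toP x.2.1) := by
    have : Continuous fun x : (Fin (dm+1) → ℝ) × (Fin (dq+1) → ℝ) × ℝ => x.2.1 := by fun_prop
    exact (this.tendsto (ofP (dm+1) m0, ofP (dq+1) q0, 0)).eventually hq.eventually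
  have f4 : ∀ᶠ x : (Fin (dm+1) → ℝ) × (Fin (dq+1) → ℝ) × ℝ in nhds (ofP (dm+1) m0, ofP (dq+1) q0, 0), (toP x.1).coeff dm ≠ 0 := by
    have : Continuous fun x : (Fin (dm+1) → ℝ) × (Fin (dq+1) → ℝ) × ℝ => (toP x.1).coeff dm := (CP.toP (by fun_prop)) dm
    exact this.continuousAt.eventually_ne (by simpa [em0] using hlead)
  have f5 : ∀ᶠ z : (Fin (dm+1) → ℝ) × (Fin (dq+1) → ℝ) × ℝ in nhds (ofP (dm+1) m0, ofP (dq+1) q0, 0),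
      ∀ x y : ℝ, ¬ (x = 0 ∧ y = 0) → hev dq (toP z.2.1) x y = 0 → hev (2 * dm + c * dm) ((toP z.1 ^ 2 + Polynomial.C z.2.2) * toP z.1 ^ c) x y ≠ 0 := by
    have cp : CP fun z : (Fin (dm+1) → ℝ) × (Fin (dq+1) → ℝ) × ℝ => toP z.1 := CP.toP (by fun_prop)
    apply nocommon_eventually
    · exact ((cp.pow 2).add (CP.C (by fun_prop))).mul (cp.pow c)
    · exact CP.toP (by fun_prop)
    · intro x y hxy h0
      simp only [em0, eq0, Polynomial.C_0, add_zero] at h0 ⊢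
      rw [hev_mul _ _ _ _ (Polynomial.natDegree_pow_le.trans (Nat.mul_le_mul_left _ hm.natDegree))
        (Polynomial.natDegree_pow_le.trans (Nat.mul_le_mul_left _ hm.natDegree)), hev_pow _ _ _ hm.natDegree, hev_pow _ _ _ hm.natDegree]
      have := hno x y hxy h0
      positivity
  filter_upwards [f0, f1, f2, f3, f4, f5] with z g0 g1 g2 g3 g4 g5 hz
  have hdz := natDegree_toP z.1
  set s := Real.sqrt (-z.2.2) with hs
  have hs0 : 0 < s := Real.sqrt_pos.2 (by linarith)
  have hs2 : s ^ 2 = -z.2.2 := Real.sq_sqrt (by linarith)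
  have hdC : ∀ ε : ℝ, (toP z.1 + Polynomial.C ε).natDegree ≤ dm := fun ε =>
    (Polynomial.natDegree_add_le _ _).trans (max_le hdz (by simp))
  rw [toP_ofP _ (hdC _)] at g0 g1 g2
  rw [zero_mul, Polynomial.C_0, add_zero] at g0
  rw [one_mul] at g1
  rw [neg_one_mul] at g2
  have hevC : ∀ ε x y : ℝ, hev dm (toP z.1 + Polynomial.C ε) x y = hev dm (toP z.1) x y + ε * x ^ dm := by
    intro ε x y
    have : Polynomial.C ε = Polynomial.C ε * Polynomial.X ^ 0 := by simp
    rw [hev_add, this, hev_C_mul, hev_X_pow _ _ (Nat.zero_le _)]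
    simp
  have hx0 : ∀ x y : ℝ, ¬ (x = 0 ∧ y = 0) → hev dm (toP z.1) x y = 0 → x ≠ 0 := by
    rintro x y hxy h0 rfl
    rw [hev_zero_left] at h0
    have hy : y ≠ 0 := fun hy => hxy ⟨rfl, hy⟩
    exact mul_ne_zero g4 (pow_ne_zero _ hy) h0
  have D1 : DR (dm + dm) ((toP z.1 + Polynomial.C s) * (toP z.1 + Polynomial.C (-s))) := by
    apply g1.mul g2
    intro x y hxy h1 h2
    rw [hevC] at h1 h2
    have a1 : hev dm (toP z.1) x y = 0 := by linarith
    have a2 : s * x ^ dm = 0 := by linarith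
    exact mul_ne_zero hs0.ne' (pow_ne_zero _ (hx0 x y hxy a1)) a2
  have e1 : (toP z.1 + Polynomial.C s) * (toP z.1 + Polynomial.C (-s)) = toP z.1 ^ 2 + Polynomial.C z.2.2 := by
    rw [show z.2.2 = - s ^ 2 by linarith]
    simp only [Polynomial.C_neg, Polynomial.C_pow]
    ring
  have D2 : DR (2 * dm + c * dm) ((toP z.1 ^ 2 + Polynomial.C z.2.2) * toP z.1 ^ c) := by
    have hD : DR (c * dm) (toP z.1 ^ c) := by
      interval_cases c
      · rw [zero_mul]; exact ⟨1, one_ne_zero, by simp⟩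
      · simpa using g0
    rw [two_mul, ← e1]
    apply D1.mul hD
    intro x y hxy h1 h2
    rw [hev_pow _ _ _ hdz] at h1
    have a1 : hev dm (toP z.1) x y = 0 := by
      by_contra hne
      exact pow_ne_zero _ hne h1
    rw [hev_mul _ _ _ _ (hdC _) (hdC _), hevC, hevC, a1] at h2
    have a2 := pow_ne_zero dm (hx0 x y hxy a1)
    have : (0 + s * x ^ dm) * (0 + -s * x ^ dm) = - (s * x ^ dm) ^ 2 := by ring
    rw [this] at h2
    have a3 : s * x ^ dm ≠ 0 := mul_ne_zero hs0.ne' a2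
    exact (neg_ne_zero.2 (pow_ne_zero 2 a3)) h2
  have D3 := D2.mul g3 g5
  have e2 : 2 * dm + c * dm + dq = k + 1 := by rw [← h.h3]; ring
  rw [e2] at D3
  exact D3

/-- auxiliary form with simple roots `2, 3, …` -/
def qq (n : ℕ) : Polynomial ℝ := ∏ i ∈ Finset.range n, lin (-((i:ℝ)+2)) 1

lemma qq_eval (n : ℕ) (x : ℝ) : (qq n).eval x = ∏ i ∈ Finset.range n, (x - ((i:ℝ)+2)) := by
  unfold qq
  rw [Polynomial.eval_prod]
  refine Finset.prod_congr rfl fun i _ => ?_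
  simp [lin]; ring

lemma qq_DR (n : ℕ) : DR n (qq n) := by
  induction n with
  | zero => exact ⟨1, one_ne_zero, by simp [qq]⟩
  | succ n ih =>
    refine ⟨qq n, -((n:ℝ)+2), 1, ih, by simp, by rw [qq, Finset.prod_range_succ]; rfl, ?_⟩
    rw [hev_one _ _ ih.natDegree, qq_eval, Finset.prod_ne_zero_iff]
    intro i hi
    have : (i:ℝ) < n := by exact_mod_cast Finset.mem_range.1 hi
    intro h0
    linarith

lemma qq_ne {n : ℕ} {x : ℝ} (hx : x ≤ 1) : (qq n).eval x ≠ 0 := by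
  rw [qq_eval, Finset.prod_ne_zero_iff]
  intro i _
  have : (0:ℝ) ≤ i := Nat.cast_nonneg i
  intro h0
  linarith

lemma qq_natDegree (n : ℕ) : (qq n).natDegree = n := by
  have hl : ∀ i : ℕ, (lin (-((i:ℝ)+2)) 1).natDegree = 1 := by
    intro i
    unfold lin
    rw [add_comm]
    exact Polynomial.natDegree_linear one_ne_zero
  unfold qq
  rw [Polynomial.natDegree_prod]
  · rw [Finset.sum_congr rfl (fun i _ => hl i)]; simp
  · intro i _
    exact lin_ne_zero (by simp)

lemma qq_coeff (n : ℕ) : (qq n).coeff n ≠ 0 := by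
  have h := Polynomial.leadingCoeff_ne_zero.2 (qq_DR n).ne_zero
  rwa [Polynomial.leadingCoeff, qq_natDegree] at h

/-- no common zeros of `qq` with a form whose affine roots are at most one -/
lemma qq_nocommon {n dm : ℕ} {m0 : Polynomial ℝ} (hd : m0.natDegree ≤ dm) (hr : ∀ x, m0.eval x = 0 → x ≤ 1) :
    ∀ x y : ℝ, ¬ (x = 0 ∧ y = 0) → hev n (qq n) x y = 0 → hev dm m0 x y ≠ 0 := by
  intro x y hxy h1 h2
  have hx : x ≠ 0 := by
    rintro rfl
    rw [hev_zero_left] at h1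
    have hy : y ≠ 0 := fun hy => hxy ⟨rfl, hy⟩
    exact mul_ne_zero (qq_coeff n) (pow_ne_zero _ hy) h1
  rw [hev_eq_eval _ _ (qq_DR n).natDegree _ _ hx] at h1
  rw [hev_eq_eval _ _ hd _ _ hx] at h2
  have a1 := (mul_eq_zero.1 h1).resolve_left (pow_ne_zero _ hx)
  have a2 := (mul_eq_zero.1 h2).resolve_left (pow_ne_zero _ hx)
  exact qq_ne (hr _ a2) a1

lemma coprime_freq {n k : ℕ} {N G : Polynomial ℝ} (hd : (N * qq n).natDegree ≤ k+1) (rs : Finset ℝ)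
    (hG : ∀ P : Polynomial ℝ, (∀ r ∈ rs, P.eval r ≠ 0) → IsCoprime G P) (hN : ∀ r ∈ rs, (N * qq n).eval r ≠ 0) (e : ℕ) :
    ∃ᶠ Q in nhds (ofP (k+2) (N * qq n)), IsCoprime (G ^ e * qq n) (toP Q) := by
  have hc : Continuous fun η : ℝ => ofP (k+2) (N * qq n + Polynomial.C η) :=
    CP.ofP ((CP.const _).add (CP.C continuous_id)) _
  have ht := hc.tendsto 0
  rw [Polynomial.C_0, add_zero] at ht
  have ht' := ht.mono_left (nhdsWithin_le_nhds (s := Set.Ioi 0))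
  apply ht'.frequently
  apply Filter.Eventually.frequently
  have h1 : ∀ᶠ η : ℝ in nhds 0, ∀ r ∈ rs, (N * qq n + Polynomial.C η).eval r ≠ 0 := by
    rw [Filter.eventually_all_finset]
    intro r hr
    have : Continuous fun η : ℝ => (N * qq n + Polynomial.C η).eval r := by
      simp only [Polynomial.eval_add, Polynomial.eval_C]; fun_prop
    exact this.continuousAt.eventually_ne (by simpa using hN r hr)
  filter_upwards [h1.filter_mono nhdsWithin_le_nhds, self_mem_nhdsWithin] with η g1 g2
  have g2 : (0:ℝ) < η := g2
  rw [toP_ofP _ ((Polynomial.natDegree_add_le _ _).trans (max_le hd (by simp)))]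
  apply IsCoprime.mul_left
  · exact (hG _ g1).pow_left
  · refine ⟨- Polynomial.C η⁻¹ * N, Polynomial.C η⁻¹, ?_⟩
    have : Polynomial.C η⁻¹ * Polynomial.C η = 1 := by rw [← Polynomial.C_mul, inv_mul_cancel₀ g2.ne', Polynomial.C_1]
    linear_combination this

end EM

namespace EM

lemma CP.eval {X : Type} [TopologicalSpace X] {F : X → Polynomial ℝ} (hF : CP F) (n : ℕ) (hd : ∀ x, (F x).natDegree ≤ n) {f : X → ℝ}
    (hf : Continuous f) : Continuous fun x => (F x).eval (f x) := by
  have := hF.hev n continuous_const hf (f := fun _ => 1)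
  refine this.congr fun x => ?_
  exact hev_one _ _ (hd x) _

lemma toP_eval_continuous {X : Type} [TopologicalSpace X] {n : ℕ} {f : X → Fin (n+1) → ℝ} (hf : Continuous f) {g : X → ℝ}
    (hg : Continuous g) : Continuous fun x => (toP (f x)).eval (g x) :=
  (CP.toP hf).eval n (fun _ => natDegree_toP _) hg

lemma toP_deriv_continuous {X : Type} [TopologicalSpace X] {n : ℕ} {f : X → Fin (n+1) → ℝ} (hf : Continuous f) {g : X → ℝ}
    (hg : Continuous g) : Continuous fun x => (toP (f x)).derivative.eval (g x) := by
  refine CP.eval (n := n) ?_ (fun x => ?_) hg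
  · intro i
    simp only [Polynomial.coeff_derivative]
    exact (CP.toP hf (i+1)).mul continuous_const
  · exact (Polynomial.natDegree_derivative_le _).trans ((Nat.sub_le _ _).trans (natDegree_toP _))

lemma root_eventually {X : Type} [TopologicalSpace X] {n : ℕ} {x0 : X} {r : ℝ} {S : X × ℝ → Prop}
    (hS : ∀ᶠ z in nhds (x0, r), S z) (y : ℝ × ℝ × ℝ) {w : Fin n → ℝ × ℝ} (hw : w ∈ Kw n) {i : Fin n} (hi : (w i).1 + (w i).2 * r = 0) :
    ∀ᶠ z : X × (ℝ × ℝ × ℝ) × (Fin n → ℝ × ℝ) in nhds (x0, y, w),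
      S (z.1, -(z.2.2 i).1 / (z.2.2 i).2) ∧ (z.2.2 i).2 ≠ 0 := by
  have hv : (w i).2 ≠ 0 := by
    intro h0
    have h1 : (w i).1 ^ 2 + (w i).2 ^ 2 = 1 := hw i trivial
    rw [h0] at hi h1
    have : (w i).1 = 0 := by linarith
    rw [this] at h1
    norm_num at h1
  have e : -(w i).1 / (w i).2 = r := by field_simp; linarith
  have c1 : Continuous fun z : X × (ℝ × ℝ × ℝ) × (Fin n → ℝ × ℝ) => (z.2.2 i).1 := by fun_prop
  have c2 : Continuous fun z : X × (ℝ × ℝ × ℝ) × (Fin n → ℝ × ℝ) => (z.2.2 i).2 := by fun_prop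
  have hc : ContinuousAt (fun z : X × (ℝ × ℝ × ℝ) × (Fin n → ℝ × ℝ) => (z.1, -(z.2.2 i).1 / (z.2.2 i).2)) (x0, y, w) := by
    refine continuousAt_fst.prodMk ?_
    exact c1.neg.continuousAt.div c2.continuousAt hv
  have ht : Filter.Tendsto (fun z : X × (ℝ × ℝ × ℝ) × (Fin n → ℝ × ℝ) => (z.1, -(z.2.2 i).1 / (z.2.2 i).2)) (nhds (x0, y, w))
      (nhds (x0, r)) := by
    have := hc.tendsto
    simpa only [e] using this
  exact (ht.eventually hS).and (c2.continuousAt.eventually_ne (x := (x0, y, w)) hv)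

/-- evaluation of the relation at a root -/
lemma Rel.eval_root {n : ℕ} {A Q : Polynomial ℝ} {y : ℝ × ℝ × ℝ} {w : Fin n → ℝ × ℝ} (h : Rel A Q y w) {i : Fin n} (hi : (w i).2 ≠ 0) :
    y.1 * A.eval (-(w i).1 / (w i).2) + y.2.1 * Q.eval (-(w i).1 / (w i).2) = 0 := by
  have := congrArg (Polynomial.eval (-(w i).1 / (w i).2)) h
  rw [Polynomial.eval_mul, gw_eval_root hi] at this
  simpa using this

lemma pos_eventually {X : Type} [TopologicalSpace X] {f : X → ℝ} (hf : Continuous f) {x0 : X} (h : 0 < f x0) : ∀ᶠ x in nhds x0, 0 < f x :=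
  Filter.Tendsto.eventually_const_lt h (hf.tendsto x0)

/-- the point spaces -/
abbrev XR (dm dq k : ℕ) : Type := (Fin (dm+1) → ℝ) × (Fin (dq+1) → ℝ) × (Fin (k+2) → ℝ) × ℝ

/-! ### the case (3,3,2,…,2) -/

/-- base quadratic -/
def m3 : Polynomial ℝ := Polynomial.X ^ 2 - 1
def N3 : Polynomial ℝ := Polynomial.X * (Polynomial.X ^ 2 + 1)

lemma m3_eq : m3 = lin (-1) 1 * lin 1 1 := by
  simp only [m3, lin, Polynomial.C_neg, Polynomial.C_1]; ring

lemma m3_natDegree : m3.natDegree = 2 := by unfold m3; compute_degree!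
lemma N3_natDegree : N3.natDegree = 3 := by unfold N3; compute_degree!
lemma m3_coeff : m3.coeff 2 ≠ 0 := by unfold m3; simp [Polynomial.coeff_one]
lemma m3_ne : m3 ≠ 0 := fun h => m3_coeff (by rw [h]; simp)
lemma m3_DR : DR 2 m3 := by
  rw [m3_eq]
  refine ⟨lin (-1) 1, 1, 1, DR_lin (by simp), by simp, rfl, ?_⟩
  rw [hev_lin]; norm_num

lemma N3Q_natDegree (K : ℕ) : (N3 * qq K).natDegree ≤ K + 3 + 1 :=
  (natDegree_mul_le' (n := 3) (m := K) N3_natDegree.le (qq_natDegree K).le).trans (by omega)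

lemma loc3 (K : ℕ) (w : Fin (K+3+1) → ℝ × ℝ) (hw : w ∈ Kw (K+3+1)) (c1 t : ℝ) (hc1 : c1 ≠ 0) (ht : t ≠ 0)
    (h : Polynomial.C c1 * (m3 ^ 2 * qq K) = Polynomial.C t * gw w) :
    ∀ᶠ z : XR 2 K (K+3) × (ℝ × ℝ × ℝ) × (Fin (K+3+1) → ℝ × ℝ) in
      nhds ((ofP 3 m3, ofP (K+1) (qq K), ofP (K+3+2) (N3 * qq K), 0), (c1, 0, t), w),
      0 < z.1.2.2.2 → ¬ Rel (gt 0 (toP z.1.1) (toP z.1.2.1) z.1.2.2.2) (toP z.1.2.2.1) z.2.1 z.2.2 := by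
  have hroot : ∀ r : ℝ, m3.eval r = 0 → ∃ i, (w i).1 + (w i).2 * r = 0 := by
    intro r hr
    apply gw_root
    have := congrArg (Polynomial.eval r) h
    simp only [Polynomial.eval_mul, Polynomial.eval_pow, hr, Polynomial.eval_C] at this
    have : t * (gw w).eval r = 0 := by rw [← this]; ring
    exact (mul_eq_zero.1 this).resolve_left ht
  obtain ⟨i, hi⟩ := hroot 1 (by simp [m3])
  obtain ⟨j, hj⟩ := hroot (-1) (by simp [m3])
  have hcont : Continuous fun z : XR 2 K (K+3) × ℝ => (toP z.1.2.1).eval z.2 * (toP z.1.2.2.1).eval z.2 :=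
    (toP_eval_continuous (by fun_prop) continuous_snd).mul (toP_eval_continuous (by fun_prop) continuous_snd)
  have v0 : ∀ r : ℝ, (toP (ofP (K+1) (qq K))).eval r * (toP (ofP (K+3+2) (N3 * qq K))).eval r
      = N3.eval r * ((qq K).eval r) ^ 2 := by
    intro r
    rw [toP_ofP _ (qq_natDegree K).le, toP_ofP _ (N3Q_natDegree K), Polynomial.eval_mul]; ring
  have s1 : ∀ᶠ z : XR 2 K (K+3) × ℝ in nhds ((ofP 3 m3, ofP (K+1) (qq K), ofP (K+3+2) (N3 * qq K), 0), 1),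
      0 < (toP z.1.2.1).eval z.2 * (toP z.1.2.2.1).eval z.2 := by
    apply pos_eventually hcont
    rw [v0]
    have : N3.eval 1 = 2 := by simp [N3]; norm_num
    rw [this]
    have := qq_ne (n := K) (x := 1) le_rfl
    positivity
  have s2 : ∀ᶠ z : XR 2 K (K+3) × ℝ in nhds ((ofP 3 m3, ofP (K+1) (qq K), ofP (K+3+2) (N3 * qq K), 0), -1),
      0 < - ((toP z.1.2.1).eval z.2 * (toP z.1.2.2.1).eval z.2) := by
    apply pos_eventually hcont.neg
    simp only [Pi.neg_apply, v0]
    have : N3.eval (-1) = -2 := by simp [N3]; norm_num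
    rw [this]
    have := qq_ne (n := K) (x := -1) (by norm_num)
    have : 0 < ((qq K).eval (-1)) ^ 2 := by positivity
    linarith
  have cc : Continuous fun z : XR 2 K (K+3) × (ℝ × ℝ × ℝ) × (Fin (K+3+1) → ℝ × ℝ) => z.2.1.1 := by fun_prop
  filter_upwards [root_eventually s1 (c1, 0, t) hw hi, root_eventually s2 (c1, 0, t) hw hj,
    cc.continuousAt.eventually_ne (x := ((ofP 3 m3, ofP (K+1) (qq K), ofP (K+3+2) (N3 * qq K), 0), (c1, 0, t), w)) hc1]
    with z a1 a2 a3 a4 hrel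
  obtain ⟨a1, b1⟩ := a1
  obtain ⟨a2, b2⟩ := a2
  have e1 := hrel.eval_root b1
  have e2 := hrel.eval_root b2
  have key : ∀ m q Q c c' τ : ℝ, c ≠ 0 → 0 < τ → q * Q ≠ 0 → c * ((m^2+τ)*m^0*q) + c' * Q = 0 → c * c' * (q * Q) < 0 := by
    intro m q Q c c' τ hc hτ hq he
    have hq0 : q ≠ 0 := left_ne_zero_of_mul hq
    have : c * c' * (q * Q) = - (c^2 * (m^2+τ) * q^2) := by linear_combination (c * q) * he
    rw [this]
    have : 0 < c^2 * (m^2+τ) * q^2 := by positivity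
    linarith
  simp only [gt, Polynomial.eval_mul, Polynomial.eval_add, Polynomial.eval_pow, Polynomial.eval_C] at e1 e2
  have k1 := key _ _ _ _ _ _ a3 a4 a1.ne' e1
  have k2 := key _ _ _ _ _ _ a3 a4 (by intro h0; rw [h0] at a2; simp at a2) e2
  nlinarith

lemma coeff4 {n : ℕ} (hn : n = 4) {p : Polynomial ℝ} (h : RR n p) : ∃ c u0 u1 u2 u3 v0 v1 v2 v3 : ℝ, c ≠ 0 ∧
    u0^2+v0^2 = 1 ∧ u1^2+v1^2=1 ∧ u2^2+v2^2=1 ∧ u3^2+v3^2=1 ∧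
    p = Polynomial.C c * (lin u0 v0 * lin u1 v1 * lin u2 v2 * lin u3 v3) := by
  subst hn
  obtain ⟨c, u, v, hc, huv, rfl⟩ := h
  exact ⟨c, u 0, u 1, u 2, u 3, v 0, v 1, v 2, v 3, hc, huv 0, huv 1, huv 2, huv 3, by rw [Fin.prod_univ_four]⟩

lemma expand4 (c u0 u1 u2 u3 v0 v1 v2 v3 : ℝ) : Polynomial.C c * (lin u0 v0 * lin u1 v1 * lin u2 v2 * lin u3 v3) =
    Polynomial.C (c * (u0*u1*u2*u3)) + Polynomial.C (c * (v0*u1*u2*u3+u0*v1*u2*u3+u0*u1*v2*u3+u0*u1*u2*v3)) * Polynomial.X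
    + Polynomial.C (c * (v0*v1*u2*u3+v0*u1*v2*u3+v0*u1*u2*v3+u0*v1*v2*u3+u0*v1*u2*v3+u0*u1*v2*v3)) * Polynomial.X^2
    + Polynomial.C (c * (u0*v1*v2*v3+v0*u1*v2*v3+v0*v1*u2*v3+v0*v1*v2*u3)) * Polynomial.X^3
    + Polynomial.C (c * (v0*v1*v2*v3)) * Polynomial.X^4 := by
  simp only [lin, Polynomial.C_mul, Polynomial.C_add]; ring

lemma quartic_ext {a0 a1 a2 a3 a4 b0 b1 b2 b3 b4 : ℝ}
    (h : Polynomial.C a0 + Polynomial.C a1 * Polynomial.X + Polynomial.C a2 * Polynomial.X^2 + Polynomial.C a3 * Polynomial.X^3 + Polynomial.C a4 * Polynomial.X^4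
     = Polynomial.C b0 + Polynomial.C b1 * Polynomial.X + Polynomial.C b2 * Polynomial.X^2 + Polynomial.C b3 * Polynomial.X^3 + Polynomial.C b4 * Polynomial.X^4) :
    a0 = b0 ∧ a1 = b1 ∧ a2 = b2 ∧ a3 = b3 ∧ a4 = b4 := by
  have g := fun i => congrArg (fun p => Polynomial.coeff p i) h
  have g0 := g 0
  have g1 := g 1
  have g2 := g 2
  have g3 := g 3
  have g4 := g 4
  simp [Polynomial.coeff_X, Polynomial.coeff_X_pow, Polynomial.coeff_C] at g0 g1 g2 g3 g4
  exact ⟨g0, g1, g2, g3, g4⟩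

lemma base3 {c1 c2 : ℝ} (hc2 : c2 ≠ 0) : ¬ RR 4 (Polynomial.C c1 * m3 ^ 2 + Polynomial.C c2 * N3) := by
  intro h
  obtain ⟨c, u0, u1, u2, u3, v0, v1, v2, v3, hc, n0, n1, n2, n3, e⟩ := coeff4 rfl h
  rw [expand4] at e
  have e' : Polynomial.C c1 + Polynomial.C c2 * Polynomial.X + Polynomial.C (-2*c1) * Polynomial.X^2 + Polynomial.C c2 * Polynomial.X^3 + Polynomial.C c1 * Polynomial.X^4 = Polynomial.C c1 * m3 ^ 2 + Polynomial.C c2 * N3 := by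
    simp only [m3, N3, Polynomial.C_mul, Polynomial.C_neg]
    rw [show (Polynomial.C (2:ℝ)) = 2 from rfl]
    ring
  rw [← e'] at e
  obtain ⟨g0, g1, g2, g3, g4⟩ := quartic_ext e
  have r0 : c1 * (u0^2-v0^2)^2 = c2 * (u0*v0) := by
    linear_combination g0*v0^4 - g1*v0^3*u0 + g2*v0^2*u0^2 - g3*v0*u0^3 + g4*u0^4 + c2*u0*v0*n0
  have r1 : c1 * (u1^2-v1^2)^2 = c2 * (u1*v1) := by
    linear_combination g0*v1^4 - g1*v1^3*u1 + g2*v1^2*u1^2 - g3*v1*u1^3 + g4*u1^4 + c2*u1*v1*n1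
  have r2 : c1 * (u2^2-v2^2)^2 = c2 * (u2*v2) := by
    linear_combination g0*v2^4 - g1*v2^3*u2 + g2*v2^2*u2^2 - g3*v2*u2^3 + g4*u2^4 + c2*u2*v2*n2
  have r3 : c1 * (u3^2-v3^2)^2 = c2 * (u3*v3) := by
    linear_combination g0*v3^4 - g1*v3^3*u3 + g2*v3^2*u3^2 - g3*v3*u3^3 + g4*u3^4 + c2*u3*v3*n3
  by_cases hc1 : c1 = 0
  · have z : ∀ u v : ℝ, c1 * (u^2-v^2)^2 = c2 * (u*v) → u * v = 0 := by
      intro u v h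
      rw [hc1, zero_mul] at h
      exact (mul_eq_zero.1 h.symm).resolve_left hc2
    have z0 := z _ _ r0
    have z1 := z _ _ r1
    have z2 := z _ _ r2
    have z3 := z _ _ r3
    have : c2 * c2 = 0 := by
      rcases mul_eq_zero.1 z0 with h | h <;> rcases mul_eq_zero.1 z1 with h' | h' <;>
      rcases mul_eq_zero.1 z2 with h'' | h'' <;> rcases mul_eq_zero.1 z3 with h3 | h3 <;>
      simp [h, h', h'', h3] at g1 g3 <;>
      first | exact mul_eq_zero_of_left g1 _ | exact mul_eq_zero_of_left g3 _
    exact hc2 (mul_self_eq_zero.1 this)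
  · have z : ∀ u v s t : ℝ, c1 * (u^2-v^2)^2 = c2 * (u*v) → c1 * (s^2-t^2)^2 = c2 * (s*t) → 0 ≤ (u * v) * (s * t) := by
      intro u v s t h h'
      have : 0 ≤ c2^2 * ((u * v) * (s * t)) := by
        have : c2^2 * ((u * v) * (s * t)) = c1^2 * ((u^2-v^2)^2 * (s^2-t^2)^2) := by
          calc _ = (c2 * (u*v)) * (c2 * (s*t)) := by ring
            _ = _ := by rw [← h, ← h']; ring
        rw [this]; positivity
      exact nonneg_of_mul_nonneg_right this (by positivity)
    have p1 := mul_nonneg (z _ _ _ _ r0 r1) (sq_nonneg (u2*u3))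
    have p2 := mul_nonneg (z _ _ _ _ r0 r2) (sq_nonneg (u1*u3))
    have p3 := mul_nonneg (z _ _ _ _ r0 r3) (sq_nonneg (u1*u2))
    have p4 := mul_nonneg (z _ _ _ _ r1 r2) (sq_nonneg (u0*u3))
    have p5 := mul_nonneg (z _ _ _ _ r1 r3) (sq_nonneg (u0*u2))
    have p6 := mul_nonneg (z _ _ _ _ r2 r3) (sq_nonneg (u0*u1))
    have p := mul_nonneg (sq_nonneg c) (add_nonneg p1 (add_nonneg p2 (add_nonneg p3 (add_nonneg p4 (add_nonneg p5 p6)))))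
    have q : c1 * (-2 * c1) < 0 := by
      have : 0 < c1^2 := by positivity
      nlinarith
    have e3 : c1 * (-2 * c1) = (c * (u0*u1*u2*u3)) * (c * (v0*v1*u2*u3+v0*u1*v2*u3+v0*u1*u2*v3+u0*v1*v2*u3+u0*v1*u2*v3+u0*u1*v2*v3)) := by
      rw [← g0, ← g2]
    rw [e3] at q
    refine absurd p (not_le.2 (lt_of_eq_of_lt ?_ q))
    ring

lemma main3 (K : ℕ) : Gam 0 2 K (K+3) ⊆ zClosure (cx '' topBoundary (2*(K+3)) (K+3+1)) := by
  apply Gam_subset (par3 K)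
  have tm : toP (ofP (2+1) m3) = m3 := toP_ofP _ m3_natDegree.le
  have tq : toP (ofP (K+1) (qq K)) = qq K := toP_ofP _ (qq_natDegree K).le
  have tQ : toP (ofP (K+3+2) (N3 * qq K)) = N3 * qq K := toP_ofP _ (N3Q_natDegree K)
  have hq0 : qq K ≠ 0 := (qq_DR K).ne_zero
  have hr : ∀ x, m3.eval x = 0 → x ≤ 1 := by
    intro x hx
    have : x^2 - 1 = 0 := by simpa [m3] using hx
    nlinarith
  apply boundary_real (par3 K) (ofP (2+1) m3) (ofP (K+1) (qq K)) (ofP (K+3+2) (N3 * qq K))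
  · rw [tm, m3_natDegree]
  · rw [tq, qq_natDegree]
  · rw [tm]; exact m3_ne
  · rw [tq]; exact hq0
  · have hA : CP fun x : XR 2 K (K+3) => gt 0 (toP x.1) (toP x.2.1) x.2.2.2 :=
      CP.gt 0 (CP.toP (by fun_prop)) (CP.toP (by fun_prop)) (by fun_prop)
    have hQ : CP fun x : XR 2 K (K+3) => toP x.2.2.1 := CP.toP (by fun_prop)
    have hx : gt 0 m3 (qq K) 0 = m3 ^ 2 * qq K := by rw [gt_zero]
    have hfac : ∀ c1 c2 : ℝ, Polynomial.C c1 * (m3 ^ 2 * qq K) + Polynomial.C c2 * (N3 * qq K) =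
        (Polynomial.C c1 * m3 ^ 2 + Polynomial.C c2 * N3) * qq K := by intros; ring
    apply Non_eventually hA hQ (P := fun x => 0 < x.2.2.2)
    · intro c1 c2 h
      dsimp only at h
      rw [tm, tq, tQ, hx, hfac] at h
      have h := (mul_eq_zero.1 h).resolve_right hq0
      have g := fun r => congrArg (Polynomial.eval r) h
      have g0 := g 0
      have g1 := g 1
      simp [m3, N3] at g0 g1
      refine ⟨g0, ?_⟩
      exact g1
    · intro c1 c2 hc2 h
      dsimp only at h
      rw [tm, tq, tQ, hx, hfac, show K+3+1 = 4 + K by omega] at h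
      refine base3 hc2 (RR.cancel_DR (qq_DR K) ?_ h)
      unfold m3 N3; compute_degree
    · intro w hw c1 t hc1 ht h
      dsimp only at h
      rw [tm, tq, hx] at h
      exact loc3 K w hw c1 t hc1 ht h
  · exact DR_gt_eventually (par3 K) (by omega) m3_DR (qq_DR K) m3_coeff (qq_nocommon m3_natDegree.le hr)
  · rw [tm, tq]
    refine coprime_freq (N3Q_natDegree K) {1, -1} ?_ ?_ _
    · intro P hP
      have h1 := hP 1 (by simp)
      have h2 := hP (-1) (by simp)
      rw [m3_eq]
      have aux : ∀ r : ℝ, P.eval r ≠ 0 → IsCoprime (Polynomial.X - Polynomial.C r) P := by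
        intro r hr
        rw [(Polynomial.irreducible_X_sub_C r).coprime_iff_not_dvd, Polynomial.dvd_iff_isRoot]
        exact hr
      apply IsCoprime.mul_left
      · have := aux 1 h1
        convert this using 1
        simp [lin]; ring
      · have := aux (-1) h2
        convert this using 1
        simp [lin]; ring
    · intro r hr
      have : r = 1 ∨ r = -1 := by simpa using hr
      rw [Polynomial.eval_mul]
      refine mul_ne_zero ?_ (qq_ne ?_)
      · rcases this with rfl | rfl <;> simp [N3] <;> norm_num
      · rcases this with rfl | rfl <;> norm_num

end EM

namespace EM

/-! ### the case (4,2,…,2) -/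

lemma rolle_W {A Q : Polynomial ℝ} {ε a b s : ℝ}
    (hW : ∀ ξ, |ξ| < ε → Q.eval ξ ≠ 0 ∧ 0 < A.derivative.eval ξ * Q.eval ξ - A.eval ξ * Q.derivative.eval ξ)
    (ha : |a| < ε) (hb : |b| < ε) (hab : a < b) (h1 : A.eval a = s * Q.eval a) (h2 : A.eval b = s * Q.eval b) : False := by
  have hin : ∀ x ∈ Set.Icc a b, |x| < ε := by
    intro x hx
    rw [abs_lt] at *
    exact ⟨by linarith [hx.1], by linarith [hx.2]⟩
  have hd : ∀ x ∈ Set.Icc a b, HasDerivAt (fun x => A.eval x / Q.eval x)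
      ((A.derivative.eval x * Q.eval x - A.eval x * Q.derivative.eval x) / (Q.eval x)^2) x := by
    intro x hx
    exact (A.hasDerivAt x).div (Q.hasDerivAt x) (hW x (hin x hx)).1
  obtain ⟨ξ, hξ, h0⟩ := exists_hasDerivAt_eq_zero hab (fun x hx => (hd x hx).continuousAt.continuousWithinAt)
    (show A.eval a / Q.eval a = A.eval b / Q.eval b by
      rw [h1, h2, mul_div_cancel_right₀ _ (hW a ha).1, mul_div_cancel_right₀ _ (hW b hb).1])
    (fun x hx => hd x (Set.Ioo_subset_Icc_self hx))
  obtain ⟨g1, g2⟩ := hW ξ (hin ξ (Set.Ioo_subset_Icc_self hξ))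
  have : 0 < (A.derivative.eval ξ * Q.eval ξ - A.eval ξ * Q.derivative.eval ξ) / (Q.eval ξ)^2 := by positivity
  exact this.ne' h0

lemma two_roots {n : ℕ} {A Q : Polynomial ℝ} {ε : ℝ} {y : ℝ × ℝ × ℝ} {w : Fin n → ℝ × ℝ} {i j : Fin n}
    (hW : ∀ ξ, |ξ| < ε → Q.eval ξ ≠ 0 ∧ 0 < A.derivative.eval ξ * Q.eval ξ - A.eval ξ * Q.derivative.eval ξ)
    (hy : y.1 ≠ 0) (hij : i ≠ j) (hi : (w i).2 ≠ 0) (hj : (w j).2 ≠ 0)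
    (ri : |-(w i).1 / (w i).2| < ε) (rj : |-(w j).1 / (w j).2| < ε) (h : Rel A Q y w) : False := by
  have e1 := h.eval_root hi
  have e2 := h.eval_root hj
  have f1 : A.eval (-(w i).1 / (w i).2) = (-y.2.1/y.1) * Q.eval (-(w i).1 / (w i).2) := by
    have : A.eval (-(w i).1 / (w i).2) = (y.1 * A.eval (-(w i).1 / (w i).2)) / y.1 := by rw [mul_div_cancel_left₀ _ hy]
    rw [this, eq_neg_of_add_eq_zero_left e1]; ring
  have f2 : A.eval (-(w j).1 / (w j).2) = (-y.2.1/y.1) * Q.eval (-(w j).1 / (w j).2) := by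
    have : A.eval (-(w j).1 / (w j).2) = (y.1 * A.eval (-(w j).1 / (w j).2)) / y.1 := by rw [mul_div_cancel_left₀ _ hy]
    rw [this, eq_neg_of_add_eq_zero_left e2]; ring
  rcases lt_trichotomy (-(w i).1 / (w i).2) (-(w j).1 / (w j).2) with hlt | heq | hlt
  · exact rolle_W hW ri rj hlt f1 f2
  · obtain ⟨p, hp⟩ := gw_two w hij
    have h' : Polynomial.C y.1 * A + Polynomial.C y.2.1 * Q = Polynomial.C y.2.2 * gw w := h
    rw [hp] at h'
    have d := congrArg (fun p => (Polynomial.derivative p).eval (-(w i).1 / (w i).2)) h'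
    have l1 : (lin (w i).1 (w i).2).eval (-(w i).1 / (w i).2) = 0 := by simp [lin]; field_simp; ring
    have l2 : (lin (w j).1 (w j).2).eval (-(w i).1 / (w i).2) = 0 := by rw [heq]; simp [lin]; field_simp; ring
    simp only [Polynomial.derivative_mul, Polynomial.derivative_add, Polynomial.derivative_C, Polynomial.eval_add, Polynomial.eval_mul, l1, l2,
      Polynomial.eval_C, Polynomial.eval_zero, zero_mul, mul_zero, zero_add, add_zero] at d
    obtain ⟨g1, g2⟩ := hW _ ri
    have : y.1 * (A.derivative.eval (-(w i).1 / (w i).2) * Q.eval (-(w i).1 / (w i).2) - A.eval (-(w i).1 / (w i).2) * Q.derivative.eval (-(w i).1 / (w i).2)) = 0 := by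
      linear_combination Q.eval (-(w i).1 / (w i).2) * d - Q.derivative.eval (-(w i).1 / (w i).2) * e1
    exact (mul_ne_zero hy g2.ne') this
  · exact rolle_W hW rj ri hlt f2 f1

def N4 : Polynomial ℝ := Polynomial.X ^ 2 + 1
lemma N4_natDegree : N4.natDegree = 2 := by unfold N4; compute_degree!

lemma N4Q_natDegree (K : ℕ) : (N4 * qq (K+1)).natDegree ≤ K + 3 + 1 :=
  (natDegree_mul_le' (n := 2) (m := K+1) N4_natDegree.le (qq_natDegree (K+1)).le).trans (by omega)

lemma loc4 (K : ℕ) (w : Fin (K+3+1) → ℝ × ℝ) (hw : w ∈ Kw (K+3+1)) (c1 t : ℝ) (hc1 : c1 ≠ 0) (ht : t ≠ 0)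
    (h : Polynomial.C c1 * (Polynomial.X ^ 3 * qq (K+1)) = Polynomial.C t * gw w) :
    ∀ᶠ z : XR 1 (K+1) (K+3) × (ℝ × ℝ × ℝ) × (Fin (K+3+1) → ℝ × ℝ) in
      nhds ((ofP 2 Polynomial.X, ofP (K+1+1) (qq (K+1)), ofP (K+3+2) (N4 * qq (K+1)), 0), (c1, 0, t), w),
      0 < z.1.2.2.2 → ¬ Rel (gt 1 (toP z.1.1) (toP z.1.2.1) z.1.2.2.2) (toP z.1.2.2.1) z.2.1 z.2.2 := by
  have hg : gw w = Polynomial.X ^ 2 * (Polynomial.C (t⁻¹ * c1) * Polynomial.X * qq (K+1)) := by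
    have : Polynomial.C t⁻¹ * Polynomial.C t = 1 := by rw [← Polynomial.C_mul, inv_mul_cancel₀ ht, Polynomial.C_1]
    rw [Polynomial.C_mul]
    linear_combination (-Polynomial.C t⁻¹) * h - gw w * this
  obtain ⟨i, j, hij, hi, hj⟩ := gw_double hg hw
  have cm : Continuous fun z : XR 1 (K+1) (K+3) × ℝ => (toP z.1.1).eval z.2 := toP_eval_continuous (by fun_prop) continuous_snd
  have cm' : Continuous fun z : XR 1 (K+1) (K+3) × ℝ => (toP z.1.1).derivative.eval z.2 := toP_deriv_continuous (by fun_prop) continuous_snd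
  have cq : Continuous fun z : XR 1 (K+1) (K+3) × ℝ => (toP z.1.2.1).eval z.2 := toP_eval_continuous (by fun_prop) continuous_snd
  have cq' : Continuous fun z : XR 1 (K+1) (K+3) × ℝ => (toP z.1.2.1).derivative.eval z.2 := toP_deriv_continuous (by fun_prop) continuous_snd
  have cQ : Continuous fun z : XR 1 (K+1) (K+3) × ℝ => (toP z.1.2.2.1).eval z.2 := toP_eval_continuous (by fun_prop) continuous_snd
  have cQ' : Continuous fun z : XR 1 (K+1) (K+3) × ℝ => (toP z.1.2.2.1).derivative.eval z.2 := toP_deriv_continuous (by fun_prop) continuous_snd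
  have tm : toP (ofP (1+1) (Polynomial.X : Polynomial ℝ)) = Polynomial.X := toP_ofP _ Polynomial.natDegree_X_le
  have tq : toP (ofP (K+1+1) (qq (K+1))) = qq (K+1) := toP_ofP _ (qq_natDegree _).le
  have tQ : toP (ofP (K+3+2) (N4 * qq (K+1))) = N4 * qq (K+1) := toP_ofP _ (N4Q_natDegree K)
  have hq := qq_ne (n := K+1) (x := 0) zero_le_one
  have hqq : 0 < (qq (K+1)).eval 0 * (qq (K+1)).eval 0 := mul_self_pos.2 hq
  have s1 := pos_eventually (x0 := ((ofP 2 Polynomial.X, ofP (K+1+1) (qq (K+1)), ofP (K+3+2) (N4 * qq (K+1)), 0), (0:ℝ))) ((cm'.mul cq).mul cQ) (by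
    simp only [Pi.mul_apply, Pi.add_apply, Pi.sub_apply]
    rw [show ofP 2 (Polynomial.X : Polynomial ℝ) = ofP (1+1) Polynomial.X from rfl, tm, tq, tQ]
    simpa [N4] using hqq)
  have s2 := pos_eventually (x0 := ((ofP 2 Polynomial.X, ofP (K+1+1) (qq (K+1)), ofP (K+3+2) (N4 * qq (K+1)), 0), (0:ℝ))) (((cm'.mul cq).mul cQ).add (cm.mul ((cq'.mul cQ).sub (cq.mul cQ')))) (by
    simp only [Pi.mul_apply, Pi.add_apply, Pi.sub_apply]
    rw [show ofP 2 (Polynomial.X : Polynomial ℝ) = ofP (1+1) Polynomial.X from rfl, tm, tq, tQ]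
    simpa [N4] using hqq)
  simp only [Pi.mul_apply, Pi.add_apply, Pi.sub_apply] at s1 s2
  have s3 := s1.and s2
  rw [nhds_prod_eq, Filter.eventually_prod_iff] at s3
  obtain ⟨pa, ha, pb, hb, hS⟩ := s3
  obtain ⟨ε, hε, hball⟩ := Metric.eventually_nhds_iff.1 hb
  have s4 : ∀ᶠ z : XR 1 (K+1) (K+3) × ℝ in nhds ((ofP 2 Polynomial.X, ofP (K+1+1) (qq (K+1)), ofP (K+3+2) (N4 * qq (K+1)), 0), (0:ℝ)),
      pa z.1 ∧ |z.2| < ε := by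
    rw [nhds_prod_eq]
    refine ha.prod_mk (pb := fun r : ℝ => |r| < ε) ?_
    filter_upwards [Metric.ball_mem_nhds (0:ℝ) hε] with r hr
    simpa using hr
  have cc : Continuous fun z : XR 1 (K+1) (K+3) × (ℝ × ℝ × ℝ) × (Fin (K+3+1) → ℝ × ℝ) => z.2.1.1 := by fun_prop
  filter_upwards [root_eventually s4 (c1, 0, t) hw (i := i) (by rw [hi]; ring), root_eventually s4 (c1, 0, t) hw (i := j) (by rw [hj]; ring),
    cc.continuousAt.eventually_ne (x := ((ofP 2 Polynomial.X, ofP (K+1+1) (qq (K+1)), ofP (K+3+2) (N4 * qq (K+1)), 0), (c1, 0, t), w)) hc1]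
    with z a1 a2 a3 a4 hrel
  refine two_roots (ε := ε) ?_ a3 hij a1.2 a2.2 a1.1.2 a2.1.2 hrel
  intro ξ hξ
  obtain ⟨g1, g2⟩ := hS a1.1.1 (hball (y := ξ) (by simpa using hξ))
  refine ⟨fun h0 => by simp [h0] at g1, ?_⟩
  simp only [gt, Polynomial.derivative_mul, Polynomial.derivative_add, Polynomial.derivative_C, Polynomial.derivative_pow, Polynomial.eval_add,
    Polynomial.eval_mul, Polynomial.eval_pow, Polynomial.eval_C, pow_one, add_zero, Polynomial.eval_natCast]
  set m := (toP z.1.1).eval ξ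
  set m' := (toP z.1.1).derivative.eval ξ
  set q := (toP z.1.2.1).eval ξ
  set q' := (toP z.1.2.1).derivative.eval ξ
  set Q := (toP z.1.2.2.1).eval ξ
  set Q' := (toP z.1.2.2.1).derivative.eval ξ
  set τ := z.1.2.2.2
  have p1 : 0 < (m^2+τ) * (m' * q * Q + m * (q' * Q - q * Q')) := mul_pos (by positivity) g2
  have p2 : 0 ≤ 2 * m^2 * (m' * q * Q) := mul_nonneg (by positivity) g1.le
  refine lt_of_lt_of_eq (add_pos_of_pos_of_nonneg p1 p2) ?_
  push_cast
  ring

lemma coeff3 {n : ℕ} (hn : n = 3) {p : Polynomial ℝ} (h : RR n p) : ∃ c u0 u1 u2 v0 v1 v2 : ℝ, c ≠ 0 ∧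
    p = Polynomial.C c * (lin u0 v0 * lin u1 v1 * lin u2 v2) := by
  subst hn
  obtain ⟨c, u, v, hc, huv, rfl⟩ := h
  exact ⟨c, u 0, u 1, u 2, v 0, v 1, v 2, hc, by rw [Fin.prod_univ_three]⟩

lemma base4 {c1 c2 : ℝ} (hc2 : c2 ≠ 0) : ¬ RR 3 (Polynomial.C c1 * Polynomial.X ^ 3 + Polynomial.C c2 * N4) := by
  intro h
  obtain ⟨c, u0, u1, u2, v0, v1, v2, hc, e⟩ := coeff3 rfl h
  have e1 : Polynomial.C c * (lin u0 v0 * lin u1 v1 * lin u2 v2) = Polynomial.C (c * (u0*u1*u2)) + Polynomial.C (c * (v0*u1*u2+u0*v1*u2+u0*u1*v2)) * Polynomial.X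
      + Polynomial.C (c * (v0*v1*u2+v0*u1*v2+u0*v1*v2)) * Polynomial.X^2 + Polynomial.C (c * (v0*v1*v2)) * Polynomial.X^3 + Polynomial.C 0 * Polynomial.X^4 := by
    simp only [lin, Polynomial.C_mul, Polynomial.C_add, Polynomial.C_0]; ring
  have e' : Polynomial.C c2 + Polynomial.C 0 * Polynomial.X + Polynomial.C c2 * Polynomial.X^2 + Polynomial.C c1 * Polynomial.X^3 + Polynomial.C 0 * Polynomial.X^4 = Polynomial.C c1 * Polynomial.X ^ 3 + Polynomial.C c2 * N4 := by
    simp only [N4, Polynomial.C_0]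
    ring
  rw [← e', e1] at e
  obtain ⟨g0, g1, g2, g3, -⟩ := quartic_ext e
  have s1 : v0*u1*u2+u0*v1*u2+u0*u1*v2 = 0 := (mul_eq_zero.1 g1.symm).resolve_left hc
  have : c2 * c2 = c^2 * ((u0*u1*u2) * (v0*v1*u2+v0*u1*v2+u0*v1*v2)) := by
    calc c2 * c2 = (c * (u0*u1*u2)) * (c * (v0*v1*u2+v0*u1*v2+u0*v1*v2)) := by rw [← g0, ← g2]
      _ = _ := by ring
  have k : 2 * ((u0*u1*u2) * (v0*v1*u2+v0*u1*v2+u0*v1*v2)) = - ((v0*u1*u2)^2 + (u0*v1*u2)^2 + (u0*u1*v2)^2) := by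
    linear_combination (v0*u1*u2+u0*v1*u2+u0*u1*v2) * s1
  have k2 : (u0*u1*u2) * (v0*v1*u2+v0*u1*v2+u0*v1*v2) ≤ 0 := by
    have : 0 ≤ (v0*u1*u2)^2 + (u0*v1*u2)^2 + (u0*u1*v2)^2 := by positivity
    linarith
  have k3 := mul_nonpos_of_nonneg_of_nonpos (sq_nonneg c) k2
  have : 0 < c2 * c2 := mul_self_pos.2 hc2
  linarith

lemma main4 (K : ℕ) : Gam 1 1 (K+1) (K+3) ⊆ zClosure (cx '' topBoundary (2*(K+3)) (K+3+1)) := by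
  apply Gam_subset (par4 K)
  have tm : toP (ofP (1+1) (Polynomial.X : Polynomial ℝ)) = Polynomial.X := toP_ofP _ Polynomial.natDegree_X_le
  have tq : toP (ofP (K+1+1) (qq (K+1))) = qq (K+1) := toP_ofP _ (qq_natDegree _).le
  have tQ : toP (ofP (K+3+2) (N4 * qq (K+1))) = N4 * qq (K+1) := toP_ofP _ (N4Q_natDegree K)
  have hq0 : qq (K+1) ≠ 0 := (qq_DR _).ne_zero
  have hX : DR 1 (Polynomial.X : Polynomial ℝ) := by
    have := DR_lin (u := 0) (v := 1) (by simp)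
    have e : lin (0:ℝ) 1 = Polynomial.X := by simp [lin]
    rwa [e] at this
  apply boundary_real (par4 K) (ofP (1+1) Polynomial.X) (ofP (K+1+1) (qq (K+1))) (ofP (K+3+2) (N4 * qq (K+1)))
  · rw [tm, Polynomial.natDegree_X]
  · rw [tq, qq_natDegree]
  · rw [tm]; exact Polynomial.X_ne_zero
  · rw [tq]; exact hq0
  · have hA : CP fun x : XR 1 (K+1) (K+3) => gt 1 (toP x.1) (toP x.2.1) x.2.2.2 :=
      CP.gt 1 (CP.toP (by fun_prop)) (CP.toP (by fun_prop)) (by fun_prop)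
    have hQ : CP fun x : XR 1 (K+1) (K+3) => toP x.2.2.1 := CP.toP (by fun_prop)
    have hx : gt 1 Polynomial.X (qq (K+1)) 0 = Polynomial.X ^ 3 * qq (K+1) := by rw [gt_zero]
    have hfac : ∀ c1 c2 : ℝ, Polynomial.C c1 * (Polynomial.X ^ 3 * qq (K+1)) + Polynomial.C c2 * (N4 * qq (K+1)) =
        (Polynomial.C c1 * Polynomial.X ^ 3 + Polynomial.C c2 * N4) * qq (K+1) := by intros; ring
    apply Non_eventually hA hQ (P := fun x => 0 < x.2.2.2)
    · intro c1 c2 h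
      dsimp only at h
      rw [tm, tq, tQ, hx, hfac] at h
      have h := (mul_eq_zero.1 h).resolve_right hq0
      have g := fun r => congrArg (Polynomial.eval r) h
      have g0 := g 0
      have g1 := g 1
      simp [N4] at g0 g1
      rw [g0] at g1
      exact ⟨by simpa using g1, g0⟩
    · intro c1 c2 hc2 h
      dsimp only at h
      rw [tm, tq, tQ, hx, hfac, show K+3+1 = 3 + (K+1) by omega] at h
      refine base4 hc2 (RR.cancel_DR (qq_DR _) ?_ h)
      unfold N4; compute_degree
    · intro w hw c1 t hc1 ht h
      dsimp only at h
      rw [tm, tq, hx] at h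
      exact loc4 K w hw c1 t hc1 ht h
  · exact DR_gt_eventually (par4 K) (by omega) hX (qq_DR _) (by simp) (qq_nocommon Polynomial.natDegree_X_le (fun x hx => by
      have : x = 0 := by simpa using hx
      rw [this]; exact zero_le_one))
  · rw [tm, tq]
    refine coprime_freq (N4Q_natDegree K) {0} ?_ ?_ _
    · intro P hP
      have h1 := hP 0 (by simp)
      have e : (Polynomial.X : Polynomial ℝ) = Polynomial.X - Polynomial.C 0 := by simp
      rw [e, (Polynomial.irreducible_X_sub_C (0:ℝ)).coprime_iff_not_dvd, Polynomial.dvd_iff_isRoot]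
      exact h1
    · intro r hr
      have : r = 0 := by simpa using hr
      rw [this, Polynomial.eval_mul]
      refine mul_ne_zero ?_ (qq_ne zero_le_one)
      simp [N4]

theorem final (k : ℕ) (hk : 3 ≤ k) :
    algBoundary (2*k) (k+1)
      = dualConeOf (2*k)
          (crlCone (2*k) (k-1) fun t => if (t : ℕ) < 2 then 3 else 2) k ∪
        dualConeOf (2*k)
          (crlCone (2*k) (k-1) fun t => if (t : ℕ) = 0 then 4 else 2) k := by
  obtain ⟨K, rfl⟩ : ∃ K, k = K + 3 := ⟨k - 3, by omega⟩
  rw [crl3, crl4, propI (par3 K), propI (par4 K)]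
  have e : algBoundary (2*(K+3)) (K+3+1) = zClosure (cx '' topBoundary (2*(K+3)) (K+3+1)) := rfl
  rw [e]
  apply Set.Subset.antisymm
  · rw [← zClosure_union]
    apply zClosure_mono
    rintro _ ⟨a, ha, rfl⟩
    exact propII K ha
  · exact Set.union_subset (zClosure_min (main3 K)) (zClosure_min (main4 K))

end EM

/-- for even degree `d = 2k` (`k ≥ 3`), the algebraic boundary of the region
of forms of minimal typical rank `k+1` is the union of the two dual hypersurfaces
`(Δ_{(3,3,2^{k−3})})^∨ ∪ (Δ_{(4,2^{k−2})})^∨`. -/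
theorem even_minimal_typical_rank_boundary (k : ℕ) (hk : 3 ≤ k) :
    algBoundary (2*k) (k+1)
      = dualConeOf (2*k)
          (crlCone (2*k) (k-1) fun t => if (t : ℕ) < 2 then 3 else 2) k ∪
        dualConeOf (2*k)
          (crlCone (2*k) (k-1) fun t => if (t : ℕ) = 0 then 4 else 2) k := by
  exact EM.final k hk
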